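/- Let τ: B⊗A → A⊗B be a one-sided graded twisting map. Then: (1) if A and B are quadratic 𝕜-algebras, the twisted tensor product A⊗_τB is quadratic; (2) if A and B are Koszul 𝕜-algebras, then A⊗_τB is Koszul. -/

import Mathlib

open TensorProduct

noncomputable section

namespace TTP

variable (𝕜 : Type) [Field 𝕜]

/-- The image of `p ⊗ q` inside `M ⊗[𝕜] N`, for submodules `p ⊆ M`, `q ⊆ N`. -/
def subTmul {M N : Type} [AddCommGroup M] [Module 𝕜 M] [AddCommGroup N] [Module 𝕜 N]
    (p : Submodule 𝕜 M) (q : Submodule 𝕜 N) : Submodule 𝕜 (M ⊗[𝕜] N) :=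
  LinearMap.range (TensorProduct.map p.subtype q.subtype)

/-- The Künneth grading on a tensor product of graded vector spaces. -/
def kunneth {M N : Type} [AddCommGroup M] [Module 𝕜 M] [AddCommGroup N] [Module 𝕜 N]
    (𝒜 : ℕ → Submodule 𝕜 M) (ℬ : ℕ → Submodule 𝕜 N) (n : ℕ) : Submodule 𝕜 (M ⊗[𝕜] N) :=
  ⨆ (pq : ℕ × ℕ) (_ : pq.1 + pq.2 = n), subTmul 𝕜 (𝒜 pq.1) (ℬ pq.2)

/-- The positive part `X₊ = ⊕_{i>0} X_i` of a graded vector space. -/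
def plusPart {M : Type} [AddCommGroup M] [Module 𝕜 M] (𝒜 : ℕ → Submodule 𝕜 M) :
    Submodule 𝕜 M :=
  ⨆ (i : ℕ) (_ : 0 < i), 𝒜 i

/-- The grading concentrating `𝒜 1` in degree `1` (and `⊥` elsewhere). -/
def degOne {M : Type} [AddCommGroup M] [Module 𝕜 M] (𝒜 : ℕ → Submodule 𝕜 M) :
    ℕ → Submodule 𝕜 M :=
  fun n => if n = 1 then 𝒜 1 else ⊥

variable (A B : Type) [Ring A] [Algebra 𝕜 A] [Ring B] [Algebra 𝕜 B]

/-- `τ ∘ (μ_B ⊗ μ_A)` on `(B ⊗ B) ⊗ (A ⊗ A)`. -/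
def twistLHS (τ : B ⊗[𝕜] A →ₗ[𝕜] A ⊗[𝕜] B) :
    (B ⊗[𝕜] B) ⊗[𝕜] (A ⊗[𝕜] A) →ₗ[𝕜] A ⊗[𝕜] B :=
  τ ∘ₗ TensorProduct.map (LinearMap.mul' 𝕜 B) (LinearMap.mul' 𝕜 A)

/-- `(μ_A ⊗ μ_B) ∘ (1_A ⊗ τ ⊗ 1_B) ∘ (τ ⊗ τ) ∘ (1_B ⊗ τ ⊗ 1_A)` on `(B ⊗ B) ⊗ (A ⊗ A)`. -/
def twistRHS (τ : B ⊗[𝕜] A →ₗ[𝕜] A ⊗[𝕜] B) :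
    (B ⊗[𝕜] B) ⊗[𝕜] (A ⊗[𝕜] A) →ₗ[𝕜] A ⊗[𝕜] B :=
  TensorProduct.map (LinearMap.mul' 𝕜 A) (LinearMap.mul' 𝕜 B)
    ∘ₗ (TensorProduct.assoc 𝕜 A A (B ⊗[𝕜] B)).symm.toLinearMap
    ∘ₗ LinearMap.lTensor A (TensorProduct.assoc 𝕜 A B B).toLinearMap
    ∘ₗ LinearMap.lTensor A (LinearMap.rTensor B τ)
    ∘ₗ LinearMap.lTensor A (TensorProduct.assoc 𝕜 B A B).symm.toLinearMap
    ∘ₗ (TensorProduct.assoc 𝕜 A B (A ⊗[𝕜] B)).toLinearMap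
    ∘ₗ TensorProduct.map τ τ
    ∘ₗ (TensorProduct.assoc 𝕜 B A (B ⊗[𝕜] A)).symm.toLinearMap
    ∘ₗ LinearMap.lTensor B (TensorProduct.assoc 𝕜 A B A).toLinearMap
    ∘ₗ LinearMap.lTensor B (LinearMap.rTensor A τ)
    ∘ₗ LinearMap.lTensor B (TensorProduct.assoc 𝕜 B A A).symm.toLinearMap
    ∘ₗ (TensorProduct.assoc 𝕜 B B (A ⊗[𝕜] A)).toLinearMap

/-- `τ : B ⊗ A → A ⊗ B` is an (algebra) twisting map: it satisfies the unital twisting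
conditions and `τ(μ_B ⊗ μ_A) = (μ_A ⊗ μ_B)(1_A ⊗ τ ⊗ 1_B)(τ ⊗ τ)(1_B ⊗ τ ⊗ 1_A)`. -/
def IsTwisting (τ : B ⊗[𝕜] A →ₗ[𝕜] A ⊗[𝕜] B) : Prop :=
  (∀ a : A, τ ((1 : B) ⊗ₜ[𝕜] a) = a ⊗ₜ[𝕜] (1 : B)) ∧
  (∀ b : B, τ (b ⊗ₜ[𝕜] (1 : A)) = (1 : A) ⊗ₜ[𝕜] b) ∧
  twistLHS 𝕜 A B τ = twistRHS 𝕜 A B τ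

/-- `τ` preserves the Künneth grading. -/
def IsGradedMapBA (𝒜 : ℕ → Submodule 𝕜 A) (ℬ : ℕ → Submodule 𝕜 B)
    (τ : B ⊗[𝕜] A →ₗ[𝕜] A ⊗[𝕜] B) : Prop :=
  ∀ n, Submodule.map τ (kunneth 𝕜 ℬ 𝒜 n) ≤ kunneth 𝕜 𝒜 ℬ n

/-- `τ` is a graded twisting map. -/
def IsGradedTwisting (𝒜 : ℕ → Submodule 𝕜 A) (ℬ : ℕ → Submodule 𝕜 B)
    (τ : B ⊗[𝕜] A →ₗ[𝕜] A ⊗[𝕜] B) : Prop :=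
  IsTwisting 𝕜 A B τ ∧ IsGradedMapBA 𝕜 A B 𝒜 ℬ τ

/-- A graded linear map `τ` is graded twisting to degree `n`:  it satisfies the unital
conditions and the twisting identity in all (Künneth) degrees `≤ n`. -/
def TwistingToDeg (𝒜 : ℕ → Submodule 𝕜 A) (ℬ : ℕ → Submodule 𝕜 B)
    (τ : B ⊗[𝕜] A →ₗ[𝕜] A ⊗[𝕜] B) (n : ℕ) : Prop :=
  IsGradedMapBA 𝕜 A B 𝒜 ℬ τ ∧
  (∀ j ≤ n, ∀ a ∈ 𝒜 j, τ ((1 : B) ⊗ₜ[𝕜] a) = a ⊗ₜ[𝕜] (1 : B)) ∧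
  (∀ j ≤ n, ∀ b ∈ ℬ j, τ (b ⊗ₜ[𝕜] (1 : A)) = (1 : A) ⊗ₜ[𝕜] b) ∧
  (∀ j ≤ n, ∀ x ∈ kunneth 𝕜 (kunneth 𝕜 ℬ ℬ) (kunneth 𝕜 𝒜 𝒜) j,
    twistLHS 𝕜 A B τ x = twistRHS 𝕜 A B τ x)

/-- The unique extension property of a graded twisting map:  for every `n ≥ 3`, any
linear map `τ'` that is graded twisting to degree `n` and agrees with `τ` in all degrees
`< n` also agrees with `τ` in degree `n`. -/
def UEP (𝒜 : ℕ → Submodule 𝕜 A) (ℬ : ℕ → Submodule 𝕜 B)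
    (τ : B ⊗[𝕜] A →ₗ[𝕜] A ⊗[𝕜] B) : Prop :=
  ∀ n, 3 ≤ n → ∀ τ' : B ⊗[𝕜] A →ₗ[𝕜] A ⊗[𝕜] B,
    TwistingToDeg 𝕜 A B 𝒜 ℬ τ' n →
    (∀ i < n, ∀ x ∈ kunneth 𝕜 ℬ 𝒜 i, τ' x = τ x) →
    ∀ x ∈ kunneth 𝕜 ℬ 𝒜 n, τ' x = τ x

/-- The multiplication `μ_τ = (μ_A ⊗ μ_B)(1_A ⊗ τ ⊗ 1_B)` on `A ⊗ B`. -/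
def mulTau (τ : B ⊗[𝕜] A →ₗ[𝕜] A ⊗[𝕜] B) :
    (A ⊗[𝕜] B) ⊗[𝕜] (A ⊗[𝕜] B) →ₗ[𝕜] A ⊗[𝕜] B :=
  TensorProduct.map (LinearMap.mul' 𝕜 A) (LinearMap.mul' 𝕜 B)
    ∘ₗ (TensorProduct.assoc 𝕜 A A (B ⊗[𝕜] B)).symm.toLinearMap
    ∘ₗ LinearMap.lTensor A (TensorProduct.assoc 𝕜 A B B).toLinearMap
    ∘ₗ LinearMap.lTensor A (LinearMap.rTensor B τ)
    ∘ₗ LinearMap.lTensor A (TensorProduct.assoc 𝕜 B A B).symm.toLinearMap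
    ∘ₗ (TensorProduct.assoc 𝕜 A B (A ⊗[𝕜] B)).toLinearMap

/-- `(C, ψ)` realizes the twisted tensor product algebra `A ⊗_τ B`:  `ψ` is a linear
isomorphism carrying the multiplication `μ_τ` and its unit to those of `C`. -/
def Realizes (τ : B ⊗[𝕜] A →ₗ[𝕜] A ⊗[𝕜] B) (C : Type) [Ring C] [Algebra 𝕜 C]
    (ψ : A ⊗[𝕜] B →ₗ[𝕜] C) : Prop :=
  Function.Bijective ψ ∧ ψ ((1 : A) ⊗ₜ[𝕜] (1 : B)) = 1 ∧
  ∀ x y : A ⊗[𝕜] B, ψ (mulTau 𝕜 A B τ (x ⊗ₜ[𝕜] y)) = ψ x * ψ y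

/-- The two-sided ideal generated by a subset, as a `𝕜`-submodule. -/
def idealSpan (C : Type) [Ring C] [Algebra 𝕜 C] (s : Set C) : Submodule 𝕜 C :=
  Submodule.span 𝕜 {x | ∃ c d r, r ∈ s ∧ x = c * r * d}

/-- Weight grading of the tensor algebra. -/
def tensorWeight (V : Type) [AddCommGroup V] [Module 𝕜 V] (n : ℕ) :
    Submodule 𝕜 (TensorAlgebra 𝕜 V) :=
  LinearMap.range (TensorAlgebra.ι 𝕜 (M := V)) ^ n

instance (V : Type) [AddCommGroup V] [Module 𝕜 V] : GradedAlgebra (tensorWeight 𝕜 V) :=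
  inferInstanceAs (GradedAlgebra
    ((LinearMap.range (TensorAlgebra.ι 𝕜 : V →ₗ[𝕜] TensorAlgebra 𝕜 V) ^ ·) : ℕ → Submodule 𝕜 _))

/-- The canonical map `T(C₁) → C` for a graded algebra `C`. -/
def canMap (C : Type) [Ring C] [Algebra 𝕜 C] (𝒞 : ℕ → Submodule 𝕜 C) :
    TensorAlgebra 𝕜 ↥(𝒞 1) →ₐ[𝕜] C :=
  TensorAlgebra.lift 𝕜 (𝒞 1).subtype

/-- `C` (with grading `𝒞`) is a quadratic algebra: the canonical map `T(C₁) → C` is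
surjective and its kernel is generated, as a two-sided ideal, by its degree 2 part. -/
def IsQuadraticAlg (C : Type) [Ring C] [Algebra 𝕜 C] (𝒞 : ℕ → Submodule 𝕜 C) : Prop :=
  Function.Surjective (canMap 𝕜 C 𝒞) ∧
  LinearMap.ker (canMap 𝕜 C 𝒞).toLinearMap =
    idealSpan 𝕜 (TensorAlgebra 𝕜 ↥(𝒞 1))
      ((LinearMap.ker (canMap 𝕜 C 𝒞).toLinearMap ⊓ tensorWeight 𝕜 ↥(𝒞 1) 2 : Submodule 𝕜 _) : Set _)

/-- The left ideal generated by the positive part of a graded algebra. -/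
def augIdeal (C : Type) [Ring C] [Algebra 𝕜 C] (𝒞 : ℕ → Submodule 𝕜 C) : Submodule C C :=
  Submodule.span C {x : C | ∃ i, 0 < i ∧ x ∈ 𝒞 i}

/-- The degree `n` component of the graded free module on generators `σ` in degree `i`. -/
def freeGrade (C : Type) [Ring C] [Algebra 𝕜 C] (𝒞 : ℕ → Submodule 𝕜 C)
    (i : ℕ) (σ : Type) (n : ℕ) : Submodule 𝕜 (σ →₀ C) :=
  ⨅ (j : σ), Submodule.comap (Finsupp.lapply j : (σ →₀ C) →ₗ[𝕜] C)
    (if i ≤ n then 𝒞 (n - i) else ⊥)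

/-- `C` (with grading `𝒞`) is a Koszul algebra: the trivial module `𝕜 = C/C₊` admits a
resolution by graded free modules with the `i`-th term generated in degree `i`. -/
def IsKoszul (C : Type) [Ring C] [Algebra 𝕜 C] (𝒞 : ℕ → Submodule 𝕜 C) : Prop :=
  ∃ (σ : ℕ → Type) (d : ∀ i : ℕ, ((σ (i + 1)) →₀ C) →ₗ[C] ((σ i) →₀ C))
    (ε : ((σ 0) →₀ C) →ₗ[C] (C ⧸ augIdeal 𝕜 C 𝒞)),
    Function.Surjective ε ∧
    LinearMap.ker ε = LinearMap.range (d 0) ∧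
    (∀ i, LinearMap.ker (d i) = LinearMap.range (d (i + 1))) ∧
    (∀ i n, ∀ x ∈ freeGrade 𝕜 C 𝒞 (i + 1) (σ (i + 1)) n, d i x ∈ freeGrade 𝕜 C 𝒞 i (σ i) n) ∧
    (∀ n, 0 < n → ∀ x ∈ freeGrade 𝕜 C 𝒞 0 (σ 0) n, ε x = 0)

/-- `(P, ιA, ιB)` is a free product (coproduct) of `A` and `B`. -/
def IsFreeProduct (P : Type) [Ring P] [Algebra 𝕜 P] (ιA : A →ₐ[𝕜] P) (ιB : B →ₐ[𝕜] P) :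
    Prop :=
  ∀ (C : Type) [Ring C] [Algebra 𝕜 C], ∀ (f : A →ₐ[𝕜] C) (g : B →ₐ[𝕜] C),
    ∃! h : P →ₐ[𝕜] C, h.comp ιA = f ∧ h.comp ιB = g

/-- The linear map `A ⊗ B → P`, `a ⊗ b ↦ ιA(a) · ιB(b)`. -/
def mulMapP (P : Type) [Ring P] [Algebra 𝕜 P] (ιA : A →ₐ[𝕜] P) (ιB : B →ₐ[𝕜] P) :
    A ⊗[𝕜] B →ₗ[𝕜] P :=
  TensorProduct.lift (LinearMap.mk₂ 𝕜 (fun a b => ιA a * ιB b)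
    (fun a a' b => by simp [map_add, add_mul])
    (fun c a b => by simp [map_smul, smul_mul_assoc])
    (fun a b b' => by simp [map_add, mul_add])
    (fun c a b => by simp [map_smul, mul_smul_comm]))

/-- The set of `τ`-relations `b ⊗ a - τ(b ⊗ a)` of total degree at most `n`,
inside the free product `P`. -/
def relSetLe (P : Type) [Ring P] [Algebra 𝕜 P] (ιA : A →ₐ[𝕜] P) (ιB : B →ₐ[𝕜] P)
    (𝒜 : ℕ → Submodule 𝕜 A) (ℬ : ℕ → Submodule 𝕜 B)
    (τ : B ⊗[𝕜] A →ₗ[𝕜] A ⊗[𝕜] B) (n : ℕ) : Set P :=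
  {x | ∃ i j a b, i + j ≤ n ∧ a ∈ 𝒜 i ∧ b ∈ ℬ j ∧
    x = ιB b * ιA a - mulMapP 𝕜 A B P ιA ιB (τ (b ⊗ₜ[𝕜] a))}

/-- The set of all `τ`-relations `b ⊗ a - τ(b ⊗ a)` inside the free product `P`. -/
def relSetAll (P : Type) [Ring P] [Algebra 𝕜 P] (ιA : A →ₐ[𝕜] P) (ιB : B →ₐ[𝕜] P)
    (τ : B ⊗[𝕜] A →ₗ[𝕜] A ⊗[𝕜] B) : Set P :=
  {x | ∃ a b, x = ιB b * ιA a - mulMapP 𝕜 A B P ιA ιB (τ (b ⊗ₜ[𝕜] a))}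

/-- The (Künneth) grading on the free product `P` of the graded algebras `A` and `B`. -/
def freeProdGrade (P : Type) [Ring P] [Algebra 𝕜 P] (ιA : A →ₐ[𝕜] P) (ιB : B →ₐ[𝕜] P)
    (𝒜 : ℕ → Submodule 𝕜 A) (ℬ : ℕ → Submodule 𝕜 B) (n : ℕ) : Submodule 𝕜 P :=
  ⨆ (l : List ℕ) (_ : l.sum = n),
    ((l.map (fun i => Submodule.map ιA.toLinearMap (𝒜 i) ⊔ Submodule.map ιB.toLinearMap (ℬ i))).foldr
      (· * ·) 1)

end TTP

namespace TTP

section GradedStructures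

variable {𝕜 : Type} [Field 𝕜]

/-- A connected `ℕ`-grading on an algebra, recorded by its homogeneous projections and its
augmentation. -/
structure GAlg (𝕜 : Type) [Field 𝕜] (R : Type) [Ring R] [Algebra 𝕜 R] where
  p : ℕ → R →ₗ[𝕜] R
  p_p : ∀ i j x, p i (p j x) = if i = j then p j x else 0
  exists_sum : ∀ x, ∃ N, ∑ i ∈ Finset.range N, p i x = x
  p_mul : ∀ l x y, p l (x * y) = ∑ ij ∈ Finset.HasAntidiagonal.antidiagonal l, p ij.1 x * p ij.2 y
  ε : R →ₗ[𝕜] 𝕜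
  p_zero : ∀ x, p 0 x = ε x • (1 : R)
  ε_one : ε 1 = 1

variable {R : Type} [Ring R] [Algebra 𝕜 R]

/-- A graded left module over a graded algebra, recorded by its homogeneous projections. -/
structure GMod (g : GAlg 𝕜 R) where
  carrier : Type
  [addCommGroup : AddCommGroup carrier]
  [moduleBase : Module 𝕜 carrier]
  [module : Module R carrier]
  [isScalarTower : IsScalarTower 𝕜 R carrier]
  p : ℕ → carrier →ₗ[𝕜] carrier
  p_p : ∀ i j x, p i (p j x) = if i = j then p j x else 0
  exists_sum : ∀ x, ∃ N, ∑ i ∈ Finset.range N, p i x = x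
  p_smul : ∀ l (r : R) x, p l (r • x) = ∑ ij ∈ Finset.HasAntidiagonal.antidiagonal l, g.p ij.1 r • p ij.2 x

attribute [instance] GMod.addCommGroup GMod.moduleBase GMod.module GMod.isScalarTower

instance (g : GAlg 𝕜 R) : CoeSort (GMod g) Type := ⟨GMod.carrier⟩

namespace GMod

variable {g : GAlg 𝕜 R}

lemma exists_forall_le (M : GMod g) (x : M) : ∃ N, ∀ i, N ≤ i → M.p i x = 0 := by
  obtain ⟨N, hN⟩ := M.exists_sum x
  refine ⟨N, fun i hi => ?_⟩
  rw [← hN, map_sum]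
  refine Finset.sum_eq_zero fun j hj => ?_
  rw [M.p_p, if_neg]
  have := Finset.mem_range.1 hj
  omega

lemma exists_sum_le (M : GMod g) (x : M) :
    ∃ N, ∀ n, N ≤ n → ∑ i ∈ Finset.range n, M.p i x = x := by
  obtain ⟨N, hN⟩ := M.exists_sum x
  obtain ⟨N', hN'⟩ := M.exists_forall_le x
  refine ⟨max N N', fun n hn => ?_⟩
  have key : ∀ k, N' ≤ k → ∀ d, ∑ i ∈ Finset.range (k + d), M.p i x
      = ∑ i ∈ Finset.range k, M.p i x := by
    intro k hk d
    induction d with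
    | zero => rfl
    | succ d ih => rw [← add_assoc, Finset.sum_range_succ, ih, hN' _ (by omega), add_zero]
  by_cases h : N' ≤ N
  · obtain ⟨d, rfl⟩ := Nat.exists_eq_add_of_le (le_trans (le_max_left _ _) hn)
    rw [key N h d, hN]
  · have h2 : N ≤ N' := by omega
    obtain ⟨d, rfl⟩ := Nat.exists_eq_add_of_le (le_trans (le_max_right _ _) hn)
    rw [key N' le_rfl d]
    obtain ⟨e, rfl⟩ := Nat.exists_eq_add_of_le h2
    conv_rhs => rw [← hN]
    have : ∀ j, ∑ i ∈ Finset.range (N + j), M.p i x = ∑ i ∈ Finset.range N, M.p i x := by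
      intro j
      induction j with
      | zero => rfl
      | succ j ih =>
        rw [← add_assoc, Finset.sum_range_succ, ih]
        have : M.p (N + j) x = 0 := by
          rw [← hN, map_sum]
          refine Finset.sum_eq_zero fun i hi => ?_
          rw [M.p_p, if_neg]
          have := Finset.mem_range.1 hi
          omega
        rw [this, add_zero]
    exact this e

/-- An element all of whose components lie in a submodule lies in it. -/
lemma mem_of_p_mem (M : GMod g) (S : AddSubgroup M) (x : M) (h : ∀ i, M.p i x ∈ S) : x ∈ S := by
  obtain ⟨N, hN⟩ := M.exists_sum x
  rw [← hN]
  exact sum_mem fun i _ => h i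

/-- The regular module. -/
abbrev reg (g : GAlg 𝕜 R) : GMod g where
  carrier := R
  p := g.p
  p_p := g.p_p
  exists_sum := g.exists_sum
  p_smul := g.p_mul

/-- Tensoring a graded module with a vector space placed in degree zero. -/
abbrev tensorRight (M : GMod g) (V : Type) [AddCommGroup V] [Module 𝕜 V] : GMod g where
  carrier := M ⊗[𝕜] V
  p i := (M.p i).rTensor V
  p_p i j x := by
    induction x with
    | zero => simp
    | tmul x v => simp only [LinearMap.rTensor_tmul, M.p_p]; split_ifs <;> simp
    | add x y hx hy => simp only [map_add, hx, hy]; split_ifs <;> simp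
  exists_sum x := by
    suffices ∃ N, ∀ n, N ≤ n → ∑ i ∈ Finset.range n, (M.p i).rTensor V x = x by
      obtain ⟨N, hN⟩ := this
      exact ⟨N, hN N le_rfl⟩
    induction x with
    | zero => exact ⟨0, by simp⟩
    | tmul x v =>
      obtain ⟨N, hN⟩ := M.exists_sum_le x
      exact ⟨N, fun n hn => by simp [← TensorProduct.sum_tmul, hN n hn]⟩
    | add x y hx hy =>
      obtain ⟨N, hN⟩ := hx
      obtain ⟨N', hN'⟩ := hy
      refine ⟨max N N', fun n hn => ?_⟩
      simp only [map_add, Finset.sum_add_distrib]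
      rw [hN n (le_trans (le_max_left _ _) hn), hN' n (le_trans (le_max_right _ _) hn)]
  p_smul l r x := by
    induction x with
    | zero => simp
    | tmul x v => simp [TensorProduct.smul_tmul', M.p_smul, TensorProduct.sum_tmul]
    | add x y hx hy => simp only [map_add, smul_add, hx, hy, Finset.sum_add_distrib]

/-- The graded free module on a vector space of generators in degree zero. -/
abbrev free (g : GAlg 𝕜 R) (V : Type) [AddCommGroup V] [Module 𝕜 V] : GMod g :=
  (reg g).tensorRight V

/-- A submodule stable under the homogeneous projections. -/
abbrev sub (M : GMod g) (P : Submodule R M) (hP : ∀ i, ∀ x ∈ P, M.p i x ∈ P) : GMod g where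
  carrier := P
  moduleBase := P.module'
  isScalarTower := P.isScalarTower'
  p i := (M.p i).restrict (p := P.restrictScalars 𝕜) (q := P.restrictScalars 𝕜) (hP i)
  p_p i j x := by
    apply Subtype.ext
    have := M.p_p i j x
    split_ifs at this ⊢ <;> exact this
  exists_sum x := by
    obtain ⟨N, hN⟩ := M.exists_sum x
    refine ⟨N, Subtype.ext ?_⟩
    rw [AddSubmonoidClass.coe_finsetSum]
    exact hN
  p_smul l r x := by
    apply Subtype.ext
    rw [AddSubmonoidClass.coe_finsetSum]
    exact M.p_smul l r x

/-- Shifting down by one a module without degree zero part. -/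
abbrev shift (M : GMod g) (hM : ∀ x, M.p 0 x = 0) : GMod g where
  carrier := M
  p i := M.p (i + 1)
  p_p i j x := by simp [M.p_p]
  exists_sum x := by
    obtain ⟨N, hN⟩ := M.exists_sum_le x
    refine ⟨N, ?_⟩
    have := hN (N + 1) (by omega)
    rwa [Finset.sum_range_succ', hM, add_zero] at this
  p_smul l r x := by
    rw [M.p_smul, Finset.Nat.sum_antidiagonal_succ']
    simp [hM]

/-- The quotient by a submodule stable under the homogeneous projections. -/
abbrev quot (M : GMod g) (P : Submodule R M) (hP : ∀ i, ∀ x ∈ P, M.p i x ∈ P) : GMod g where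
  carrier := M ⧸ P
  moduleBase := Submodule.Quotient.module' P
  isScalarTower := Submodule.Quotient.isScalarTower P R
  p i := (P.restrictScalars 𝕜).mapQ (P.restrictScalars 𝕜) (M.p i) (hP i)
  p_p i j x := by
    obtain ⟨x, rfl⟩ := Submodule.Quotient.mk_surjective P x
    have := congrArg (Submodule.Quotient.mk (p := P)) (M.p_p i j x)
    split_ifs at this ⊢ <;> exact this
  exists_sum x := by
    obtain ⟨x, rfl⟩ := P.mkQ_surjective x
    obtain ⟨N, hN⟩ := M.exists_sum x
    refine ⟨N, ?_⟩
    conv_rhs => rw [← hN, map_sum]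
    rfl
  p_smul l r x := by
    obtain ⟨x, rfl⟩ := P.mkQ_surjective x
    have := congrArg P.mkQ (M.p_smul l r x)
    rw [map_sum] at this
    exact this

/-- Restriction of scalars along a graded algebra homomorphism. -/
def restrict {S : Type} [Ring S] [Algebra 𝕜 S] {h : GAlg 𝕜 S} (M : GMod g) (f : S →ₐ[𝕜] R)
    (hf : ∀ i s, f (h.p i s) = g.p i (f s)) : GMod h :=
  letI := Module.compHom M f.toRingHom
  { carrier := M
    isScalarTower := ⟨fun c s x => by
      change f (c • s) • x = c • (f s • x)
      rw [map_smul, smul_assoc]⟩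
    p := M.p
    p_p := M.p_p
    exists_sum := M.exists_sum
    p_smul := fun l s x => by
      change M.p l (f s • x) = ∑ ij ∈ Finset.HasAntidiagonal.antidiagonal l, f (h.p ij.1 s) • M.p ij.2 x
      simp only [hf, M.p_smul] }

end GMod

end GradedStructures

end TTP

namespace TTP

section LinearResolutions

variable {𝕜 : Type} [Field 𝕜] {R : Type} [Ring R] [Algebra 𝕜 R] {g : GAlg 𝕜 R}

lemma GAlg.p_one (g : GAlg 𝕜 R) (i : ℕ) : g.p i 1 = if i = 0 then 1 else 0 := by
  have h0 : g.p 0 1 = 1 := by rw [g.p_zero, g.ε_one, one_smul]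
  have := g.p_p i 0 1
  rw [h0] at this
  exact this

lemma GAlg.ε_p (g : GAlg 𝕜 R) (i : ℕ) (r : R) : g.ε (g.p i r) = if i = 0 then g.ε r else 0 := by
  have := congrArg g.ε (g.p_p 0 i r)
  rw [g.p_zero, map_smul, g.ε_one, smul_eq_mul, mul_one] at this
  rw [this]
  by_cases h : i = 0
  · subst h; simp [g.p_zero, g.ε_one]
  · rw [if_neg (Ne.symm h), if_neg h, map_zero]

/-- Homogeneity (of degree zero) of a map of graded modules, possibly over different algebras. -/
def Homog {S : Type} [Ring S] [Algebra 𝕜 S] {h : GAlg 𝕜 S} {M : GMod g} {N : GMod h}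
    (f : M → N) : Prop :=
  ∀ i x, f (M.p i x) = N.p i (f x)

/-- Homogeneity of degree one of a map of graded modules. -/
def HomogOne {S : Type} [Ring S] [Algebra 𝕜 S] {h : GAlg 𝕜 S} {M : GMod g} {N : GMod h}
    (f : M → N) : Prop :=
  ∀ i x, f (M.p i x) = N.p (i + 1) (f x)

lemma HomogOne.p_zero {S : Type} [Ring S] [Algebra 𝕜 S] {h : GAlg 𝕜 S} {M : GMod g} {N : GMod h}
    {f : M →+ N} (hf : HomogOne (M := M) (N := N) f) (x : M) : N.p 0 (f x) = 0 :=
  M.mem_of_p_mem (AddMonoidHom.ker ((N.p 0).toAddMonoidHom.comp f)) x (fun i => by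
    change N.p 0 (f (M.p i x)) = 0
    rw [hf, N.p_p, if_neg (by omega)])

section Free

variable {V W : Type} [AddCommGroup V] [Module 𝕜 V] [AddCommGroup W] [Module 𝕜 W]

/-- The module homomorphism out of a free module determined by the images of the generators. -/
def linLift {M : Type} [AddCommGroup M] [Module 𝕜 M] [Module R M] [IsScalarTower 𝕜 R M]
    (θ : V →ₗ[𝕜] M) : R ⊗[𝕜] V →ₗ[R] M where
  toFun := TensorProduct.lift ((Algebra.lsmul 𝕜 𝕜 M).toLinearMap.compl₂ θ)
  map_add' := map_add _
  map_smul' r x := by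
    induction x with
    | zero => simp
    | tmul s v => simp [TensorProduct.smul_tmul']
    | add x y hx hy => simp only [smul_add, map_add, hx, hy]

@[simp] lemma linLift_tmul {M : Type} [AddCommGroup M] [Module 𝕜 M] [Module R M]
    [IsScalarTower 𝕜 R M] (θ : V →ₗ[𝕜] M) (r : R) (v : V) :
    linLift θ (r ⊗ₜ[𝕜] v) = r • θ v := by
  simp [linLift]

lemma linLift_homog (M : GMod g) (θ : V →ₗ[𝕜] M) (hθ : ∀ v, M.p 0 (θ v) = θ v) :
    Homog (M := GMod.free g V) (N := M) (linLift θ) := by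
  intro i (x : R ⊗[𝕜] V)
  induction x with
  | zero => simp
  | tmul r v =>
    rw [linLift_tmul, M.p_smul, Finset.sum_eq_single (i, 0)]
    · simp [hθ]
    · rintro ⟨a, b⟩ hab hne
      have hb : b ≠ 0 := by
        rintro rfl
        exact hne (by simpa using hab)
      simp only
      rw [← hθ v, M.p_p, if_neg hb, smul_zero]
    · simp
  | add x y hx hy => simp only [map_add, hx, hy]

lemma baseChange_homog (g : GAlg 𝕜 R) (f : V →ₗ[𝕜] W) :
    Homog (M := GMod.free g V) (N := GMod.free g W) (f.baseChange R) := by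
  intro i (x : R ⊗[𝕜] V)
  induction x with
  | zero => simp
  | tmul r v => simp
  | add x y hx hy => simp only [map_add, hx, hy]

lemma free_hom_ext {M : Type} [AddCommGroup M] [Module R M]
    {f f' : R ⊗[𝕜] V →ₗ[R] M} (h : ∀ v, f (1 ⊗ₜ v) = f' (1 ⊗ₜ v)) (x : R ⊗[𝕜] V) :
    f x = f' x := by
  induction x with
  | zero => simp
  | tmul r v =>
    have : r ⊗ₜ[𝕜] v = r • ((1 : R) ⊗ₜ[𝕜] v) := by simp [TensorProduct.smul_tmul']
    rw [this, map_smul, map_smul, h]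
  | add x y hx hy => rw [map_add, map_add, hx, hy]

lemma free_p_zero (g : GAlg 𝕜 R) (x : R ⊗[𝕜] V) :
    ∃ v : V, (GMod.free g V).p 0 x = 1 ⊗ₜ[𝕜] v := by
  induction x with
  | zero => exact ⟨0, by simp⟩
  | tmul r v => exact ⟨g.ε r • v, by simp [g.p_zero, TensorProduct.smul_tmul]⟩
  | add x y hx hy =>
    obtain ⟨v, hv⟩ := hx
    obtain ⟨w, hw⟩ := hy
    exact ⟨v + w, by rw [map_add, hv, hw, TensorProduct.tmul_add]⟩

lemma free_p_zero_one_tmul (g : GAlg 𝕜 R) (v : V) :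
    (GMod.free g V).p 0 ((1 : R) ⊗ₜ[𝕜] v) = 1 ⊗ₜ[𝕜] v := by
  simp [g.p_one]

lemma one_tmul_injective (g : GAlg 𝕜 R) {v : V} (h : (1 : R) ⊗ₜ[𝕜] v = 0) : v = 0 := by
  have := congrArg ((TensorProduct.lid 𝕜 V).toLinearMap ∘ₗ (g.ε).rTensor V) h
  simpa [g.ε_one] using this

lemma baseChange_injective {f : V →ₗ[𝕜] W} (hf : Function.Injective f) :
    Function.Injective (f.baseChange R) :=
  Module.Flat.lTensor_preserves_injective_linearMap (M := R) f hf

end Free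

/-- A minimal presentation of a graded module `M` generated in degree zero: a free module with
generators in degree zero mapping onto `M`, and its kernel `N`, shifted down by one. -/
structure IsPres {V : Type} [AddCommGroup V] [Module 𝕜 V] {M N : GMod g}
    (ι : N →ₗ[R] R ⊗[𝕜] V) (π : R ⊗[𝕜] V →ₗ[R] M) : Prop where
  inj : Function.Injective ι
  surj : Function.Surjective π
  π_ι : ∀ x, π (ι x) = 0
  exact : ∀ x, π x = 0 → ∃ y, ι y = x
  ι_homog : HomogOne (M := N) (N := GMod.free g V) ι
  π_homog : Homog (M := GMod.free g V) (N := M) π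

/-- The map sending a generator to its image. -/
def gen {V M : Type} [AddCommGroup V] [Module 𝕜 V] [AddCommGroup M] [Module 𝕜 M] [Module R M]
    [IsScalarTower 𝕜 R M] (π : R ⊗[𝕜] V →ₗ[R] M) : V →ₗ[𝕜] M :=
  π.restrictScalars 𝕜 ∘ₗ TensorProduct.mk 𝕜 R V 1

@[simp] lemma gen_apply {V M : Type} [AddCommGroup V] [Module 𝕜 V] [AddCommGroup M] [Module 𝕜 M]
    [Module R M] [IsScalarTower 𝕜 R M] (π : R ⊗[𝕜] V →ₗ[R] M) (v : V) :
    gen π v = π (1 ⊗ₜ v) := rfl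

namespace IsPres

variable {V : Type} [AddCommGroup V] [Module 𝕜 V] {M N : GMod g}
  {ι : N →ₗ[R] R ⊗[𝕜] V} {π : R ⊗[𝕜] V →ₗ[R] M}

lemma one_tmul_inj (P : IsPres ι π) {v : V} (h : π (1 ⊗ₜ v) = 0) : v = 0 := by
  obtain ⟨y, hy⟩ := P.exact _ h
  have := HomogOne.p_zero (M := N) (N := GMod.free g V) (f := ι.toAddMonoidHom) P.ι_homog y
  rw [LinearMap.toAddMonoidHom_coe, hy, free_p_zero_one_tmul] at this
  exact one_tmul_injective g this

lemma exists_gen (P : IsPres ι π) {x : M} (h : M.p 0 x = x) : ∃ v, π (1 ⊗ₜ v) = x := by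
  obtain ⟨y, rfl⟩ := P.surj x
  obtain ⟨v, hv⟩ := free_p_zero g y
  exact ⟨v, by rw [← hv, P.π_homog, h]⟩

lemma p_zero_π (P : IsPres ι π) (v : V) : M.p 0 (π (1 ⊗ₜ v)) = π (1 ⊗ₜ v) := by
  rw [← P.π_homog, free_p_zero_one_tmul]

/-- Factorization of a map through the kernel of a presentation. -/
lemma exists_fac (P : IsPres ι π) {X : Type} [AddCommGroup X] [Module R X]
    (h : X →ₗ[R] R ⊗[𝕜] V) (hh : ∀ x, π (h x) = 0) :
    ∃ f : X →ₗ[R] N, ∀ x, ι (f x) = h x := by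
  choose f hf using fun x => P.exact _ (hh x)
  exact ⟨{ toFun := f
           map_add' := fun x y => P.inj (by simp [hf])
           map_smul' := fun r x => P.inj (by simp [hf]) }, hf⟩

end IsPres

/-- The presentation determined by a minimal cover. -/
lemma exists_isPres {V : Type} [AddCommGroup V] [Module 𝕜 V] {M : GMod g} (π : R ⊗[𝕜] V →ₗ[R] M)
    (hs : Function.Surjective π) (hh : Homog (M := GMod.free g V) (N := M) π)
    (h0 : ∀ v, π (1 ⊗ₜ v) = 0 → v = 0) : ∃ (N : GMod g) (ι : N →ₗ[R] R ⊗[𝕜] V), IsPres ι π :=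
  ⟨((GMod.free g V).sub (LinearMap.ker π) (fun i x hx => by
      rw [LinearMap.mem_ker] at hx ⊢
      rw [hh, hx, map_zero])).shift (fun x => by
        obtain ⟨v, hv⟩ := free_p_zero g x.1
        apply Subtype.ext
        have h2 : π ((GMod.free g V).p 0 x.1) = 0 := by
          rw [hh, LinearMap.mem_ker.1 x.2, map_zero]
        change (GMod.free g V).p 0 x.1 = 0
        rw [hv] at h2 ⊢
        rw [h0 v h2, TensorProduct.tmul_zero]), (LinearMap.ker π).subtype,
    { inj := Subtype.val_injective
      surj := hs
      π_ι := fun x => x.2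
      exact := fun x hx => ⟨⟨x, hx⟩, rfl⟩
      ι_homog := fun i x => rfl
      π_homog := hh }⟩

/-- `Lin m M`: the graded module `M` is generated in degree zero and has linear syzygies, up to
homological degree `m`. -/
def Lin : ℕ → GMod g → Prop
  | 0, _ => True
  | m + 1, M => ∃ (V : Type) (_ : AddCommGroup V) (_ : Module 𝕜 V) (N : GMod g)
      (ι : N →ₗ[R] R ⊗[𝕜] V) (π : R ⊗[𝕜] V →ₗ[R] M), IsPres ι π ∧ Lin m N

lemma Lin.iso {m : ℕ} {M M' : GMod g} (h : Lin m M) (e : M ≃ₗ[R] M')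
    (he : Homog (M := M) (N := M') e) : Lin m M' := by
  cases m with
  | zero => trivial
  | succ m =>
    obtain ⟨V, _, _, N, ι, π, P, hP⟩ := h
    exact ⟨V, _, _, N, ι, e.toLinearMap ∘ₗ π,
           { inj := P.inj
             surj := e.surjective.comp P.surj
             π_ι := fun x => by simp [P.π_ι]
             exact := fun x hx => P.exact x (by simpa using hx)
             ι_homog := P.ι_homog
             π_homog := fun i x => by
              change e (π _) = _
              rw [P.π_homog, he]; rfl }, hP⟩

/-- A short exact sequence of graded modules. -/
structure IsSES {M' M M'' : GMod g} (f : M' →ₗ[R] M) (q : M →ₗ[R] M'') : Prop where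
  inj : Function.Injective f
  surj : Function.Surjective q
  comp : ∀ x, q (f x) = 0
  exact : ∀ y, q y = 0 → ∃ x, f x = y
  f_homog : Homog (M := M') (N := M) f
  q_homog : Homog (M := M) (N := M'') q

/-- The horseshoe lemma for minimal presentations. -/
lemma IsSES.exists_pres {M' M M'' N' N'' : GMod g} {f : M' →ₗ[R] M} {q : M →ₗ[R] M''}
    (h : IsSES f q) {V' V'' : Type} [AddCommGroup V'] [Module 𝕜 V'] [AddCommGroup V'']
    [Module 𝕜 V''] {ι' : N' →ₗ[R] R ⊗[𝕜] V'} {π' : R ⊗[𝕜] V' →ₗ[R] M'}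
    {ι'' : N'' →ₗ[R] R ⊗[𝕜] V''} {π'' : R ⊗[𝕜] V'' →ₗ[R] M''}
    (P' : IsPres ι' π') (P'' : IsPres ι'' π'') :
    ∃ (N : GMod g) (ι : N →ₗ[R] R ⊗[𝕜] (V' × V'')) (π : R ⊗[𝕜] (V' × V'') →ₗ[R] M)
      (a : N' →ₗ[R] N) (b : N →ₗ[R] N''), IsPres ι π ∧ IsSES a b := by
  obtain ⟨s, hs⟩ := (q.restrictScalars 𝕜).exists_rightInverse_of_surjective
    (LinearMap.range_eq_top.2 h.surj)
  have hs' : ∀ x, q (s x) = x := fun x => LinearMap.congr_fun hs x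
  let θ : V' × V'' →ₗ[𝕜] M :=
    (f.restrictScalars 𝕜 ∘ₗ gen π').coprod (M.p 0 ∘ₗ s ∘ₗ gen π'')
  have hθ : ∀ v, M.p 0 (θ v) = θ v := by
    rintro ⟨v, w⟩
    simp only [θ, LinearMap.coprod_apply, LinearMap.comp_apply, map_add, M.p_p,
      LinearMap.restrictScalars_apply, gen_apply, if_true]
    rw [← h.f_homog, P'.p_zero_π]
  let π : R ⊗[𝕜] (V' × V'') →ₗ[R] M := linLift θ
  let i₁ := (LinearMap.inl 𝕜 V' V'').baseChange R
  let i₂ := (LinearMap.inr 𝕜 V' V'').baseChange R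
  let p₁ := (LinearMap.fst 𝕜 V' V'').baseChange R
  let p₂ := (LinearMap.snd 𝕜 V' V'').baseChange R
  have hi₁ : ∀ x, π (i₁ x) = f (π' x) := fun x =>
    free_hom_ext (f := π ∘ₗ i₁) (f' := f ∘ₗ π') (fun v => by simp [π, i₁, θ]) x
  have hp₂ : ∀ x, q (π x) = π'' (p₂ x) := fun x =>
    free_hom_ext (f := q ∘ₗ π) (f' := π'' ∘ₗ p₂) (fun v => by
      simp [π, p₂, θ, h.comp, h.q_homog _ _, hs', P''.p_zero_π]) x
  have hsum : ∀ x, i₁ (p₁ x) + i₂ (p₂ x) = x := fun x =>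
    free_hom_ext (f := i₁ ∘ₗ p₁ + i₂ ∘ₗ p₂) (f' := LinearMap.id) (fun v => by
      simp [i₁, p₁, i₂, p₂, ← TensorProduct.tmul_add]) x
  have h12 : ∀ x, p₂ (i₁ x) = 0 := fun x =>
    free_hom_ext (f := p₂ ∘ₗ i₁) (f' := 0) (fun v => by simp [i₁, p₂]) x
  have h22 : ∀ x, p₂ (i₂ x) = x := fun x =>
    free_hom_ext (f := p₂ ∘ₗ i₂) (f' := LinearMap.id) (fun v => by simp [i₂, p₂]) x
  have hinj : Function.Injective i₁ := baseChange_injective LinearMap.inl_injective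
  obtain ⟨N, ι, P⟩ := exists_isPres (g := g) (M := M) π (by
      intro y
      obtain ⟨z, hz⟩ := P''.surj (q y)
      obtain ⟨x, hx⟩ := h.exact (y - π (i₂ z)) (by rw [map_sub, hp₂, h22, hz, sub_self])
      obtain ⟨w, rfl⟩ := P'.surj x
      exact ⟨i₁ w + i₂ z, by rw [map_add, hi₁, hx, sub_add_cancel]⟩)
    (linLift_homog M θ hθ) (by
      rintro ⟨v, w⟩ hv
      have hw : w = 0 := P''.one_tmul_inj (by
        have := hp₂ (1 ⊗ₜ (v, w))
        rw [hv, map_zero] at this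
        rw [this]; simp [p₂])
      subst hw
      have : f (π' (1 ⊗ₜ v)) = 0 := by rw [← hi₁, ← hv]; simp [i₁]
      have hv0 : v = 0 := P'.one_tmul_inj (h.inj (by rw [this, map_zero]))
      rw [hv0]; rfl)
  obtain ⟨a, ha⟩ := P.exists_fac (i₁ ∘ₗ ι') (fun x => by
    change π (i₁ _) = 0
    rw [hi₁, P'.π_ι, map_zero])
  obtain ⟨b, hb⟩ := P''.exists_fac (p₂ ∘ₗ ι) (fun x => by
    change π'' (p₂ _) = 0
    rw [← hp₂, P.π_ι, map_zero])
  have ha' : ∀ x, ι (a x) = i₁ (ι' x) := ha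
  have hb' : ∀ x, ι'' (b x) = p₂ (ι x) := hb
  refine ⟨N, ι, π, a, b, P, ?_, ?_, ?_, ?_, ?_, ?_⟩
  · intro x y hxy
    apply P'.inj
    apply hinj
    rw [← ha', ← ha', hxy]
  · intro n
    have h1 : q (π (i₂ (ι'' n))) = 0 := by rw [hp₂, h22, P''.π_ι]
    obtain ⟨x, hx⟩ := h.exact _ h1
    obtain ⟨w, rfl⟩ := P'.surj x
    obtain ⟨y, hy⟩ := P.exact (i₂ (ι'' n) - i₁ w) (by
      rw [map_sub, hi₁, hx, sub_self])
    refine ⟨y, P''.inj ?_⟩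
    rw [hb', hy, map_sub, h22, h12, sub_zero]
  · intro x
    apply P''.inj
    rw [hb', ha', h12, map_zero]
  · intro y hy
    have h1 : p₂ (ι y) = 0 := by rw [← hb', hy, map_zero]
    have h2 : i₁ (p₁ (ι y)) = ι y := by
      have := hsum (ι y)
      rwa [h1, map_zero, add_zero] at this
    obtain ⟨x, hx⟩ := P'.exact (p₁ (ι y)) (by
      apply h.inj
      rw [← hi₁, h2, P.π_ι, map_zero])
    exact ⟨x, P.inj (by rw [ha', hx, h2])⟩
  · intro i x
    apply P.inj
    rw [ha', P'.ι_homog, P.ι_homog, ha']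
    exact baseChange_homog g _ _ _
  · intro i x
    apply P''.inj
    rw [hb', P.ι_homog, P''.ι_homog, hb']
    exact baseChange_homog g _ _ _

lemma Lin.extension {m : ℕ} {M' M M'' : GMod g} {f : M' →ₗ[R] M} {q : M →ₗ[R] M''}
    (h : IsSES f q) (h' : Lin m M') (h'' : Lin m M'') : Lin m M := by
  induction m generalizing M' M M'' with
  | zero => trivial
  | succ m ih =>
    obtain ⟨V', _, _, N', ι', π', P', hP'⟩ := h'
    obtain ⟨V'', _, _, N'', ι'', π'', P'', hP''⟩ := h''
    obtain ⟨N, ι, π, a, b, P, hab⟩ := h.exists_pres P' P''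
    exact ⟨_, _, _, N, ι, π, P, ih hab hP' hP''⟩

/-- The cokernel of a linear module, shifted by one, inside a linear module is linear. -/
lemma Lin.quotient {m : ℕ} {K M N : GMod g} (f : K →ₗ[R] M) (q : M →ₗ[R] N)
    (f_inj : Function.Injective f) (q_surj : Function.Surjective q)
    (comp : ∀ x, q (f x) = 0) (exact : ∀ y, q y = 0 → ∃ x, f x = y)
    (f_homog : HomogOne (M := K) (N := M) f) (q_homog : Homog (M := M) (N := N) q)
    (hK : Lin m K) (hM : Lin (m + 1) M) : Lin (m + 1) N := by
  obtain ⟨V, _, _, L, ι, π, P, hP⟩ := hM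
  have hcov : ∀ v, (q ∘ₗ π) (1 ⊗ₜ v) = 0 → v = 0 := by
    intro v hv
    obtain ⟨x, hx⟩ := exact _ hv
    apply P.one_tmul_inj
    have := HomogOne.p_zero (M := K) (N := M) (f := f.toAddMonoidHom) f_homog x
    rw [LinearMap.toAddMonoidHom_coe, hx] at this
    rwa [P.p_zero_π] at this
  obtain ⟨L', ι', Q⟩ := exists_isPres (g := g) (M := N) (q ∘ₗ π) (q_surj.comp P.surj)
    (fun i x => by
      change q (π _) = _
      rw [P.π_homog, q_homog]; rfl) hcov
  obtain ⟨a, ha⟩ := Q.exists_fac ι (fun x => by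
    exact (congrArg q (P.π_ι x)).trans (map_zero q))
  choose b hb using fun x : L' => exact (π (ι' x)) (Q.π_ι x)
  let b' : L' →ₗ[R] K :=
    { toFun := b
      map_add' := fun x y => f_inj (by simp only [map_add, hb])
      map_smul' := fun r x => f_inj (by simp only [RingHom.id_apply, map_smul, hb]) }
  refine ⟨V, _, _, L', ι', _, Q,
    Lin.extension (f := a) (q := b') ⟨?_, ?_, ?_, ?_, ?_, ?_⟩ hP hK⟩
  · intro x y hxy
    apply P.inj
    rw [← ha, ← ha, hxy]
  · intro k
    obtain ⟨x, hx⟩ := P.surj (f k)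
    obtain ⟨y, hy⟩ := Q.exact x (by rw [LinearMap.comp_apply, hx, comp])
    refine ⟨y, f_inj ?_⟩
    change f (b y) = _
    rw [hb, hy, hx]
  · intro x
    apply f_inj
    change f (b _) = _
    rw [hb, ha, P.π_ι, map_zero]
  · intro y hy
    have h1 : π (ι' y) = 0 := by
      rw [← hb, show b y = 0 from hy, map_zero]
    obtain ⟨x, hx⟩ := P.exact _ h1
    exact ⟨x, Q.inj (by rw [ha, hx])⟩
  · intro i x
    apply Q.inj
    rw [ha, P.ι_homog, Q.ι_homog, ha]
  · intro i x
    apply f_inj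
    change f (b _) = f (K.p i (b x))
    rw [hb, Q.ι_homog, f_homog, hb]
    exact P.π_homog _ _

/-- Two minimal covers of the same module are related by a map of generators. -/
lemma IsPres.exists_baseChange {V W : Type} [AddCommGroup V] [Module 𝕜 V] [AddCommGroup W]
    [Module 𝕜 W] {M N N' : GMod g} {ι : N →ₗ[R] R ⊗[𝕜] V} {π : R ⊗[𝕜] V →ₗ[R] M}
    {ι' : N' →ₗ[R] R ⊗[𝕜] W} {π' : R ⊗[𝕜] W →ₗ[R] M} (P : IsPres ι π) (Q : IsPres ι' π') :
    ∃ φ : V →ₗ[𝕜] W, ∀ x, π' (φ.baseChange R x) = π x := by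
  choose φ hφ using fun v : V => Q.exists_gen (P.p_zero_π v)
  have hinj : ∀ v w : W, gen π' v = gen π' w → v = w := by
    intro v w hvw
    rw [← sub_eq_zero, ← map_sub] at hvw
    exact sub_eq_zero.1 (Q.one_tmul_inj hvw)
  have hφ' : ∀ v, gen π' (φ v) = gen π v := hφ
  exact ⟨{ toFun := φ
           map_add' := fun v w => hinj _ _ (by simp only [map_add, hφ'])
           map_smul' := fun c v => hinj _ _ (by simp only [map_smul, hφ', RingHom.id_apply]) },
    fun x => free_hom_ext (f := π' ∘ₗ LinearMap.baseChange R _) (f' := π)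
      (fun v => by simp [hφ]) x⟩

lemma IsPres.baseChange_inverse {V W : Type} [AddCommGroup V] [Module 𝕜 V] [AddCommGroup W]
    [Module 𝕜 W] {M N : GMod g} {ι : N →ₗ[R] R ⊗[𝕜] V} {π : R ⊗[𝕜] V →ₗ[R] M}
    {π' : R ⊗[𝕜] W →ₗ[R] M} (P : IsPres ι π)
    {φ : V →ₗ[𝕜] W} {χ : W →ₗ[𝕜] V} (hφ : ∀ x, π' (φ.baseChange R x) = π x)
    (hχ : ∀ x, π (χ.baseChange R x) = π' x) (x : R ⊗[𝕜] V) :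
    χ.baseChange R (φ.baseChange R x) = x := by
  refine free_hom_ext (f := χ.baseChange R ∘ₗ φ.baseChange R) (f' := LinearMap.id)
    (fun v => ?_) x
  have h1 : gen π (χ (φ v) - v) = 0 := by
    have := (hχ (φ.baseChange R (1 ⊗ₜ v))).trans (hφ _)
    rw [map_sub, sub_eq_zero]
    simpa using this
  have h2 := sub_eq_zero.1 (P.one_tmul_inj h1)
  simp [h2]

/-- Minimal presentations are unique. -/
lemma Lin.of_pres {m : ℕ} {V : Type} [AddCommGroup V] [Module 𝕜 V] {M N : GMod g}
    (h : Lin (m + 1) M) {ι : N →ₗ[R] R ⊗[𝕜] V} {π : R ⊗[𝕜] V →ₗ[R] M} (P : IsPres ι π) :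
    Lin m N := by
  obtain ⟨W, _, _, N', ι', π', Q, hQ⟩ := h
  obtain ⟨φ, hφ⟩ := P.exists_baseChange Q
  obtain ⟨χ, hχ⟩ := Q.exists_baseChange P
  obtain ⟨a, ha⟩ := P.exists_fac (χ.baseChange R ∘ₗ ι') (fun x => by
    rw [LinearMap.comp_apply, hχ, Q.π_ι])
  obtain ⟨b, hb⟩ := Q.exists_fac (φ.baseChange R ∘ₗ ι) (fun x => by
    rw [LinearMap.comp_apply, hφ, P.π_ι])
  refine hQ.iso (LinearEquiv.ofLinearMap a b ?_ ?_) ?_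
  · ext x
    apply P.inj
    simp only [LinearMap.comp_apply, ha, hb, LinearMap.id_apply]
    exact P.baseChange_inverse hφ hχ _
  · ext x
    apply Q.inj
    simp only [LinearMap.comp_apply, ha, hb, LinearMap.id_apply]
    exact Q.baseChange_inverse hχ hφ _
  · intro i x
    apply P.inj
    change ι (a _) = ι (N.p i (a x))
    rw [ha, P.ι_homog, ha]
    simp only [LinearMap.comp_apply]
    rw [Q.ι_homog]
    exact baseChange_homog g _ _ _

end LinearResolutions

end TTP

namespace TTP

section KoszulLinear

variable {𝕜 : Type} [Field 𝕜] {R : Type} [Ring R] [Algebra 𝕜 R] {g : GAlg 𝕜 R}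

lemma Lin.tensorRight {m : ℕ} {M : GMod g} (h : Lin m M) (U : Type) [AddCommGroup U]
    [Module 𝕜 U] : Lin m (M.tensorRight U) := by
  induction m generalizing M with
  | zero => trivial
  | succ m ih =>
    obtain ⟨V, _, _, N, ι, π, P, hP⟩ := h
    let e : (R ⊗[𝕜] V) ⊗[𝕜] U ≃ₗ[R] R ⊗[𝕜] (V ⊗[𝕜] U) :=
      TensorProduct.AlgebraTensorModule.assoc 𝕜 𝕜 R R V U
    let ι₁ : N ⊗[𝕜] U →ₗ[R] (R ⊗[𝕜] V) ⊗[𝕜] U :=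
      TensorProduct.AlgebraTensorModule.map ι LinearMap.id
    let π₁ : (R ⊗[𝕜] V) ⊗[𝕜] U →ₗ[R] M ⊗[𝕜] U :=
      TensorProduct.AlgebraTensorModule.map π LinearMap.id
    have hι₁ : ∀ x, ι₁ x = (ι.restrictScalars 𝕜).rTensor U x := fun x => rfl
    have hπ₁ : ∀ x, π₁ x = (π.restrictScalars 𝕜).rTensor U x := fun x => rfl
    have hex : Function.Exact ((ι.restrictScalars 𝕜).rTensor U)
        ((π.restrictScalars 𝕜).rTensor U) := by
      refine rTensor_exact U ?_ P.surj
      intro x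
      exact ⟨fun hx => P.exact x hx, fun ⟨y, hy⟩ => hy ▸ P.π_ι y⟩
    have he : Homog (M := (GMod.free g V).tensorRight U) (N := GMod.free g (V ⊗[𝕜] U)) e := by
      intro i (x : (R ⊗[𝕜] V) ⊗[𝕜] U)
      induction x with
      | zero => simp
      | add x y hx hy => simp only [map_add, hx, hy]
      | tmul x u =>
        induction x with
        | zero => simp
        | add x y hx hy => simp only [TensorProduct.add_tmul, map_add, hx, hy]
        | tmul r v => simp [e]
    refine ⟨V ⊗[𝕜] U, _, _, N.tensorRight U, e.toLinearMap ∘ₗ ι₁, π₁ ∘ₗ e.symm.toLinearMap, ?_,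
      ih hP⟩
    refine ⟨?_, ?_, ?_, ?_, ?_, ?_⟩
    · refine e.injective.comp ?_
      exact Module.Flat.rTensor_preserves_injective_linearMap (M := U) (ι.restrictScalars 𝕜) P.inj
    · intro y
      obtain ⟨x, hx⟩ := LinearMap.rTensor_surjective U (g := π.restrictScalars 𝕜) P.surj y
      refine ⟨e x, ?_⟩
      rw [LinearMap.comp_apply, LinearEquiv.coe_coe, e.symm_apply_apply]
      exact hx
    · intro x
      simp only [LinearMap.comp_apply, LinearEquiv.coe_coe, LinearEquiv.symm_apply_apply]
      rw [hπ₁, hι₁]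
      exact hex.apply_apply_eq_zero x
    · intro x hx
      obtain ⟨y, hy⟩ := (hex (e.symm x)).1 hx
      refine ⟨y, ?_⟩
      simp only [LinearMap.comp_apply, LinearEquiv.coe_coe]
      rw [hι₁, hy, e.apply_symm_apply]
    · intro i (x : N ⊗[𝕜] U)
      have : ι₁ ((N.tensorRight U).p i x) = ((GMod.free g V).tensorRight U).p (i + 1) (ι₁ x) := by
        induction x with
        | zero => simp
        | add x y hx hy => simp only [map_add, hx, hy]
        | tmul x u =>
          simp only [ι₁, LinearMap.rTensor_tmul, TensorProduct.AlgebraTensorModule.map_tmul]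
          rw [P.ι_homog]
      simp only [LinearMap.comp_apply, LinearEquiv.coe_coe]
      rw [this, he]
    · intro i x
      obtain ⟨x, rfl⟩ := e.surjective x
      rw [← he]
      simp only [LinearMap.comp_apply, LinearEquiv.coe_coe, LinearEquiv.symm_apply_apply]
      change (R ⊗[𝕜] V) ⊗[𝕜] U at x
      induction x with
      | zero => simp
      | add x y hx hy => simp only [map_add, hx, hy]
      | tmul x u =>
        simp only [π₁, LinearMap.rTensor_tmul, TensorProduct.AlgebraTensorModule.map_tmul]
        rw [← P.π_homog]

lemma homog_of_fixed {M N : GMod g} (f : M →+ N) (s : ℕ)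
    (h : ∀ l x, M.p l x = x → N.p (l + s) (f x) = f x) (l : ℕ) (x : M) :
    f (M.p l x) = N.p (l + s) (f x) := by
  have key : ∀ i, N.p (l + s) (f (M.p i x)) = if l = i then f (M.p i x) else 0 := by
    intro i
    rw [← h i (M.p i x) (by simp [M.p_p]), N.p_p]
    by_cases hli : l = i
    · simp [hli]
    · simp [hli]
  obtain ⟨n, hn⟩ := M.exists_sum_le x
  have h1 := hn (max n (l + 1)) (le_max_left _ _)
  conv_rhs => rw [← h1, map_sum, map_sum]
  simp only [key]
  rw [Finset.sum_ite_eq, if_pos]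
  exact Finset.mem_range.2 (lt_of_lt_of_le (Nat.lt_succ_self l) (le_max_right _ _))

/-- A module with a linear free resolution has linear syzygies. -/
lemma Lin.of_resolution (m : ℕ) (V : ℕ → Type) [∀ i, AddCommGroup (V i)] [∀ i, Module 𝕜 (V i)]
    (D : ∀ i, R ⊗[𝕜] V (i + 1) →ₗ[R] R ⊗[𝕜] V i) (M : GMod g) (e : R ⊗[𝕜] V 0 →ₗ[R] M)
    (hs : Function.Surjective e) (h0 : LinearMap.ker e = LinearMap.range (D 0))
    (hD : ∀ i, LinearMap.ker (D i) = LinearMap.range (D (i + 1)))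
    (hDh : ∀ i, HomogOne (M := GMod.free g (V (i + 1))) (N := GMod.free g (V i)) (D i))
    (heh : Homog (M := GMod.free g (V 0)) (N := M) e) : Lin m M := by
  induction m generalizing V M with
  | zero => trivial
  | succ m ih =>
    obtain ⟨N, ι, P⟩ := exists_isPres (g := g) (M := M) e hs heh (by
      intro v hv
      have : (1 : R) ⊗ₜ[𝕜] v ∈ LinearMap.range (D 0) := h0 ▸ hv
      obtain ⟨y, hy⟩ := this
      have h1 := HomogOne.p_zero (M := GMod.free g (V 1)) (N := GMod.free g (V 0))
        (f := (D 0).toAddMonoidHom) (hDh 0) y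
      rw [LinearMap.toAddMonoidHom_coe, hy, free_p_zero_one_tmul] at h1
      exact one_tmul_injective g h1)
    obtain ⟨e', he'⟩ := P.exists_fac (D 0) (fun x => by
      rw [← LinearMap.mem_ker, h0]; exact ⟨x, rfl⟩)
    refine ⟨V 0, _, _, N, ι, e, P, ih (fun i => V (i + 1)) (fun i => D (i + 1)) N e' ?_ ?_
      (fun i => hD (i + 1)) (fun i => hDh (i + 1)) ?_⟩
    · intro n
      have : ι n ∈ LinearMap.range (D 0) := h0 ▸ P.π_ι n
      obtain ⟨y, hy⟩ := this
      exact ⟨y, P.inj (by rw [he', hy])⟩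
    · rw [← hD 0]
      ext x
      rw [LinearMap.mem_ker, LinearMap.mem_ker, ← he']
      exact ⟨fun h => by rw [h, map_zero], fun h => P.inj (by rw [h, map_zero])⟩
    · intro i x
      apply P.inj
      rw [he', hDh, P.ι_homog, he']

/-- A module with linear syzygies in all degrees has a linear free resolution. -/
lemma Lin.exists_resolution {M : GMod g} (h : ∀ m, Lin m M) :
    ∃ (V : ℕ → Type) (_ : ∀ i, AddCommGroup (V i)) (_ : ∀ i, Module 𝕜 (V i))
      (D : ∀ i, R ⊗[𝕜] V (i + 1) →ₗ[R] R ⊗[𝕜] V i) (e : R ⊗[𝕜] V 0 →ₗ[R] M),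
      Function.Surjective e ∧ LinearMap.ker e = LinearMap.range (D 0) ∧
      (∀ i, LinearMap.ker (D i) = LinearMap.range (D (i + 1))) ∧
      (∀ i, HomogOne (M := GMod.free g (V (i + 1))) (N := GMod.free g (V i)) (D i)) ∧
      Homog (M := GMod.free g (V 0)) (N := M) e := by
  have step : ∀ X : {N : GMod g // ∀ m, Lin m N}, ∃ (V : Type) (_ : AddCommGroup V)
      (_ : Module 𝕜 V) (Y : {N : GMod g // ∀ m, Lin m N}) (ι : Y.1 →ₗ[R] R ⊗[𝕜] V)
      (π : R ⊗[𝕜] V →ₗ[R] X.1), IsPres ι π := by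
    rintro ⟨N, hN⟩
    obtain ⟨V, _, _, N', ι, π, P, -⟩ := hN 1
    exact ⟨V, _, _, ⟨N', fun m => (hN (m + 1)).of_pres P⟩, ι, π, P⟩
  choose V i₁ i₂ Y ι π P using step
  let S : ℕ → {N : GMod g // ∀ m, Lin m N} := fun n => Nat.rec ⟨M, h⟩ (fun _ X => Y X) n
  have hker : ∀ i, LinearMap.ker (π (S i)) =
      LinearMap.range (ι (S i) ∘ₗ π (S (i + 1))) := by
    intro i
    ext x
    constructor
    · intro hx
      obtain ⟨y, hy⟩ := (P (S i)).exact x hx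
      obtain ⟨z, hz⟩ := (P (S (i + 1))).surj y
      refine ⟨z, ?_⟩
      rw [LinearMap.comp_apply, hz, hy]
    · rintro ⟨y, rfl⟩
      exact (P (S i)).π_ι _
  refine ⟨fun i => V (S i), fun i => i₁ (S i), fun i => i₂ (S i),
    fun i => ι (S i) ∘ₗ π (S (i + 1)), π (S 0), (P (S 0)).surj, hker 0, ?_, ?_, (P (S 0)).π_homog⟩
  · intro i
    rw [← hker (i + 1)]
    ext x
    rw [LinearMap.mem_ker, LinearMap.mem_ker, LinearMap.comp_apply]
    exact ⟨fun h => (P (S i)).inj (by rw [h, map_zero]), fun h => by rw [h, map_zero]⟩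
  · intro i l x
    rw [LinearMap.comp_apply, (P (S (i + 1))).π_homog, LinearMap.comp_apply]
    exact (P (S i)).ι_homog _ _

variable {𝓡 : ℕ → Submodule 𝕜 R}

lemma mem_augIdeal (h : ∀ n r, r ∈ 𝓡 n ↔ g.p n r = r) (x : R) :
    x ∈ augIdeal 𝕜 R 𝓡 ↔ g.ε x = 0 := by
  have h0 : ∀ y, g.ε y = 0 ↔ g.p 0 y = 0 := fun y => by
    rw [g.p_zero]
    refine ⟨fun h => by rw [h, zero_smul], fun h => ?_⟩
    have := congrArg g.ε h
    simpa [g.ε_one] using this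
  rw [h0]
  constructor
  · intro hx
    induction hx using Submodule.span_induction with
    | mem x hx =>
      obtain ⟨i, hi, hx⟩ := hx
      rw [← (h i x).1 hx, g.p_p, if_neg (by omega)]
    | zero => simp
    | add x y _ _ hx hy => rw [map_add, hx, hy, add_zero]
    | smul r x _ hx => simp [g.p_mul, hx]
  · intro hx
    refine (GMod.reg g).mem_of_p_mem (augIdeal 𝕜 R 𝓡).toAddSubgroup x fun i => ?_
    rcases Nat.eq_zero_or_pos i with rfl | hi
    · change g.p 0 x ∈ augIdeal 𝕜 R 𝓡
      rw [hx]
      exact zero_mem _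
    · exact Submodule.subset_span ⟨i, hi, (h i _).2 (by simp [g.p_p])⟩

/-- The trivial module of a connected graded algebra. -/
abbrev augQuot (g : GAlg 𝕜 R) (𝓡 : ℕ → Submodule 𝕜 R) (h : ∀ n r, r ∈ 𝓡 n ↔ g.p n r = r) :
    GMod g :=
  (GMod.reg g).quot (augIdeal 𝕜 R 𝓡) (fun i x hx => by
    rw [mem_augIdeal h] at hx ⊢
    change g.ε (g.p i x) = 0
    rw [g.ε_p]
    split_ifs <;> simp [hx])

lemma augQuot_p_zero (h : ∀ n r, r ∈ 𝓡 n ↔ g.p n r = r) (x : augQuot g 𝓡 h) :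
    (augQuot g 𝓡 h).p 0 x = x := by
  obtain ⟨x, rfl⟩ := Submodule.Quotient.mk_surjective (augIdeal 𝕜 R 𝓡) x
  refine (Submodule.Quotient.eq _).2 ((mem_augIdeal h _).2 ?_)
  change g.ε (g.p 0 x - x) = 0
  rw [map_sub, g.ε_p, if_pos rfl, sub_self]

lemma GMod.smul_eq_of_p_zero {L : GMod g} (hL : ∀ x, L.p 0 x = x) (r : R) (x : L) :
    r • x = g.ε r • x := by
  have := L.p_smul 0 r x
  rw [hL] at this
  simpa [hL, g.p_zero] using this

/-- Modules concentrated in degree zero are linear as soon as the trivial module is. -/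
lemma Lin.of_p_zero (h : ∀ n r, r ∈ 𝓡 n ↔ g.p n r = r) {m : ℕ} (hT : Lin m (augQuot g 𝓡 h))
    {L : GMod g} (hL : ∀ x, L.p 0 x = x) : Lin m L := by
  let T := augQuot g 𝓡 h
  let u : T := Submodule.Quotient.mk 1
  have hu : ∀ r : R, (Submodule.Quotient.mk r : T) = g.ε r • u := by
    intro r
    rw [← GMod.smul_eq_of_p_zero (augQuot_p_zero h)]
    change _ = Submodule.Quotient.mk (r • (1 : R))
    rw [smul_eq_mul, mul_one]
  let δ : T →ₗ[𝕜] 𝕜 := ((augIdeal 𝕜 R 𝓡).restrictScalars 𝕜).liftQ g.ε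
    (fun x hx => (mem_augIdeal h x).1 hx)
  have hδ : δ u = 1 := g.ε_one
  let f : L →ₗ[R] T ⊗[𝕜] L :=
    { toFun := fun x => u ⊗ₜ x
      map_add' := fun x y => TensorProduct.tmul_add _ _ _
      map_smul' := fun r x => by
        rw [GMod.smul_eq_of_p_zero hL, RingHom.id_apply, TensorProduct.smul_tmul',
          GMod.smul_eq_of_p_zero (augQuot_p_zero h), TensorProduct.smul_tmul] }
  have hf : Function.Bijective f := by
    constructor
    · intro x y hxy
      have := congrArg ((TensorProduct.lid 𝕜 L).toLinearMap ∘ₗ δ.rTensor L) hxy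
      simpa [f, hδ] using this
    · intro (x : T ⊗[𝕜] L)
      induction x with
      | zero => exact ⟨0, map_zero f⟩
      | add x y hx hy =>
        obtain ⟨a, rfl⟩ := hx
        obtain ⟨b, rfl⟩ := hy
        exact ⟨a + b, map_add f a b⟩
      | tmul t x =>
        obtain ⟨r, rfl⟩ := Submodule.Quotient.mk_surjective (augIdeal 𝕜 R 𝓡) t
        refine ⟨g.ε r • x, ?_⟩
        rw [hu, TensorProduct.smul_tmul]
        rfl
  refine (hT.tensorRight L).iso (LinearEquiv.ofBijective f hf).symm ?_
  intro i x
  obtain ⟨x, rfl⟩ := (LinearEquiv.ofBijective f hf).surjective x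
  rw [LinearEquiv.symm_apply_apply, LinearEquiv.symm_apply_eq]
  change _ = u ⊗ₜ[𝕜] (L.p i x)
  change (T.p i u) ⊗ₜ[𝕜] x = _
  rw [← augQuot_p_zero h u, T.p_p]
  conv_rhs => rw [← hL x, L.p_p, hL x]
  split_ifs with hi
  · rw [augQuot_p_zero]
  · simp

/-- The identification of a free module with finitely supported functions. -/
def freeEquiv {σ V : Type} [AddCommGroup V] [Module 𝕜 V] (R : Type) [Ring R] [Algebra 𝕜 R]
    (b : V ≃ₗ[𝕜] (σ →₀ 𝕜)) : R ⊗[𝕜] V ≃ₗ[R] (σ →₀ R) :=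
  letI := Classical.decEq σ
  (TensorProduct.AlgebraTensorModule.congr (LinearEquiv.refl R R) b) ≪≫ₗ
    TensorProduct.finsuppScalarRight 𝕜 R R σ

lemma freeEquiv_p {σ V : Type} [AddCommGroup V] [Module 𝕜 V] (b : V ≃ₗ[𝕜] (σ →₀ 𝕜)) (l : ℕ)
    (x : R ⊗[𝕜] V) (j : σ) :
    freeEquiv R b ((GMod.free g V).p l x) j = g.p l (freeEquiv R b x j) := by
  induction x with
  | zero => simp
  | add x y hx hy => simp only [map_add, Finsupp.add_apply, hx, hy]
  | tmul r v => simp [freeEquiv]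

lemma mem_freeGrade (h : ∀ n r, r ∈ 𝓡 n ↔ g.p n r = r) {σ V : Type} [AddCommGroup V]
    [Module 𝕜 V] (b : V ≃ₗ[𝕜] (σ →₀ 𝕜)) (i n : ℕ) (x : R ⊗[𝕜] V) :
    freeEquiv R b x ∈ freeGrade 𝕜 R 𝓡 i σ n ↔
      (if i ≤ n then (GMod.free g V).p (n - i) x = x else x = 0) := by
  simp only [freeGrade, Submodule.mem_iInf, Submodule.mem_comap, Finsupp.lapply_apply]
  split_ifs with hi
  · simp only [h]
    rw [← (freeEquiv R b).injective.eq_iff, Finsupp.ext_iff]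
    exact forall_congr' fun j => by rw [freeEquiv_p]
  · rw [← (freeEquiv R b).map_eq_zero_iff, Finsupp.ext_iff]
    simp

lemma IsKoszul.lin (h : ∀ n r, r ∈ 𝓡 n ↔ g.p n r = r) (hK : IsKoszul 𝕜 R 𝓡) (m : ℕ) :
    Lin m (augQuot g 𝓡 h) := by
  obtain ⟨σ, d, e, hs, h0, hd, hdh, heh⟩ := hK
  let φ := fun i => freeEquiv (σ := σ i) R (LinearEquiv.refl 𝕜 (σ i →₀ 𝕜))
  have hfix : ∀ (l : ℕ) (i : ℕ) (x : R ⊗[𝕜] (σ i →₀ 𝕜)), φ i x ∈ freeGrade 𝕜 R 𝓡 i (σ i) (l + i) ↔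
      (GMod.free g (σ i →₀ 𝕜)).p l x = x := by
    intro l i x
    rw [mem_freeGrade h, if_pos (by omega), Nat.add_sub_cancel]
  refine Lin.of_resolution m (fun i => σ i →₀ 𝕜)
    (fun i => (φ i).symm.toLinearMap ∘ₗ d i ∘ₗ (φ (i + 1)).toLinearMap) _
    (e ∘ₗ (φ 0).toLinearMap) (hs.comp (φ 0).surjective) ?_ ?_ ?_ ?_
  · ext x
    rw [LinearMap.mem_ker, LinearMap.comp_apply, ← LinearMap.mem_ker, h0]
    constructor
    · rintro ⟨y, hy⟩
      exact ⟨(φ 1).symm y, by simp [hy]⟩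
    · rintro ⟨y, hy⟩
      exact ⟨φ 1 y, by rw [← hy]; simp⟩
  · intro i
    ext x
    have : x ∈ LinearMap.ker ((φ i).symm.toLinearMap ∘ₗ d i ∘ₗ (φ (i + 1)).toLinearMap) ↔
        φ (i + 1) x ∈ LinearMap.ker (d i) := by simp
    rw [this, hd]
    constructor
    · rintro ⟨y, hy⟩
      exact ⟨(φ _).symm y, by simp [hy]⟩
    · rintro ⟨y, hy⟩
      exact ⟨φ _ y, by rw [← hy]; simp⟩
  · intro i
    refine homog_of_fixed (M := GMod.free g (σ (i + 1) →₀ 𝕜)) (N := GMod.free g (σ i →₀ 𝕜))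
      ((φ i).symm.toLinearMap ∘ₗ d i ∘ₗ (φ (i + 1)).toLinearMap).toAddMonoidHom 1 ?_
    intro l x hx
    rw [← hfix]
    have := hdh i (l + (i + 1)) _ ((hfix l (i + 1) x).2 hx)
    rw [show l + 1 + i = l + (i + 1) by omega]
    simpa using this
  · refine homog_of_fixed (M := GMod.free g (σ 0 →₀ 𝕜)) (N := augQuot g 𝓡 h)
      (e ∘ₗ (φ 0).toLinearMap).toAddMonoidHom 0 ?_
    intro l x hx
    rcases Nat.eq_zero_or_pos l with rfl | hl
    · exact augQuot_p_zero h _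
    · have : e (φ 0 x) = 0 := heh l hl _ ((hfix l 0 x).2 hx)
      change (augQuot g 𝓡 h).p (l + 0) (e (φ 0 x)) = e (φ 0 x)
      rw [this, map_zero]

lemma isKoszul_of_lin (h : ∀ n r, r ∈ 𝓡 n ↔ g.p n r = r) (hL : ∀ m, Lin m (augQuot g 𝓡 h)) :
    IsKoszul 𝕜 R 𝓡 := by
  obtain ⟨V, _, _, D, e, hs, h0, hD, hDh, heh⟩ := Lin.exists_resolution hL
  let b := fun i => Module.Basis.ofVectorSpace 𝕜 (V i)
  let φ := fun i => freeEquiv R (b i).repr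
  refine ⟨fun i => Module.Basis.ofVectorSpaceIndex 𝕜 (V i),
    fun i => (φ i).toLinearMap ∘ₗ D i ∘ₗ (φ (i + 1)).symm.toLinearMap,
    e ∘ₗ (φ 0).symm.toLinearMap, hs.comp (φ 0).symm.surjective, ?_, ?_, ?_, ?_⟩
  · ext x
    rw [LinearMap.mem_ker, LinearMap.comp_apply, ← LinearMap.mem_ker, h0]
    constructor
    · rintro ⟨y, hy⟩
      exact ⟨φ 1 y, by simp [hy]⟩
    · rintro ⟨y, hy⟩
      exact ⟨(φ 1).symm y, by rw [← hy]; simp⟩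
  · intro i
    ext x
    have : x ∈ LinearMap.ker ((φ i).toLinearMap ∘ₗ D i ∘ₗ (φ (i + 1)).symm.toLinearMap) ↔
        (φ (i + 1)).symm x ∈ LinearMap.ker (D i) := by simp
    rw [this, hD]
    constructor
    · rintro ⟨y, hy⟩
      exact ⟨φ _ y, by simp [hy]⟩
    · rintro ⟨y, hy⟩
      exact ⟨(φ _).symm y, by rw [← hy]; simp⟩
  · intro i n x hx
    obtain ⟨x, rfl⟩ := (φ (i + 1)).surjective x
    simp only [LinearMap.comp_apply, LinearEquiv.coe_coe, LinearEquiv.symm_apply_apply]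
    rw [mem_freeGrade (g := g) h] at hx
    rw [mem_freeGrade (g := g) h]
    split_ifs at hx with hn
    · rw [if_pos (by omega), show n - i = n - (i + 1) + 1 by omega, ← hDh, hx]
    · rw [hx, map_zero, map_zero]
      split_ifs <;> rfl
  · intro n hn x hx
    obtain ⟨x, rfl⟩ := (φ 0).surjective x
    simp only [LinearMap.comp_apply, LinearEquiv.coe_coe, LinearEquiv.symm_apply_apply]
    rw [mem_freeGrade (g := g) h, if_pos (Nat.zero_le n), Nat.sub_zero] at hx
    rw [← hx, heh, ← augQuot_p_zero h (e x), GMod.p_p, if_neg (by omega)]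

end KoszulLinear

end TTP

namespace TTP

section Induction

variable {𝕜 : Type} [Field 𝕜]

namespace GAlg

variable {R S : Type} [Ring R] [Algebra 𝕜 R] [Ring S] [Algebra 𝕜 S]

lemma smul_one_inj (g : GAlg 𝕜 R) {c d : 𝕜} (h : c • (1 : R) = d • 1) : c = d := by
  simpa [g.ε_one] using congrArg g.ε h

lemma ε_mul (g : GAlg 𝕜 R) (x y : R) : g.ε (x * y) = g.ε x * g.ε y := by
  apply g.smul_one_inj
  rw [← g.p_zero, g.p_mul]
  simp [g.p_zero, mul_smul, smul_comm (g.ε y)]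

/-- The augmentation as an algebra homomorphism. -/
def εHom (g : GAlg 𝕜 R) : R →ₐ[𝕜] 𝕜 := AlgHom.ofLinearMap g.ε g.ε_one g.ε_mul

lemma ε_map {g : GAlg 𝕜 R} {h : GAlg 𝕜 S} (f : R →ₐ[𝕜] S) (hf : ∀ i r, f (g.p i r) = h.p i (f r))
    (r : R) : h.ε (f r) = g.ε r := by
  apply h.smul_one_inj
  rw [← h.p_zero, ← hf, g.p_zero, map_smul, map_one]

end GAlg

/-- A vector space viewed as a graded module concentrated in degree zero. -/
def GMod.triv {R : Type} [Ring R] [Algebra 𝕜 R] (g : GAlg 𝕜 R) (U : Type) [AddCommGroup U]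
    [Module 𝕜 U] : GMod g :=
  letI := Module.compHom U g.εHom.toRingHom
  { carrier := U
    isScalarTower := ⟨fun c s x => by
      change g.ε (c • s) • x = c • (g.ε s • x)
      rw [map_smul, smul_assoc]⟩
    p := fun i => if i = 0 then LinearMap.id else 0
    p_p := fun i j x => by split_ifs <;> simp_all
    exists_sum := fun x => ⟨1, by simp⟩
    p_smul := fun l s x => by
      change (if l = 0 then LinearMap.id else 0) (g.ε s • x) = ∑ ij ∈ Finset.HasAntidiagonal.antidiagonal l,
        g.ε (g.p ij.1 s) • (if ij.2 = 0 then LinearMap.id else (0 : U →ₗ[𝕜] U)) x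
      rw [Finset.sum_eq_single (l, 0)]
      · simp only [g.ε_p, if_true, LinearMap.id_apply]
        split_ifs <;> simp
      · rintro ⟨a, b⟩ hab hne
        have hb : b ≠ 0 := by
          rintro rfl
          exact hne (by simpa using hab)
        simp [hb]
      · simp }

/-- Restriction of scalars of a module homomorphism. -/
def GMod.restrictMap {R S : Type} [Ring R] [Algebra 𝕜 R] [Ring S] [Algebra 𝕜 S] {g : GAlg 𝕜 R}
    {h : GAlg 𝕜 S} {M N : GMod g} (f : S →ₐ[𝕜] R) (hf : ∀ i s, f (h.p i s) = g.p i (f s))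
    (φ : M →ₗ[R] N) : (M.restrict f hf) →ₗ[S] (N.restrict f hf) where
  toFun := φ
  map_add' := φ.map_add
  map_smul' s x := φ.map_smul (f s) x

variable {A B C : Type} [Ring A] [Algebra 𝕜 A] [Ring B] [Algebra 𝕜 B] [Ring C] [Algebra 𝕜 C]

/-- The map `a ⊗ w ↦ f(a) • j(w)`. -/
def act {W M : Type} [AddCommGroup W] [Module 𝕜 W] [AddCommGroup M] [Module 𝕜 M] [Module C M]
    [IsScalarTower 𝕜 C M] (f : A →ₐ[𝕜] C) (j : W →ₗ[𝕜] M) : A ⊗[𝕜] W →ₗ[𝕜] M :=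
  TensorProduct.lift (((Algebra.lsmul 𝕜 𝕜 M).toLinearMap.compl₂ j) ∘ₗ f.toLinearMap)

@[simp] lemma act_tmul {W M : Type} [AddCommGroup W] [Module 𝕜 W] [AddCommGroup M] [Module 𝕜 M]
    [Module C M] [IsScalarTower 𝕜 C M] (f : A →ₐ[𝕜] C) (j : W →ₗ[𝕜] M) (a : A) (w : W) :
    act f j (a ⊗ₜ w) = f a • j w := by
  simp [act]

/-- The graded algebra `C` is the product of its graded subalgebras `A` and `B`. -/
structure IsProd (gA : GAlg 𝕜 A) (gB : GAlg 𝕜 B) (gC : GAlg 𝕜 C) (ιA : A →ₐ[𝕜] C)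
    (ιB : B →ₐ[𝕜] C) : Prop where
  ιA_p : ∀ i a, ιA (gA.p i a) = gC.p i (ιA a)
  ιB_p : ∀ i b, ιB (gB.p i b) = gC.p i (ιB b)
  bij : Function.Bijective (act ιA ιB.toLinearMap)

variable {gA : GAlg 𝕜 A} {gB : GAlg 𝕜 B} {gC : GAlg 𝕜 C} {ιA : A →ₐ[𝕜] C} {ιB : B →ₐ[𝕜] C}

lemma rTensor_homog {g : GAlg 𝕜 A} {h : GAlg 𝕜 B} (f : A →ₐ[𝕜] B)
    (hf : ∀ i a, f (g.p i a) = h.p i (f a)) (V : Type) [AddCommGroup V] [Module 𝕜 V] :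
    Homog (M := GMod.free g V) (N := GMod.free h V) (f.toLinearMap.rTensor V) := by
  intro i (x : A ⊗[𝕜] V)
  induction x with
  | zero => simp
  | tmul r v => simp [hf]
  | add x y hx hy => simp only [map_add, hx, hy]

lemma rTensor_smul (f : A →ₐ[𝕜] B) {V : Type} [AddCommGroup V] [Module 𝕜 V] (a : A)
    (x : A ⊗[𝕜] V) : f.toLinearMap.rTensor V (a • x) = f a • f.toLinearMap.rTensor V x := by
  induction x with
  | zero => simp
  | tmul r v => simp [TensorProduct.smul_tmul']
  | add x y hx hy => simp only [smul_add, map_add, hx, hy]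

namespace IsProd

/-- Free `C`-modules are induced from free `B`-modules. -/
lemma act_rTensor_bij (H : IsProd gA gB gC ιA ιB) (V : Type) [AddCommGroup V] [Module 𝕜 V] :
    Function.Bijective (act ιA (ιB.toLinearMap.rTensor V)) := by
  let e := TensorProduct.congr (LinearEquiv.ofBijective _ H.bij) (LinearEquiv.refl 𝕜 V)
  have : act ιA (ιB.toLinearMap.rTensor V) =
      ((TensorProduct.assoc 𝕜 A B V).symm ≪≫ₗ e).toLinearMap := by
    ext a b v
    simp [e, TensorProduct.smul_tmul']
  rw [this]
  exact LinearEquiv.bijective _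

/-- Modules induced from linear modules are linear. -/
lemma lin_induced (H : IsProd gA gB gC ιA ιB) {m : ℕ} {W : GMod gB} {M : GMod gC}
    (j : W →ₗ[𝕜] M) (hj : ∀ b w, j (b • w) = ιB b • j w) (hjh : Homog (M := W) (N := M) j)
    (hbij : Function.Bijective (act ιA j)) (hW : Lin m W) : Lin m M := by
  induction m generalizing W M with
  | zero => trivial
  | succ m ih =>
    obtain ⟨V, _, _, W', ι, π, P, hW'⟩ := hW
    let jV : B ⊗[𝕜] V →ₗ[𝕜] C ⊗[𝕜] V := ιB.toLinearMap.rTensor V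
    let πM : C ⊗[𝕜] V →ₗ[C] M := linLift (j ∘ₗ gen π)
    have hVbij : Function.Bijective (act ιA jV) := H.act_rTensor_bij V
    have hjinj : Function.Injective j := by
      intro x y hxy
      have : (1 : A) ⊗ₜ[𝕜] x = (1 : A) ⊗ₜ[𝕜] y := hbij.1 (by simp [hxy])
      rw [← sub_eq_zero, ← TensorProduct.tmul_sub] at this
      exact sub_eq_zero.1 (one_tmul_injective gA this)
    have hπj : ∀ x, πM (jV x) = j (π x) := by
      intro x
      induction x with
      | zero => simp
      | add x y hx hy => simp only [map_add, hx, hy]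
      | tmul b v =>
        have : b ⊗ₜ[𝕜] v = b • ((1 : B) ⊗ₜ[𝕜] v) := by simp [TensorProduct.smul_tmul']
        rw [this, π.map_smul, hj]
        simp [πM, jV, TensorProduct.smul_tmul']
    have hπact : ∀ x, πM (act ιA jV x) = act ιA j ((π.restrictScalars 𝕜).lTensor A x) := by
      intro x
      induction x with
      | zero => simp
      | add x y hx hy => simp only [map_add, hx, hy]
      | tmul a x => simp [hπj]
    have hex : Function.Exact ((ι.restrictScalars 𝕜).lTensor A)
        ((π.restrictScalars 𝕜).lTensor A) :=
      lTensor_exact A (fun x => ⟨fun hx => P.exact x hx, fun ⟨y, hy⟩ => hy ▸ P.π_ι y⟩) P.surj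
    obtain ⟨M', ιM, Q⟩ := exists_isPres (g := gC) (M := M) πM (by
        intro y
        obtain ⟨x, rfl⟩ := hbij.2 y
        obtain ⟨z, rfl⟩ := LinearMap.lTensor_surjective A (g := π.restrictScalars 𝕜) P.surj x
        exact ⟨_, hπact z⟩)
      (linLift_homog M _ (fun v => by
        rw [LinearMap.comp_apply, ← hjh, gen_apply, P.p_zero_π])) (fun v hv => by
        apply P.one_tmul_inj
        apply hjinj
        rw [← hπj, map_zero, ← hv]
        simp [jV])
    choose j' hj' using fun w => Q.exact (jV (ι w)) (by rw [hπj, P.π_ι, map_zero])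
    let J : W' →ₗ[𝕜] M' :=
      { toFun := j'
        map_add' := fun x y => Q.inj (by simp only [map_add, hj'])
        map_smul' := fun c x => Q.inj (by
          have h1 := (ι.restrictScalars 𝕜).map_smul c x
          have h2 := (ιM.restrictScalars 𝕜).map_smul c (j' x)
          simp only [LinearMap.restrictScalars_apply] at h1 h2
          rw [hj', h1, map_smul, RingHom.id_apply, h2, hj']) }
    have hJ : ∀ x, ιM (act ιA J x) = act ιA jV ((ι.restrictScalars 𝕜).lTensor A x) := by
      intro x
      induction x with
      | zero => simp
      | add x y hx hy => simp only [map_add, hx, hy]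
      | tmul a x => simp [J, hj']
    refine ⟨V, _, _, M', ιM, πM, Q, ih J ?_ ?_ ⟨?_, ?_⟩ hW'⟩
    · intro b w
      apply Q.inj
      change ιM (j' _) = ιM (_ • j' _)
      rw [hj', ι.map_smul, ιM.map_smul, hj']
      exact rTensor_smul ιB b _
    · intro i w
      apply Q.inj
      change ιM (j' _) = ιM (M'.p i (j' _))
      rw [hj', P.ι_homog, Q.ι_homog, hj']
      exact rTensor_homog ιB H.ιB_p V _ _
    · intro x y hxy
      have := congrArg ιM hxy
      rw [hJ, hJ] at this
      exact Module.Flat.lTensor_preserves_injective_linearMap (M := A) (ι.restrictScalars 𝕜) P.inj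
        (hVbij.1 this)
    · intro x
      obtain ⟨y, hy⟩ := hVbij.2 (ιM x)
      have hy0 : (π.restrictScalars 𝕜).lTensor A y = 0 := by
        apply hbij.1
        rw [← hπact, hy, Q.π_ι, map_zero]
      obtain ⟨z, rfl⟩ := (hex y).1 hy0
      exact ⟨z, Q.inj (by rw [hJ, hy])⟩

/-- If `A` is a quotient of `C`, linear `A`-modules are linear over `C`. -/
lemma lin_restrict (H : IsProd gA gB gC ιA ιB) (ρ : C →ₐ[𝕜] A)
    (hρ : ∀ i c, ρ (gC.p i c) = gA.p i (ρ c)) (hρA : ∀ a, ρ (ιA a) = a)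
    (hρB : ∀ b, ρ (ιB b) = gB.ε b • 1)
    (hB : ∀ (m : ℕ) (U : Type) [AddCommGroup U] [Module 𝕜 U], Lin m (GMod.triv gB U))
    {m : ℕ} {N : GMod gA} (hN : Lin m N) : Lin m (N.restrict ρ hρ) := by
  induction m generalizing N with
  | zero => trivial
  | succ m ih =>
    obtain ⟨U, _, _, N', ι, π, P, hN'⟩ := hN
    refine Lin.quotient (GMod.restrictMap (N := GMod.free gA U) ρ hρ ι)
      (GMod.restrictMap (M := GMod.free gA U) ρ hρ π) P.inj P.surj P.π_ι P.exact
      P.ι_homog P.π_homog (ih hN') ?_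
    let j : GMod.triv gB U →ₗ[𝕜] (GMod.free gA U).restrict ρ hρ := TensorProduct.mk 𝕜 A U 1
    refine H.lin_induced j ?_ ?_ ?_ (hB (m + 1) U)
    · intro b (u : U)
      change (1 : A) ⊗ₜ[𝕜] (gB.ε b • u) = ρ (ιB b) • ((1 : A) ⊗ₜ[𝕜] u)
      rw [hρB]
      simp [TensorProduct.smul_tmul']
    · intro i (u : U)
      change (1 : A) ⊗ₜ[𝕜] ((if i = 0 then LinearMap.id else (0 : U →ₗ[𝕜] U)) u) =
        (GMod.free gA U).p i (1 ⊗ₜ u)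
      rw [LinearMap.rTensor_tmul]
      change _ = (gA.p i 1) ⊗ₜ[𝕜] u
      rw [gA.p_one]
      split_ifs <;> simp
    · have : ∀ x : A ⊗[𝕜] U, act ιA j x = x := by
        intro x
        induction x using TensorProduct.induction_on with
        | zero => exact map_zero _
        | add x y hx hy => exact (map_add (act ιA j) x y).trans (congrArg₂ (· + ·) hx hy)
        | tmul a u =>
          refine (act_tmul ιA j a u).trans ?_
          change ρ (ιA a) • ((1 : A) ⊗ₜ[𝕜] u) = _
          rw [hρA]
          simp [TensorProduct.smul_tmul']
      exact ⟨fun x y hxy => (this x).symm.trans (hxy.trans (this y)), fun x => ⟨x, this x⟩⟩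

end IsProd

end Induction

end TTP

namespace TTP

section Fibered

variable {𝕜 : Type} [Field 𝕜]
variable {A B C : Type} [Ring A] [Algebra 𝕜 A] [Ring B] [Algebra 𝕜 B] [Ring C] [Algebra 𝕜 C]
  {gA : GAlg 𝕜 A} {gB : GAlg 𝕜 B} {gC : GAlg 𝕜 C} {ιA : A →ₐ[𝕜] C} {ιB : B →ₐ[𝕜] C}
  {ρ : C →ₐ[𝕜] B}

/-- Elements of degree zero lift uniquely to generators in a minimal presentation. -/
lemma IsPres.exists_lift {V U : Type} [AddCommGroup V] [Module 𝕜 V] [AddCommGroup U]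
    [Module 𝕜 U] {M N : GMod gC} {ι : N →ₗ[C] C ⊗[𝕜] V} {π : C ⊗[𝕜] V →ₗ[C] M}
    (P : IsPres ι π) (t : U →ₗ[𝕜] M) (ht : ∀ u, M.p 0 (t u) = t u) :
    ∃ η : U →ₗ[𝕜] V, ∀ u, π (1 ⊗ₜ η u) = t u := by
  choose η hη using fun u => P.exists_gen (ht u)
  have hinj : ∀ v w : V, gen π v = gen π w → v = w := by
    intro v w hvw
    rw [← sub_eq_zero, ← map_sub] at hvw
    exact sub_eq_zero.1 (P.one_tmul_inj hvw)
  have hη' : ∀ v, gen π (η v) = t v := hη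
  exact ⟨{ toFun := η
           map_add' := fun v w => hinj _ _ (by simp only [map_add, hη'])
           map_smul' := fun c v => hinj _ _ (by simp only [map_smul, hη', RingHom.id_apply]) }, hη⟩

/-- The submodule generated by the action of the kernel of `ρ`. -/
def kerSMul (ρ : C →ₐ[𝕜] B) (M : GMod gC) : Submodule C M :=
  Submodule.span C {x | ∃ (c : C) (y : M), ρ c = 0 ∧ x = c • y}

lemma smul_mem_kerSMul (M : GMod gC) {c : C} (hc : ρ c = 0) (y : M) : c • y ∈ kerSMul ρ M :=
  Submodule.subset_span ⟨c, y, hc, rfl⟩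

lemma p_mem_kerSMul (hρ : ∀ i c, ρ (gC.p i c) = gB.p i (ρ c)) (M : GMod gC) {x : M}
    (hx : x ∈ kerSMul ρ M) (i : ℕ) : M.p i x ∈ kerSMul ρ M := by
  induction hx using Submodule.span_induction generalizing i with
  | mem x hx =>
    obtain ⟨c, y, hc, rfl⟩ := hx
    rw [M.p_smul]
    exact sum_mem fun ij _ => smul_mem_kerSMul M (by rw [hρ, hc, map_zero]) _
  | zero => rw [map_zero]; exact zero_mem _
  | add x y _ _ hx hy => rw [map_add]; exact add_mem (hx i) (hy i)
  | smul c x _ hx =>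
    rw [M.p_smul]
    exact sum_mem fun ij _ => Submodule.smul_mem _ _ (hx _)

/-- A graded version of Nakayama's lemma. -/
lemma nakayama (hρ : ∀ i c, ρ (gC.p i c) = gB.p i (ρ c)) (M : GMod gC) (S : Submodule C M)
    (hS : ∀ i, ∀ x ∈ S, M.p i x ∈ S) (h : ∀ x : M, ∃ s ∈ S, x - s ∈ kerSMul ρ M) (x : M) :
    x ∈ S := by
  refine M.mem_of_p_mem S.toAddSubgroup x fun l => ?_
  change M.p l x ∈ S
  induction l using Nat.strong_induction_on generalizing x with
  | _ l ih =>
    have key : ∀ w ∈ kerSMul ρ M, ∀ l' ≤ l, M.p l' w ∈ S := by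
      intro w hw
      induction hw using Submodule.span_induction with
      | mem w hw =>
        obtain ⟨c, y, hc, rfl⟩ := hw
        intro l' hl'
        rw [M.p_smul]
        refine sum_mem fun ij hij => ?_
        have hij' := Finset.HasAntidiagonal.mem_antidiagonal.1 hij
        rcases Nat.eq_zero_or_pos ij.1 with h0 | h0
        · rw [h0, gC.p_zero, ← gC.ε_map (g := gC) (AlgHom.id 𝕜 C) (fun _ _ => rfl),
            AlgHom.id_apply, ← GAlg.ε_map (h := gB) ρ hρ, hc, map_zero, zero_smul, zero_smul]
          exact zero_mem _
        · exact S.smul_mem _ (ih _ (by omega) _)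
      | zero => intro l' _; rw [map_zero]; exact zero_mem _
      | add x y _ _ hx hy => intro l' hl'; rw [map_add]; exact add_mem (hx l' hl') (hy l' hl')
      | smul c x _ hx =>
        intro l' hl'
        rw [M.p_smul]
        refine sum_mem fun ij hij => S.smul_mem _ (hx _ ?_)
        have hij' := Finset.HasAntidiagonal.mem_antidiagonal.1 hij
        omega
    obtain ⟨s, hs, hxs⟩ := h x
    have := add_mem (key _ hxs l le_rfl) (hS l s hs)
    rwa [← map_add, sub_add_cancel] at this

/-- A `C`-module fibered into its quotient `Y` over `B` and a relatively projective extension of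
an `A`-submodule `N`. -/
structure IsFib (ιA : A →ₐ[𝕜] C) (ρ : C →ₐ[𝕜] B) {M : GMod gC} {Y : GMod gB} {N : GMod gA}
    {Z : Type} [AddCommGroup Z] [Module 𝕜 Z] [Module A Z] (q : M →ₗ[𝕜] Y) (ι : N →ₗ[𝕜] M)
    (ζ : M →ₗ[𝕜] Z) : Prop where
  q_smul : ∀ c x, q (c • x) = ρ c • q x
  q_homog : Homog (M := M) (N := Y) q
  q_surj : Function.Surjective q
  q_ker : ∀ x, q x = 0 → x ∈ kerSMul ρ M
  ι_inj : Function.Injective ι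
  ι_smul : ∀ a x, ι (a • x) = ιA a • ι x
  ι_homog : Homog (M := N) (N := M) ι
  ζ_smul : ∀ a x, ζ (ιA a • x) = a • ζ x
  ζ_surj : Function.Surjective ζ
  ζ_ι : ∀ x, ζ (ι x) = 0
  exact : ∀ x, ζ x = 0 → ∃ y, ι y = x

namespace IsFib

/-- The minimal cover of a fibered module lifting one of its quotient. -/
lemma exists_cover (hρ : ∀ i c, ρ (gC.p i c) = gB.p i (ρ c)) (hρs : Function.Surjective ρ)
    {M : GMod gC} {Y S : GMod gB} {N : GMod gA}
    {Z : Type} [AddCommGroup Z] [Module 𝕜 Z] [Module A Z] {q : M →ₗ[𝕜] Y} {ι : N →ₗ[𝕜] M}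
    {ζ : M →ₗ[𝕜] Z} (F : IsFib ιA ρ q ι ζ) {V : Type} [AddCommGroup V] [Module 𝕜 V]
    {ιY : S →ₗ[B] B ⊗[𝕜] V} {πY : B ⊗[𝕜] V →ₗ[B] Y} (P : IsPres ιY πY) :
    ∃ (K : GMod gC) (κ : K →ₗ[C] C ⊗[𝕜] V) (π : C ⊗[𝕜] V →ₗ[C] M), IsPres κ π ∧
      ∀ x, q (π x) = πY (ρ.toLinearMap.rTensor V x) := by
  obtain ⟨s, hs⟩ := q.exists_rightInverse_of_surjective (LinearMap.range_eq_top.2 F.q_surj)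
  have hs' : ∀ x, q (s x) = x := fun x => LinearMap.congr_fun hs x
  let θ : V →ₗ[𝕜] M := M.p 0 ∘ₗ s ∘ₗ gen πY
  let π : C ⊗[𝕜] V →ₗ[C] M := linLift θ
  have hqπ : ∀ x, q (π x) = πY (ρ.toLinearMap.rTensor V x) := by
    intro x
    induction x with
    | zero => simp
    | add x y hx hy => simp only [map_add, hx, hy]
    | tmul c v =>
      have : (ρ c) ⊗ₜ[𝕜] v = ρ c • ((1 : B) ⊗ₜ[𝕜] v) := by simp [TensorProduct.smul_tmul']
      simp only [π, linLift_tmul, LinearMap.rTensor_tmul, AlgHom.toLinearMap_apply, this]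
      rw [F.q_smul, πY.map_smul]
      simp only [θ, LinearMap.comp_apply]
      rw [F.q_homog, hs', gen_apply, P.p_zero_π]
  have hπh : Homog (M := GMod.free gC V) (N := M) π :=
    linLift_homog M θ (fun v => by simp [θ, M.p_p])
  have hρV : Function.Surjective (ρ.toLinearMap.rTensor V) := LinearMap.rTensor_surjective V hρs
  obtain ⟨K, κ, Q⟩ := exists_isPres (g := gC) (M := M) π (by
      intro x
      refine nakayama hρ M (LinearMap.range π) ?_ ?_ x
      · rintro i _ ⟨y, rfl⟩
        exact ⟨_, hπh i y⟩
      · intro x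
        obtain ⟨y, hy⟩ := P.surj (q x)
        obtain ⟨z, rfl⟩ := hρV y
        exact ⟨π z, ⟨z, rfl⟩, F.q_ker _ (by rw [map_sub, hqπ, hy, sub_self])⟩) hπh
    (fun v hv => P.one_tmul_inj (by
      have := hqπ (1 ⊗ₜ v)
      rw [hv, map_zero] at this
      simpa using this.symm))
  exact ⟨K, κ, π, Q, hqπ⟩

end IsFib

lemma sub_smul_one_smul {M : Type} [AddCommGroup M] [Module 𝕜 M] [Module C M]
    [IsScalarTower 𝕜 C M] (x : C) (c : 𝕜) (z : M) : (x - c • (1 : C)) • z = x • z - c • z := by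
  rw [sub_smul, smul_assoc, one_smul]

lemma act_smul {W M : Type} [AddCommGroup W] [Module 𝕜 W] [AddCommGroup M] [Module 𝕜 M]
    [Module C M] [IsScalarTower 𝕜 C M] (f : A →ₐ[𝕜] C) (j : W →ₗ[𝕜] M) (a : A)
    (x : A ⊗[𝕜] W) : act f j (a • x) = f a • act f j x := by
  induction x with
  | zero => simp
  | add x y hx hy => simp only [smul_add, map_add, hx, hy]
  | tmul b w => simp [TensorProduct.smul_tmul', mul_smul]

namespace IsProd

/-- Elements of a free module killed by `ρ` are combinations of multiples by `A₊`. -/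
lemma mem_span_of_rTensor_eq_zero (H : IsProd gA gB gC ιA ιB)
    (hρA : ∀ a, ρ (ιA a) = gA.ε a • 1) (hρB : ∀ b, ρ (ιB b) = b) {V : Type} [AddCommGroup V]
    [Module 𝕜 V] {x : C ⊗[𝕜] V} (hx : ρ.toLinearMap.rTensor V x = 0) :
    x ∈ Submodule.span 𝕜 {y | ∃ (a : A) (z : C ⊗[𝕜] V), gA.ε a = 0 ∧ y = ιA a • z} := by
  obtain ⟨y, rfl⟩ := (H.act_rTensor_bij V).2 x
  have key : ∀ y : A ⊗[𝕜] (B ⊗[𝕜] V), act ιA (ιB.toLinearMap.rTensor V) y -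
      ιB.toLinearMap.rTensor V (ρ.toLinearMap.rTensor V (act ιA (ιB.toLinearMap.rTensor V) y)) ∈
      Submodule.span 𝕜 {y | ∃ (a : A) (z : C ⊗[𝕜] V), gA.ε a = 0 ∧ y = ιA a • z} := by
    intro y
    induction y with
    | zero => simp
    | add x y hx hy =>
      simp only [map_add]
      rw [add_sub_add_comm]
      exact add_mem hx hy
    | tmul a w =>
      have h1 : ρ.toLinearMap.rTensor V (ιB.toLinearMap.rTensor V w) = w := by
        induction w with
        | zero => simp
        | add x y hx hy => simp only [map_add, hx, hy]
        | tmul b v => simp [hρB]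
      rw [act_tmul, rTensor_smul, h1, hρA, smul_assoc, one_smul, map_smul]
      refine Submodule.subset_span ⟨a - gA.ε a • 1, ιB.toLinearMap.rTensor V w, ?_, ?_⟩
      · simp [gA.ε_one]
      · have h2 : ιA (a - gA.ε a • 1) = ιA a - gA.ε a • (1 : C) := by
          rw [map_sub, map_smul, map_one]
        rw [h2]
        exact (sub_smul_one_smul _ _ _).symm
  have := key y
  rwa [hx, map_zero, sub_zero] at this

end IsProd

end Fibered

end TTP

namespace TTP

section FiberedStep

variable {𝕜 : Type} [Field 𝕜]
variable {A B C : Type} [Ring A] [Algebra 𝕜 A] [Ring B] [Algebra 𝕜 B] [Ring C] [Algebra 𝕜 C]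
  {gA : GAlg 𝕜 A} {gB : GAlg 𝕜 B} {gC : GAlg 𝕜 C} {ιA : A →ₐ[𝕜] C} {ιB : B →ₐ[𝕜] C}
  {ρ : C →ₐ[𝕜] B}

namespace IsFib

variable {M : GMod gC} {Y : GMod gB} {N : GMod gA}
  {Z : Type} [AddCommGroup Z] [Module 𝕜 Z] [Module A Z] {q : M →ₗ[𝕜] Y} {ι : N →ₗ[𝕜] M}
  {ζ : M →ₗ[𝕜] Z}

/-- The syzygy of a fibered module is an extension of an `A`-projective module by the syzygy of
the `A`-submodule. -/
lemma exists_syzygy [IsScalarTower 𝕜 A Z] [Module.Projective A Z] (H : IsProd gA gB gC ιA ιB)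
    (hρA : ∀ a, ρ (ιA a) = gA.ε a • 1) (hρB : ∀ b, ρ (ιB b) = b)
    (F : IsFib ιA ρ q ι ζ) {V : Type} [AddCommGroup V] [Module 𝕜 V] {K : GMod gC}
    {κ : K →ₗ[C] C ⊗[𝕜] V} {π : C ⊗[𝕜] V →ₗ[C] M} (Q : IsPres κ π) {U : Type}
    [AddCommGroup U] [Module 𝕜 U] {N' : GMod gA} {ιN : N' →ₗ[A] A ⊗[𝕜] U}
    {πN : A ⊗[𝕜] U →ₗ[A] N} (PN : IsPres ιN πN) :
    ∃ (ι' : N' →ₗ[𝕜] K) (Z' : Type) (_ : AddCommGroup Z') (_ : Module 𝕜 Z') (_ : Module A Z')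
      (_ : IsScalarTower 𝕜 A Z') (_ : Module.Projective A Z') (ζ' : K →ₗ[𝕜] Z'),
      Function.Injective ι' ∧ (∀ a x, ι' (a • x) = ιA a • ι' x) ∧
      Homog (M := N') (N := K) ι' ∧ (∀ a x, ζ' (ιA a • x) = a • ζ' x) ∧
      Function.Surjective ζ' ∧ (∀ x, ζ' (ι' x) = 0) ∧ (∀ x, ζ' x = 0 → ∃ y, ι' y = x) ∧
      ∀ k, ρ.toLinearMap.rTensor V (κ k) = 0 → ∃ k' ∈ kerSMul ρ K, ζ' k' = ζ' k := by
  obtain ⟨η, hη⟩ := Q.exists_lift (ι ∘ₗ gen πN) (fun u => by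
    rw [LinearMap.comp_apply, ← F.ι_homog, gen_apply, PN.p_zero_π])
  have hη_inj : Function.Injective η := by
    intro u u' h
    rw [← sub_eq_zero] at h ⊢
    rw [← map_sub] at h
    apply PN.one_tmul_inj
    apply F.ι_inj
    have := hη (u - u')
    rw [h, TensorProduct.tmul_zero, map_zero] at this
    rw [map_zero]
    exact this.symm
  let Φ : A ⊗[𝕜] (B ⊗[𝕜] V) →ₗ[𝕜] C ⊗[𝕜] V := act ιA (ιB.toLinearMap.rTensor V)
  have hΦ : Function.Bijective Φ := H.act_rTensor_bij V
  let κ₀ : U →ₗ[𝕜] B ⊗[𝕜] V := TensorProduct.mk 𝕜 B V 1 ∘ₗ η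
  have hκ₀ : Function.Injective κ₀ := by
    intro u u' h
    apply hη_inj
    rw [← sub_eq_zero] at h ⊢
    refine one_tmul_injective gB ?_
    rw [TensorProduct.tmul_sub]
    exact h
  let J : A ⊗[𝕜] U →ₗ[𝕜] C ⊗[𝕜] V := act ιA (TensorProduct.mk 𝕜 C V 1 ∘ₗ η)
  have hJΦ : ∀ x, J x = Φ (κ₀.lTensor A x) := by
    intro x
    induction x with
    | zero => simp
    | add x y hx hy => simp only [map_add, hx, hy]
    | tmul a u => simp [J, Φ, κ₀]
  have hJ_inj : Function.Injective J := by
    intro x y h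
    rw [hJΦ, hJΦ] at h
    exact Module.Flat.lTensor_preserves_injective_linearMap (M := A) κ₀ hκ₀ (hΦ.1 h)
  have hJ_smul : ∀ a x, J (a • x) = ιA a • J x := act_smul ιA _
  have hJ_homog : Homog (M := GMod.free gA U) (N := GMod.free gC V) J := by
    intro i (x : A ⊗[𝕜] U)
    induction x with
    | zero => simp
    | add x y hx hy => simp only [map_add, hx, hy]
    | tmul a u => simp [J, TensorProduct.smul_tmul', H.ιA_p]
  have hπJ : ∀ x, π (J x) = ι (πN x) := by
    intro x
    induction x with
    | zero => simp
    | add x y hx hy => simp only [map_add, hx, hy]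
    | tmul a u =>
      have h1 : a ⊗ₜ[𝕜] u = a • ((1 : A) ⊗ₜ[𝕜] u) := by simp [TensorProduct.smul_tmul']
      rw [h1, hJ_smul, π.map_smul, πN.map_smul, F.ι_smul]
      refine congrArg (ιA a • ·) ?_
      have := hη u
      simpa [J] using this
  let Q₀ := (B ⊗[𝕜] V) ⧸ LinearMap.range κ₀
  let Ψ := LinearEquiv.ofBijective Φ hΦ
  let χ : C ⊗[𝕜] V →ₗ[𝕜] A ⊗[𝕜] Q₀ :=
    (LinearMap.range κ₀).mkQ.lTensor A ∘ₗ Ψ.symm.toLinearMap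
  have hχΦ : ∀ y, χ (Φ y) = (LinearMap.range κ₀).mkQ.lTensor A y := by
    intro y
    change (LinearMap.range κ₀).mkQ.lTensor A (Ψ.symm (Ψ y)) = _
    rw [Ψ.symm_apply_apply]
  have hχ_surj : Function.Surjective χ :=
    (LinearMap.lTensor_surjective A (g := (LinearMap.range κ₀).mkQ)
      (Submodule.mkQ_surjective _)).comp Ψ.symm.surjective
  have hχ_smul : ∀ a x, χ (ιA a • x) = a • χ x := by
    intro a x
    obtain ⟨y, rfl⟩ := hΦ.2 x
    rw [← act_smul, hχΦ, hχΦ]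
    exact ((LinearMap.range κ₀).mkQ.baseChange A).map_smul a y
  have hχJ : ∀ x, χ (J x) = 0 := by
    intro x
    rw [hJΦ, hχΦ, ← LinearMap.comp_apply, ← LinearMap.lTensor_comp]
    have : (LinearMap.range κ₀).mkQ ∘ₗ κ₀ = 0 := LinearMap.range_mkQ_comp κ₀
    rw [this]
    simp
  have hχ_ker : ∀ x, χ x = 0 → ∃ y, J y = x := by
    intro x hx
    obtain ⟨y, rfl⟩ := hΦ.2 x
    rw [hχΦ] at hx
    have hex : Function.Exact κ₀ (LinearMap.range κ₀).mkQ := LinearMap.exact_map_mkQ_range κ₀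
    obtain ⟨z, rfl⟩ := (lTensor_exact A hex (Submodule.mkQ_surjective _) y).1 hx
    exact ⟨z, hJΦ z⟩
  let ζ₀ : Q₀ →ₗ[𝕜] Z := (LinearMap.range κ₀).liftQ
    (ζ ∘ₗ π.restrictScalars 𝕜 ∘ₗ ιB.toLinearMap.rTensor V) (by
      rintro _ ⟨u, rfl⟩
      have := hη u
      rw [LinearMap.mem_ker]
      simp only [LinearMap.comp_apply, LinearMap.restrictScalars_apply] at this ⊢
      simp only [κ₀, LinearMap.comp_apply, TensorProduct.mk_apply, LinearMap.rTensor_tmul,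
        AlgHom.toLinearMap_apply, map_one, this, F.ζ_ι])
  let ζE : A ⊗[𝕜] Q₀ →ₗ[A] Z := linLift ζ₀
  have hζE : ∀ x, ζE (χ x) = ζ (π x) := by
    intro x
    obtain ⟨y, rfl⟩ := hΦ.2 x
    rw [hχΦ]
    induction y with
    | zero => simp
    | add x y hx hy => simp only [map_add, hx, hy]
    | tmul a w =>
      simp only [LinearMap.lTensor_tmul, ζE, linLift_tmul, Φ, act_tmul]
      rw [π.map_smul, F.ζ_smul]
      rfl
  have hζE_surj : Function.Surjective ζE := by
    intro z
    obtain ⟨x, rfl⟩ := F.ζ_surj z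
    obtain ⟨y, rfl⟩ := Q.surj x
    exact ⟨χ y, hζE y⟩
  obtain ⟨s, hs⟩ := Module.projective_lifting_property ζE LinearMap.id hζE_surj
  have hs' : ∀ z, ζE (s z) = z := fun z => LinearMap.congr_fun hs z
  let e : A ⊗[𝕜] Q₀ →ₗ[A] LinearMap.ker ζE :=
    (LinearMap.id - s ∘ₗ ζE).codRestrict (LinearMap.ker ζE) (fun x => by
      rw [LinearMap.mem_ker, LinearMap.sub_apply, map_sub, LinearMap.comp_apply, hs',
        LinearMap.id_apply, sub_self])
  have he : ∀ x, ζE x = 0 → (e x : A ⊗[𝕜] Q₀) = x := by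
    intro x hx
    simp [e, hx]
  choose j hj using fun n => Q.exact (J (ιN n)) (by rw [hπJ, PN.π_ι, map_zero])
  let ι' : N' →ₗ[𝕜] K :=
    { toFun := j
      map_add' := fun x y => Q.inj (by simp only [map_add, hj])
      map_smul' := fun c x => Q.inj (by
        have h1 := (ιN.restrictScalars 𝕜).map_smul c x
        have h2 := (κ.restrictScalars 𝕜).map_smul c (j x)
        simp only [LinearMap.restrictScalars_apply] at h1 h2
        rw [hj, h1, map_smul, RingHom.id_apply, h2, hj]) }
  have hι' : ∀ n, κ (ι' n) = J (ιN n) := hj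
  let ζ' : K →ₗ[𝕜] LinearMap.ker ζE :=
    { toFun := fun k => ⟨χ (κ k), by rw [LinearMap.mem_ker, hζE, Q.π_ι, map_zero]⟩
      map_add' := fun x y => Subtype.ext (by simp)
      map_smul' := fun c x => Subtype.ext (by
        have h2 := (κ.restrictScalars 𝕜).map_smul c x
        simp only [LinearMap.restrictScalars_apply] at h2
        simp [h2]) }
  have hζ' : ∀ k, (ζ' k : A ⊗[𝕜] Q₀) = χ (κ k) := fun k => rfl
  have hζ'_smul : ∀ a x, ζ' (ιA a • x) = a • ζ' x := by
    intro a x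
    apply Subtype.ext
    rw [Submodule.coe_smul, hζ', hζ', κ.map_smul, hχ_smul]
  have hζ'_surj : Function.Surjective ζ' := by
    rintro ⟨z, hz⟩
    obtain ⟨x, rfl⟩ := hχ_surj z
    rw [LinearMap.mem_ker, hζE] at hz
    obtain ⟨n, hn⟩ := F.exact _ hz
    obtain ⟨y, rfl⟩ := PN.surj n
    obtain ⟨k, hk⟩ := Q.exact (x - J y) (by rw [map_sub, hπJ, hn, sub_self])
    exact ⟨k, Subtype.ext (by rw [hζ', hk, map_sub, hχJ, sub_zero])⟩
  refine ⟨ι', LinearMap.ker ζE, inferInstance, inferInstance, inferInstance, inferInstance,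
    Module.Projective.of_split (LinearMap.ker ζE).subtype e ?_, ζ', ?_, ?_, ?_, hζ'_smul,
    hζ'_surj, ?_, ?_, ?_⟩
  · ext x
    simpa using congrArg Subtype.val (Subtype.ext (he x.1 x.2))
  · intro x y h
    apply PN.inj
    apply hJ_inj
    rw [← hι', ← hι', h]
  · intro a x
    apply Q.inj
    rw [hι', ιN.map_smul, hJ_smul, κ.map_smul, hι']
  · intro i x
    apply Q.inj
    rw [hι', PN.ι_homog, hJ_homog, Q.ι_homog, hι']
  · intro x
    exact Subtype.ext (by rw [hζ', hι', hχJ]; rfl)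
  · intro k hk
    obtain ⟨y, hy⟩ := hχ_ker (κ k) (by rw [← hζ', hk]; rfl)
    obtain ⟨n, rfl⟩ := PN.exact y (F.ι_inj (by rw [← hπJ, hy, Q.π_ι, map_zero]))
    exact ⟨n, Q.inj (by rw [hι', hy])⟩
  · intro k hk
    have key : ∀ y ∈ Submodule.span 𝕜 {y | ∃ (a : A) (z : C ⊗[𝕜] V), gA.ε a = 0 ∧
        y = ιA a • z}, ∃ k' ∈ kerSMul ρ K, ζ' k' = e (χ y) := by
      intro y hy
      induction hy using Submodule.span_induction with
      | mem y hy =>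
        obtain ⟨a, z, ha, rfl⟩ := hy
        obtain ⟨w, hw⟩ := hζ'_surj (e (χ z))
        refine ⟨ιA a • w, smul_mem_kerSMul K (by rw [hρA, ha, zero_smul]) w, ?_⟩
        rw [hζ'_smul, hw, hχ_smul, e.map_smul]
      | zero => exact ⟨0, zero_mem _, by simp⟩
      | add x y _ _ hx hy =>
        obtain ⟨k₁, h₁, e₁⟩ := hx
        obtain ⟨k₂, h₂, e₂⟩ := hy
        exact ⟨k₁ + k₂, add_mem h₁ h₂, by simp only [map_add, e₁, e₂]⟩
      | smul c x _ hx =>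
        obtain ⟨k₁, h₁, e₁⟩ := hx
        refine ⟨c • k₁, Submodule.smul_of_tower_mem _ c h₁, ?_⟩
        rw [map_smul, e₁, map_smul]
        exact ((e.restrictScalars 𝕜).map_smul c _).symm
    obtain ⟨k', hk', h⟩ := key _ (H.mem_span_of_rTensor_eq_zero hρA hρB hk)
    refine ⟨k', hk', ?_⟩
    rw [h]
    exact Subtype.ext (he _ (by rw [hζE, Q.π_ι, map_zero]))

end IsFib

end FiberedStep

end TTP

namespace TTP

section FiberedLinear

variable {𝕜 : Type} [Field 𝕜]
variable {A B C : Type} [Ring A] [Algebra 𝕜 A] [Ring B] [Algebra 𝕜 B] [Ring C] [Algebra 𝕜 C]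
  {gA : GAlg 𝕜 A} {gB : GAlg 𝕜 B} {gC : GAlg 𝕜 C} {ιA : A →ₐ[𝕜] C} {ιB : B →ₐ[𝕜] C}
  {ρ : C →ₐ[𝕜] B}

/-- The largest quotient of a `C`-module annihilated by the kernel of `ρ`, as a `B`-module. -/
def fiber (hρ : ∀ i c, ρ (gC.p i c) = gB.p i (ρ c)) (hιB : ∀ i b, ιB (gB.p i b) = gC.p i (ιB b))
    (K : GMod gC) : GMod gB :=
  (K.quot (kerSMul ρ K) (fun i _ hx => p_mem_kerSMul hρ K hx i)).restrict ιB hιB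

/-- The projection onto `fiber`. -/
def fiberMk (hρ : ∀ i c, ρ (gC.p i c) = gB.p i (ρ c))
    (hιB : ∀ i b, ιB (gB.p i b) = gC.p i (ιB b)) (K : GMod gC) :
    K →ₗ[𝕜] fiber hρ hιB K :=
  ((kerSMul ρ K).restrictScalars 𝕜).mkQ

section

variable {hρ : ∀ i c, ρ (gC.p i c) = gB.p i (ρ c)}
  {hιB : ∀ i b, ιB (gB.p i b) = gC.p i (ιB b)} {K : GMod gC}

lemma fiberMk_surj : Function.Surjective (fiberMk hρ hιB K) :=
  Submodule.Quotient.mk_surjective _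

lemma fiberMk_eq_zero {x : K} : fiberMk hρ hιB K x = 0 ↔ x ∈ kerSMul ρ K :=
  Submodule.Quotient.mk_eq_zero _

lemma fiberMk_homog : Homog (M := K) (N := fiber hρ hιB K) (fiberMk hρ hιB K) :=
  fun _ _ => rfl

lemma smul_fiberMk (b : B) (x : K) : b • fiberMk hρ hιB K x = fiberMk hρ hιB K (ιB b • x) := rfl

lemma fiberMk_smul (hρB : ∀ b, ρ (ιB b) = b) (c : C) (x : K) :
    fiberMk hρ hιB K (c • x) = ρ c • fiberMk hρ hιB K x := by
  rw [smul_fiberMk, ← sub_eq_zero, ← map_sub, fiberMk_eq_zero, ← sub_smul]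
  exact smul_mem_kerSMul K (by rw [map_sub, hρB, sub_self]) x

end

namespace IsFib

variable {M : GMod gC} {Y : GMod gB} {N : GMod gA}
  {Z : Type} [AddCommGroup Z] [Module 𝕜 Z] [Module A Z] {q : M →ₗ[𝕜] Y} {ι : N →ₗ[𝕜] M}
  {ζ : M →ₗ[𝕜] Z}

/-- The fiber of the syzygy of a fibered module maps onto the syzygy of the quotient. -/
lemma exists_fiber_hom (hρ : ∀ i c, ρ (gC.p i c) = gB.p i (ρ c))
    (hιB : ∀ i b, ιB (gB.p i b) = gC.p i (ιB b)) (hρB : ∀ b, ρ (ιB b) = b)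
    (F : IsFib ιA ρ q ι ζ) {V : Type} [AddCommGroup V] [Module 𝕜 V] {K : GMod gC}
    {κ : K →ₗ[C] C ⊗[𝕜] V} {π : C ⊗[𝕜] V →ₗ[C] M} (Q : IsPres κ π) {S : GMod gB}
    {ιY : S →ₗ[B] B ⊗[𝕜] V} {πY : B ⊗[𝕜] V →ₗ[B] Y} (P : IsPres ιY πY)
    (hqπ : ∀ x, q (π x) = πY (ρ.toLinearMap.rTensor V x)) :
    ∃ φ : fiber hρ hιB K →ₗ[B] S, Function.Surjective φ ∧
      Homog (M := fiber hρ hιB K) (N := S) φ ∧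
      ∀ k, ιY (φ (fiberMk hρ hιB K k)) = ρ.toLinearMap.rTensor V (κ k) := by
  choose f hf using fun k => P.exact (ρ.toLinearMap.rTensor V (κ k)) (by
    rw [← hqπ, Q.π_ι, map_zero])
  have hf_ker : ∀ k ∈ kerSMul ρ K, f k = 0 := by
    intro k hk
    apply P.inj
    rw [hf, map_zero]
    induction hk using Submodule.span_induction with
    | mem x hx =>
      obtain ⟨c, y, hc, rfl⟩ := hx
      rw [κ.map_smul, rTensor_smul, hc, zero_smul]
    | zero => simp
    | add x y _ _ hx hy => simp only [map_add, hx, hy, add_zero]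
    | smul c x _ hx => rw [κ.map_smul, rTensor_smul, hx, smul_zero]
  let f' : K →+ S :=
    { toFun := f
      map_zero' := hf_ker 0 (zero_mem _)
      map_add' := fun x y => P.inj (by simp only [map_add, hf]) }
  have hf' : ∀ k, ιY (f' k) = ρ.toLinearMap.rTensor V (κ k) := hf
  let φ₀ : fiber hρ hιB K →+ S :=
    QuotientAddGroup.lift (kerSMul ρ K).toAddSubgroup f' hf_ker
  have hφ₀ : ∀ k, φ₀ (fiberMk hρ hιB K k) = f' k := fun k => rfl
  refine ⟨{ φ₀ with map_smul' := ?_ }, ?_, ?_, hf⟩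
  · intro b x
    obtain ⟨k, rfl⟩ := fiberMk_surj x
    apply P.inj
    rw [RingHom.id_apply]
    change ιY (φ₀ _) = ιY (b • φ₀ _)
    rw [smul_fiberMk, hφ₀, hφ₀, ιY.map_smul, hf', hf', κ.map_smul, rTensor_smul, hρB]
  · intro s
    have hρs : Function.Surjective (ρ.toLinearMap.rTensor V) :=
      LinearMap.rTensor_surjective V (g := ρ.toLinearMap) (fun b => ⟨ιB b, hρB b⟩)
    obtain ⟨x, hx⟩ := hρs (ιY s)
    have hlift : ∀ w ∈ kerSMul ρ M, ∃ x', ρ.toLinearMap.rTensor V x' = 0 ∧ π x' = w := by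
      intro w hw
      induction hw using Submodule.span_induction with
      | mem w hw =>
        obtain ⟨c, y, hc, rfl⟩ := hw
        obtain ⟨z, rfl⟩ := Q.surj y
        exact ⟨c • z, by rw [rTensor_smul, hc, zero_smul], π.map_smul c z⟩
      | zero => exact ⟨0, map_zero _, map_zero _⟩
      | add x y _ _ hx hy =>
        obtain ⟨x', h1, h2⟩ := hx
        obtain ⟨y', h3, h4⟩ := hy
        exact ⟨x' + y', by rw [map_add, h1, h3, add_zero], by rw [map_add, h2, h4]⟩
      | smul c x _ hx =>
        obtain ⟨x', h1, h2⟩ := hx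
        exact ⟨c • x', by rw [rTensor_smul, h1, smul_zero], by rw [π.map_smul, h2]⟩
    obtain ⟨x', h1, h2⟩ := hlift (π x) (F.q_ker _ (by rw [hqπ, hx, P.π_ι]))
    obtain ⟨k, hk⟩ := Q.exact (x - x') (by rw [map_sub, h2, sub_self])
    refine ⟨fiberMk hρ hιB K k, P.inj ?_⟩
    change ιY (f' k) = _
    rw [hf', hk, map_sub, h1, hx, sub_zero]
  · intro i x
    obtain ⟨k, rfl⟩ := fiberMk_surj x
    apply P.inj
    change ιY (f' (K.p i k)) = ιY (S.p i (f' k))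
    rw [hf', Q.ι_homog, P.ι_homog, hf']
    exact rTensor_homog ρ hρ V _ _

/-- Fibered modules are linear if their constituents are. -/
lemma lin (H : IsProd gA gB gC ιA ιB) (hρ : ∀ i c, ρ (gC.p i c) = gB.p i (ρ c))
    (hρA : ∀ a, ρ (ιA a) = gA.ε a • 1) (hρB : ∀ b, ρ (ιB b) = b)
    (hB : ∀ (m : ℕ) (L : GMod gB), (∀ x, L.p 0 x = x) → Lin m L) (m : ℕ)
    {M : GMod gC} {Y : GMod gB} {N : GMod gA}
    {Z : Type} [AddCommGroup Z] [Module 𝕜 Z] [Module A Z] [IsScalarTower 𝕜 A Z]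
    [Module.Projective A Z] {q : M →ₗ[𝕜] Y} {ι : N →ₗ[𝕜] M} {ζ : M →ₗ[𝕜] Z}
    (F : IsFib ιA ρ q ι ζ) (hY : Lin m Y) (hN : Lin m N) : Lin m M := by
  induction m generalizing M Y N Z with
  | zero => trivial
  | succ m ih =>
    obtain ⟨V, _, _, S, ιY, πY, P, hS⟩ := hY
    obtain ⟨U, _, _, N', ιN, πN, PN, hN'⟩ := hN
    obtain ⟨K, κ, π, Q, hqπ⟩ := F.exists_cover hρ (fun b => ⟨ιB b, hρB b⟩) P
    refine ⟨V, _, _, K, κ, π, Q, ?_⟩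
    cases m with
    | zero => trivial
    | succ m =>
      obtain ⟨ι', Z', _, _, _, _, _, ζ', h1, h2, h3, h4, h5, h6, h7, h8⟩ :=
        F.exists_syzygy H hρA hρB Q PN
      obtain ⟨φ, hφs, hφh, hφ⟩ := F.exists_fiber_hom hρ H.ιB_p hρB Q P hqπ
      refine ih (q := fiberMk hρ H.ιB_p K) (ι := ι') (ζ := ζ')
        ⟨fiberMk_smul hρB, fiberMk_homog, fiberMk_surj, fun x => fiberMk_eq_zero.1, h1, h2, h3,
          h4, h5, h6, h7⟩ ?_ hN'
      obtain ⟨U', _, _, N'', ιN', πN', PN', -⟩ := hN'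
      have hgen : ∀ n, ι' n - K.p 0 (ι' n) ∈ kerSMul ρ K := by
        intro n
        obtain ⟨y, rfl⟩ := PN'.surj n
        induction y with
        | zero => simp
        | add x y hx hy =>
          simp only [map_add]
          rw [add_sub_add_comm]
          exact add_mem hx hy
        | tmul a u =>
          have hu : a ⊗ₜ[𝕜] u = a • ((1 : A) ⊗ₜ[𝕜] u) := by simp [TensorProduct.smul_tmul']
          rw [hu, πN'.map_smul, h2]
          have h0 : K.p 0 (ι' (πN' (1 ⊗ₜ u))) = ι' (πN' (1 ⊗ₜ u)) := by
            rw [← h3, PN'.p_zero_π]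
          rw [K.p_smul, Finset.Nat.antidiagonal_zero, Finset.sum_singleton, h0, ← H.ιA_p, gA.p_zero,
            map_smul, map_one, ← sub_smul]
          exact smul_mem_kerSMul K (by simp [hρA]) _
      have hstab : ∀ i, ∀ x ∈ LinearMap.ker φ, (fiber hρ H.ιB_p K).p i x ∈ LinearMap.ker φ := by
        intro i x hx
        rw [LinearMap.mem_ker] at hx ⊢
        rw [hφh, hx, map_zero]
      refine Lin.extension (M' := (fiber hρ H.ιB_p K).sub (LinearMap.ker φ) hstab)
        (f := (LinearMap.ker φ).subtype) (q := φ)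
        ⟨Subtype.val_injective, hφs, fun x => x.2, fun y hy => ⟨⟨y, hy⟩, rfl⟩, fun _ _ => rfl,
          hφh⟩ (hB _ _ ?_) hS
      rintro ⟨x, hx⟩
      apply Subtype.ext
      obtain ⟨k, rfl⟩ := fiberMk_surj x
      change fiberMk hρ H.ιB_p K (K.p 0 k) = fiberMk hρ H.ιB_p K k
      symm
      rw [← sub_eq_zero, ← map_sub, fiberMk_eq_zero]
      obtain ⟨k', hk', hk''⟩ := h8 k (by rw [← hφ, LinearMap.mem_ker.1 hx, map_zero])
      obtain ⟨n, hn⟩ := h7 (k - k') (by rw [map_sub, hk'', sub_self])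
      have hk : k = ι' n + k' := by rw [hn, sub_add_cancel]
      rw [hk, map_add, add_sub_add_comm]
      exact add_mem (hgen n) (sub_mem hk' (p_mem_kerSMul hρ K hk' 0))

end IsFib

end FiberedLinear

end TTP

namespace TTP

section ProductKoszul

variable {𝕜 : Type} [Field 𝕜]
variable {A B C : Type} [Ring A] [Algebra 𝕜 A] [Ring B] [Algebra 𝕜 B] [Ring C] [Algebra 𝕜 C]
  {gA : GAlg 𝕜 A} {gB : GAlg 𝕜 B} {gC : GAlg 𝕜 C} {ιA : A →ₐ[𝕜] C} {ιB : B →ₐ[𝕜] C}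
  {𝒜 : ℕ → Submodule 𝕜 A} {ℬ : ℕ → Submodule 𝕜 B} {𝒞 : ℕ → Submodule 𝕜 C}

namespace IsProd

/-- If `B` is a graded quotient of the product `C`, then `C` is Koszul when `A` and `B` are. -/
lemma isKoszul_of_right (H : IsProd gA gB gC ιA ιB) (hA : ∀ n a, a ∈ 𝒜 n ↔ gA.p n a = a)
    (hB : ∀ n b, b ∈ ℬ n ↔ gB.p n b = b) (hC : ∀ n c, c ∈ 𝒞 n ↔ gC.p n c = c)
    (ρ : C →ₐ[𝕜] B) (hρ : ∀ i c, ρ (gC.p i c) = gB.p i (ρ c))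
    (hρA : ∀ a, ρ (ιA a) = gA.ε a • 1) (hρB : ∀ b, ρ (ιB b) = b)
    (hKA : IsKoszul 𝕜 A 𝒜) (hKB : IsKoszul 𝕜 B ℬ) : IsKoszul 𝕜 C 𝒞 := by
  refine isKoszul_of_lin hC fun m => ?_
  let T := augQuot gC 𝒞 hC
  let q : T →ₗ[𝕜] T.restrict ιB H.ιB_p := (LinearMap.id : T →ₗ[𝕜] T)
  let ι : T.restrict ιA H.ιA_p →ₗ[𝕜] T := (LinearMap.id : T →ₗ[𝕜] T)
  have hT : ∀ x, T.p 0 x = x := augQuot_p_zero hC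
  have F : IsFib (Z := PUnit) ιA ρ q ι 0 :=
    { q_smul := fun c x => by
        change c • x = ιB (ρ c) • x
        rw [T.smul_eq_of_p_zero hT, T.smul_eq_of_p_zero hT, GAlg.ε_map ιB H.ιB_p,
          GAlg.ε_map ρ hρ]
      q_homog := fun _ _ => rfl
      q_surj := fun x => ⟨x, rfl⟩
      q_ker := fun x hx => by
        have : x = 0 := hx
        rw [this]
        exact zero_mem _
      ι_inj := fun _ _ h => h
      ι_smul := fun _ _ => rfl
      ι_homog := fun _ _ => rfl
      ζ_smul := fun _ _ => rfl
      ζ_surj := fun x => ⟨0, rfl⟩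
      ζ_ι := fun _ => rfl
      exact := fun x _ => ⟨x, rfl⟩ }
  exact F.lin H hρ hρA hρB (fun m L hL => Lin.of_p_zero hB (hKB.lin hB m) hL) m
    (Lin.of_p_zero hB (hKB.lin hB m) hT) (Lin.of_p_zero hA (hKA.lin hA m) hT)

/-- If `A` is a graded quotient of the product `C`, then `C` is Koszul when `A` and `B` are. -/
lemma isKoszul_of_left (H : IsProd gA gB gC ιA ιB) (hA : ∀ n a, a ∈ 𝒜 n ↔ gA.p n a = a)
    (hB : ∀ n b, b ∈ ℬ n ↔ gB.p n b = b) (hC : ∀ n c, c ∈ 𝒞 n ↔ gC.p n c = c)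
    (ρ : C →ₐ[𝕜] A) (hρ : ∀ i c, ρ (gC.p i c) = gA.p i (ρ c))
    (hρA : ∀ a, ρ (ιA a) = a) (hρB : ∀ b, ρ (ιB b) = gB.ε b • 1)
    (hKA : IsKoszul 𝕜 A 𝒜) (hKB : IsKoszul 𝕜 B ℬ) : IsKoszul 𝕜 C 𝒞 := by
  refine isKoszul_of_lin hC fun m => ?_
  let T := augQuot gC 𝒞 hC
  have hT : ∀ x, T.p 0 x = x := augQuot_p_zero hC
  have hN : Lin m (T.restrict ιA H.ιA_p) := Lin.of_p_zero hA (hKA.lin hA m) hT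
  have hR := H.lin_restrict ρ hρ hρA hρB
    (fun m U _ _ => Lin.of_p_zero hB (hKB.lin hB m) (fun _ => rfl)) hN
  let e : (T.restrict ιA H.ιA_p).restrict ρ hρ ≃ₗ[C] T :=
    { toFun := fun x => x
      invFun := fun x => x
      left_inv := fun _ => rfl
      right_inv := fun _ => rfl
      map_add' := fun _ _ => rfl
      map_smul' := fun c (x : T) => by
        change ιA (ρ c) • x = c • x
        rw [T.smul_eq_of_p_zero hT, T.smul_eq_of_p_zero hT, GAlg.ε_map ιA H.ιA_p,
          GAlg.ε_map ρ hρ] }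
  exact hR.iso e (fun _ _ => rfl)

end IsProd

end ProductKoszul

end TTP

namespace TTP

section Twisted

variable {𝕜 : Type} [Field 𝕜]

/-- The elements which are the sum of their components. -/
def summable {M : Type} [AddCommGroup M] [Module 𝕜 M] (p : ℕ → M →ₗ[𝕜] M) : AddSubmonoid M where
  carrier := {x | ∃ N, ∀ n, N ≤ n → ∑ i ∈ Finset.range n, p i x = x}
  zero_mem' := ⟨0, by simp⟩
  add_mem' := by
    rintro x y ⟨N, hN⟩ ⟨N', hN'⟩
    refine ⟨max N N', fun n hn => ?_⟩
    simp only [map_add, Finset.sum_add_distrib]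
    rw [hN n (le_trans (le_max_left _ _) hn), hN' n (le_trans (le_max_right _ _) hn)]

lemma mem_summable {M : Type} [AddCommGroup M] [Module 𝕜 M] {p : ℕ → M →ₗ[𝕜] M} {x : M} (k : ℕ)
    (h : ∀ i, p i x = if i = k then x else 0) : x ∈ summable p :=
  ⟨k + 1, fun n hn => by
    simp only [h]
    rw [Finset.sum_ite_eq' (Finset.range n) k, if_pos (Finset.mem_range.2 (by omega))]⟩

variable {A B C : Type} [Ring A] [Algebra 𝕜 A] [Ring B] [Algebra 𝕜 B] [Ring C] [Algebra 𝕜 C]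

lemma GAlg.p_mem (g : GAlg 𝕜 A) (i : ℕ) (x : A) : g.p i (g.p i x) = g.p i x := by
  rw [g.p_p, if_pos rfl]

/-- A graded algebra from projections onto components closed under multiplication. -/
def GAlg.ofMul (p : ℕ → A →ₗ[𝕜] A) (p_p : ∀ i j x, p i (p j x) = if i = j then p j x else 0)
    (hs : ∀ x, x ∈ summable p)
    (hm : ∀ i j x y, p i x = x → p j y = y → p (i + j) (x * y) = x * y)
    (ε : A →ₗ[𝕜] 𝕜) (p_zero : ∀ x, p 0 x = ε x • (1 : A)) (ε_one : ε 1 = 1) : GAlg 𝕜 A where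
  p := p
  p_p := p_p
  exists_sum x := by
    obtain ⟨N, hN⟩ := hs x
    exact ⟨N, hN N le_rfl⟩
  p_mul l x y := by
    obtain ⟨N, hN⟩ := hs x
    obtain ⟨N', hN'⟩ := hs y
    obtain ⟨n, h1, h2, h3⟩ : ∃ n, N ≤ n ∧ N' ≤ n ∧ l < n :=
      ⟨N + N' + l + 1, by omega, by omega, by omega⟩
    have key : ∀ i j, p l (p i x * p j y) = if i + j = l then p i x * p j y else 0 := by
      intro i j
      rw [← hm i j (p i x) (p j y) (by simp [p_p]) (by simp [p_p]), p_p]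
      by_cases h : l = i + j
      · simp [h]
      · rw [if_neg h, if_neg (Ne.symm h)]
    conv_lhs => rw [← hN n h1, ← hN' n h2, Finset.sum_mul_sum, ← Finset.sum_product', map_sum]
    simp only [key]
    rw [← Finset.sum_filter]
    refine Finset.sum_congr ?_ fun _ _ => rfl
    ext ⟨i, j⟩
    simp only [Finset.mem_filter, Finset.mem_product, Finset.mem_range,
      Finset.HasAntidiagonal.mem_antidiagonal]
    omega
  ε := ε
  p_zero := p_zero
  ε_one := ε_one

lemma exists_gAlg [Nontrivial A] (𝒜 : ℕ → Submodule 𝕜 A) [GradedAlgebra 𝒜]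
    (hconn : 𝒜 0 = (1 : Submodule 𝕜 A)) :
    ∃ g : GAlg 𝕜 A, ∀ n a, a ∈ 𝒜 n ↔ g.p n a = a := by
  let p : ℕ → A →ₗ[𝕜] A := GradedAlgebra.proj 𝒜
  have hp_mem : ∀ i x, p i x ∈ 𝒜 i := fun i x => by
    simp only [p, GradedAlgebra.proj_apply]
    exact SetLike.coe_mem _
  have hp_of : ∀ {i x}, x ∈ 𝒜 i → ∀ j, p j x = if j = i then x else 0 := by
    intro i x hx j
    simp only [p, GradedAlgebra.proj_apply]
    split_ifs with h
    · subst h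
      exact DirectSum.decompose_of_mem_same 𝒜 hx
    · exact DirectSum.decompose_of_mem_ne 𝒜 hx (Ne.symm h)
  have hmem : ∀ n a, a ∈ 𝒜 n ↔ p n a = a := fun n a =>
    ⟨fun h => by rw [hp_of h, if_pos rfl], fun h => h ▸ hp_mem n a⟩
  have hinj : LinearMap.ker (Algebra.linearMap 𝕜 A) = ⊥ :=
    LinearMap.ker_eq_bot.2 (FaithfulSMul.algebraMap_injective 𝕜 A)
  obtain ⟨r, hr⟩ := (Algebra.linearMap 𝕜 A).exists_leftInverse_of_injective hinj
  have hr' : ∀ c, r (algebraMap 𝕜 A c) = c := fun c => LinearMap.congr_fun hr c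
  refine ⟨GAlg.ofMul p (fun i j x => hp_of (hp_mem j x) i) ?_ ?_ (r ∘ₗ p 0) ?_ ?_, hmem⟩
  · intro x
    induction x using DirectSum.Decomposition.inductionOn 𝒜 with
    | zero => exact zero_mem _
    | homogeneous x => exact mem_summable _ (hp_of x.2)
    | add x y hx hy => exact add_mem hx hy
  · intro i j x y hx hy
    rw [← hmem] at hx hy ⊢
    exact SetLike.mul_mem_graded hx hy
  · intro x
    have h0 := hp_mem 0 x
    rw [hconn, Submodule.one_eq_range] at h0
    obtain ⟨c, hc⟩ := h0
    rw [LinearMap.comp_apply, ← hc, Algebra.linearMap_apply, hr', Algebra.algebraMap_eq_smul_one]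
  · have : p 0 1 = 1 := (hmem 0 1).1 (SetLike.one_mem_graded 𝒜)
    rw [LinearMap.comp_apply, this, ← map_one (algebraMap 𝕜 A), hr']

variable (gA : GAlg 𝕜 A) (gB : GAlg 𝕜 B)

/-- The projections of the Künneth grading. -/
def tensorProj (l : ℕ) : A ⊗[𝕜] B →ₗ[𝕜] A ⊗[𝕜] B :=
  ∑ ij ∈ Finset.HasAntidiagonal.antidiagonal l, TensorProduct.map (gA.p ij.1) (gB.p ij.2)

lemma tensorProj_tmul (l : ℕ) (a : A) (b : B) : tensorProj gA gB l (a ⊗ₜ b) =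
    ∑ ij ∈ Finset.HasAntidiagonal.antidiagonal l, gA.p ij.1 a ⊗ₜ[𝕜] gB.p ij.2 b := by
  simp [tensorProj, LinearMap.sum_apply]

lemma tensorProj_homog {i j : ℕ} {a : A} {b : B} (ha : gA.p i a = a) (hb : gB.p j b = b) (l : ℕ) :
    tensorProj gA gB l (a ⊗ₜ b) = if l = i + j then a ⊗ₜ b else 0 := by
  have h1 : ∀ i', gA.p i' a = if i' = i then a else 0 := fun i' => by
    conv_lhs => rw [← ha, gA.p_p]
    rw [ha]
  have h2 : ∀ j', gB.p j' b = if j' = j then b else 0 := fun j' => by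
    conv_lhs => rw [← hb, gB.p_p]
    rw [hb]
  rw [tensorProj_tmul]
  simp only [h1, h2]
  split_ifs with h
  · rw [Finset.sum_eq_single (i, j)]
    · simp
    · rintro ⟨i', j'⟩ - hne
      by_cases hi : i' = i
      · have : j' ≠ j := fun hj => hne (by rw [hi, hj])
        simp [this]
      · simp [hi]
    · intro hn
      exact absurd (Finset.HasAntidiagonal.mem_antidiagonal.2 h.symm) hn
  · refine Finset.sum_eq_zero fun ij hij => ?_
    have := Finset.HasAntidiagonal.mem_antidiagonal.1 hij
    by_cases h1 : ij.1 = i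
    · have h2 : ij.2 ≠ j := by
        intro h2
        exact h (by omega)
      simp [h2]
    · simp [h1]

/-- An element of the tensor product is a sum of homogeneous pure tensors. -/
lemma tensor_induction {motive : A ⊗[𝕜] B → Prop} (zero : motive 0)
    (hadd : ∀ x y, motive x → motive y → motive (x + y))
    (homog : ∀ i j a b, gA.p i a = a → gB.p j b = b → motive (a ⊗ₜ b)) (x : A ⊗[𝕜] B) :
    motive x := by
  let S : AddSubmonoid (A ⊗[𝕜] B) := ⟨⟨{x | motive x}, fun {x y} => hadd x y⟩, zero⟩
  induction x with
  | zero => exact zero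
  | add x y hx hy => exact hadd x y hx hy
  | tmul a b =>
    change a ⊗ₜ b ∈ S
    obtain ⟨N, hN⟩ := gA.exists_sum a
    obtain ⟨N', hN'⟩ := gB.exists_sum b
    rw [← hN, ← hN', TensorProduct.sum_tmul]
    refine sum_mem fun i _ => ?_
    rw [TensorProduct.tmul_sum]
    exact sum_mem fun j _ => homog i j _ _ (gA.p_mem _ _) (gB.p_mem _ _)

lemma tensorProj_tensorProj (i j : ℕ) (x : A ⊗[𝕜] B) : tensorProj gA gB i (tensorProj gA gB j x) =
    if i = j then tensorProj gA gB j x else 0 := by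
  refine tensor_induction gA gB (motive := fun x => tensorProj gA gB i (tensorProj gA gB j x) =
    if i = j then tensorProj gA gB j x else 0) ?_ ?_ ?_ x
  · simp
  · intro x y hx hy
    simp only [map_add, hx, hy]
    split_ifs <;> simp
  · intro k l a b ha hb
    simp only [tensorProj_homog gA gB ha hb]
    split_ifs with h1 h2 h3
    · simp [tensorProj_homog gA gB ha hb, h1, h2]
    · rw [tensorProj_homog gA gB ha hb, if_neg (by omega)]
    · simp
    · simp

lemma tensorProj_summable (x : A ⊗[𝕜] B) : x ∈ summable (tensorProj gA gB) :=
  tensor_induction gA gB (zero_mem _) (fun _ _ hx hy => add_mem hx hy)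
    (fun _ _ _ _ ha hb => mem_summable _ (tensorProj_homog gA gB ha hb)) x

variable {gA gB} {𝒜 : ℕ → Submodule 𝕜 A} {ℬ : ℕ → Submodule 𝕜 B}

lemma tmul_mem_kunneth {i j n : ℕ} {a : A} {b : B} (ha : a ∈ 𝒜 i) (hb : b ∈ ℬ j) (hn : i + j = n) :
    a ⊗ₜ[𝕜] b ∈ kunneth 𝕜 𝒜 ℬ n :=
  Submodule.mem_iSup_of_mem (i, j) (Submodule.mem_iSup_of_mem hn
    ⟨(⟨a, ha⟩ : 𝒜 i) ⊗ₜ (⟨b, hb⟩ : ℬ j), by simp⟩)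

lemma tensorProj_mem_kunneth (hA : ∀ n a, a ∈ 𝒜 n ↔ gA.p n a = a)
    (hB : ∀ n b, b ∈ ℬ n ↔ gB.p n b = b) (n : ℕ) (x : A ⊗[𝕜] B) :
    tensorProj gA gB n x ∈ kunneth 𝕜 𝒜 ℬ n := by
  induction x with
  | zero => simp
  | add x y hx hy => rw [map_add]; exact add_mem hx hy
  | tmul a b =>
    rw [tensorProj_tmul]
    exact sum_mem fun ij hij => tmul_mem_kunneth ((hA _ _).2 (gA.p_mem _ _))
      ((hB _ _).2 (gB.p_mem _ _)) (Finset.HasAntidiagonal.mem_antidiagonal.1 hij)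

/-- To prove a linear condition on a Künneth component, check it on homogeneous tensors. -/
lemma kunneth_le {n : ℕ} {S : Submodule 𝕜 (A ⊗[𝕜] B)}
    (h : ∀ i j a b, i + j = n → a ∈ 𝒜 i → b ∈ ℬ j → a ⊗ₜ b ∈ S) : kunneth 𝕜 𝒜 ℬ n ≤ S := by
  refine iSup₂_le fun ij hij => ?_
  rintro _ ⟨y, rfl⟩
  induction y with
  | zero => simp
  | add x y hx hy => rw [map_add]; exact add_mem hx hy
  | tmul a b => exact h _ _ _ _ hij a.2 b.2

lemma mem_kunneth_iff (hA : ∀ n a, a ∈ 𝒜 n ↔ gA.p n a = a) (hB : ∀ n b, b ∈ ℬ n ↔ gB.p n b = b)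
    (n : ℕ) (x : A ⊗[𝕜] B) : x ∈ kunneth 𝕜 𝒜 ℬ n ↔ tensorProj gA gB n x = x := by
  constructor
  · have : kunneth 𝕜 𝒜 ℬ n ≤ LinearMap.ker (tensorProj gA gB n - LinearMap.id) := by
      refine kunneth_le fun i j a b hij ha hb => ?_
      rw [LinearMap.mem_ker, LinearMap.sub_apply, sub_eq_zero,
        tensorProj_homog gA gB ((hA _ _).1 ha) ((hB _ _).1 hb), if_pos hij.symm]
      rfl
    intro hx
    simpa [sub_eq_zero] using this hx
  · intro hx
    rw [← hx]
    exact tensorProj_mem_kunneth hA hB n x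

lemma subTmul_le {M N : Type} [AddCommGroup M] [Module 𝕜 M] [AddCommGroup N] [Module 𝕜 N]
    {p : Submodule 𝕜 M} {q : Submodule 𝕜 N} {S : Submodule 𝕜 (M ⊗[𝕜] N)}
    (h : ∀ a ∈ p, ∀ b ∈ q, a ⊗ₜ b ∈ S) : subTmul 𝕜 p q ≤ S := by
  rintro _ ⟨y, rfl⟩
  induction y with
  | zero => simp
  | add x y hx hy => rw [map_add]; exact add_mem hx hy
  | tmul a b => exact h _ a.2 _ b.2

lemma tmul_mem_subTmul {M N : Type} [AddCommGroup M] [Module 𝕜 M] [AddCommGroup N] [Module 𝕜 N]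
    {p : Submodule 𝕜 M} {q : Submodule 𝕜 N} {a : M} {b : N} (ha : a ∈ p) (hb : b ∈ q) :
    a ⊗ₜ b ∈ subTmul 𝕜 p q :=
  ⟨(⟨a, ha⟩ : p) ⊗ₜ (⟨b, hb⟩ : q), by simp⟩

lemma mulTau_tmul (τ : B ⊗[𝕜] A →ₗ[𝕜] A ⊗[𝕜] B) (a a' : A) (b b' : B) :
    mulTau 𝕜 A B τ ((a ⊗ₜ b) ⊗ₜ (a' ⊗ₜ b')) =
      TensorProduct.map (LinearMap.mulLeft 𝕜 a) (LinearMap.mulRight 𝕜 b') (τ (b ⊗ₜ a')) := by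
  simp only [mulTau, LinearMap.comp_apply, LinearEquiv.coe_coe, TensorProduct.assoc_tmul,
    LinearMap.lTensor_tmul, TensorProduct.assoc_symm_tmul, LinearMap.rTensor_tmul]
  generalize τ (b ⊗ₜ a') = t
  induction t with
  | zero => simp
  | add x y hx hy => simp only [TensorProduct.add_tmul, TensorProduct.tmul_add, map_add, hx, hy]
  | tmul x y => simp

end Twisted

end TTP

namespace TTP

section Realization

variable {𝕜 : Type} [Field 𝕜]
variable {A B C : Type} [Ring A] [Algebra 𝕜 A] [Ring B] [Algebra 𝕜 B] [Ring C] [Algebra 𝕜 C]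
variable {τ : B ⊗[𝕜] A →ₗ[𝕜] A ⊗[𝕜] B} {ψ : A ⊗[𝕜] B →ₗ[𝕜] C}

/-- The inclusion of the left factor into a twisted tensor product. -/
def Realizes.left (h : Realizes 𝕜 A B τ C ψ) (hτ : IsTwisting 𝕜 A B τ) : A →ₐ[𝕜] C :=
  AlgHom.ofLinearMap (ψ ∘ₗ (TensorProduct.mk 𝕜 A B).flip 1) h.2.1 fun a a' => by
    simp [← h.2.2, mulTau_tmul, hτ.1]

/-- The inclusion of the right factor into a twisted tensor product. -/
def Realizes.right (h : Realizes 𝕜 A B τ C ψ) (hτ : IsTwisting 𝕜 A B τ) : B →ₐ[𝕜] C :=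
  AlgHom.ofLinearMap (ψ ∘ₗ TensorProduct.mk 𝕜 A B 1) h.2.1 fun b b' => by
    simp [← h.2.2, mulTau_tmul, hτ.2.1]

variable (h : Realizes 𝕜 A B τ C ψ) (hτ : IsTwisting 𝕜 A B τ)

lemma Realizes.left_apply (a : A) : h.left hτ a = ψ (a ⊗ₜ 1) := rfl

lemma Realizes.right_apply (b : B) : h.right hτ b = ψ (1 ⊗ₜ b) := rfl

lemma Realizes.left_mul_right (a : A) (b : B) : h.left hτ a * h.right hτ b = ψ (a ⊗ₜ b) := by
  simp [left_apply, right_apply, ← h.2.2, mulTau_tmul, hτ.1]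

lemma Realizes.right_mul_left (a : A) (b : B) :
    h.right hτ b * h.left hτ a = ψ (τ (b ⊗ₜ a)) := by
  rw [left_apply, right_apply, ← h.2.2, mulTau_tmul]
  congr 1
  have : TensorProduct.map (LinearMap.mulLeft 𝕜 (1 : A)) (LinearMap.mulRight 𝕜 (1 : B)) =
      LinearMap.id := by
    ext
    simp
  rw [this]
  rfl

lemma Realizes.act_eq : act (h.left hτ) (h.right hτ).toLinearMap = ψ := by
  ext a b
  simpa using h.left_mul_right hτ a b

variable {gA : GAlg 𝕜 A} {gB : GAlg 𝕜 B} {𝒜 : ℕ → Submodule 𝕜 A} {ℬ : ℕ → Submodule 𝕜 B}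

lemma mulTau_mem_kunneth [GradedAlgebra 𝒜] [GradedAlgebra ℬ] (hg : IsGradedMapBA 𝕜 A B 𝒜 ℬ τ)
    {m n : ℕ} {x y : A ⊗[𝕜] B} (hx : x ∈ kunneth 𝕜 𝒜 ℬ m) (hy : y ∈ kunneth 𝕜 𝒜 ℬ n) :
    mulTau 𝕜 A B τ (x ⊗ₜ y) ∈ kunneth 𝕜 𝒜 ℬ (m + n) := by
  have key : ∀ i j a b, i + j = m → a ∈ 𝒜 i → b ∈ ℬ j → ∀ i' j' a' b', i' + j' = n → a' ∈ 𝒜 i' →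
      b' ∈ ℬ j' → mulTau 𝕜 A B τ ((a ⊗ₜ b) ⊗ₜ (a' ⊗ₜ b')) ∈ kunneth 𝕜 𝒜 ℬ (m + n) := by
    intro i j a b hij ha hb i' j' a' b' hij' ha' hb'
    rw [mulTau_tmul]
    have h1 : τ (b ⊗ₜ a') ∈ kunneth 𝕜 𝒜 ℬ (j + i') :=
      hg _ (Submodule.mem_map_of_mem (tmul_mem_kunneth hb ha' rfl))
    have h2 : kunneth 𝕜 𝒜 ℬ (j + i') ≤ (kunneth 𝕜 𝒜 ℬ (m + n)).comap
        (TensorProduct.map (LinearMap.mulLeft 𝕜 a) (LinearMap.mulRight 𝕜 b')) :=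
      kunneth_le fun k l c d hkl hc hd =>
        tmul_mem_kunneth (SetLike.mul_mem_graded ha hc) (SetLike.mul_mem_graded hd hb') (by omega)
    exact h2 h1
  have h1 : ∀ i j a b, i + j = m → a ∈ 𝒜 i → b ∈ ℬ j →
      mulTau 𝕜 A B τ ((a ⊗ₜ b) ⊗ₜ y) ∈ kunneth 𝕜 𝒜 ℬ (m + n) := fun i j a b hij ha hb =>
    (kunneth_le (S := (kunneth 𝕜 𝒜 ℬ (m + n)).comap
      (mulTau 𝕜 A B τ ∘ₗ TensorProduct.mk 𝕜 _ _ (a ⊗ₜ b))) (key i j a b hij ha hb)) hy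
  exact (kunneth_le (S := (kunneth 𝕜 𝒜 ℬ (m + n)).comap
      (mulTau 𝕜 A B τ ∘ₗ (TensorProduct.mk 𝕜 _ _).flip y)) h1) hx

lemma Realizes.exists_gAlg [GradedAlgebra 𝒜] [GradedAlgebra ℬ] (h : Realizes 𝕜 A B τ C ψ)
    (hg : IsGradedMapBA 𝕜 A B 𝒜 ℬ τ)
    (hA : ∀ n a, a ∈ 𝒜 n ↔ gA.p n a = a) (hB : ∀ n b, b ∈ ℬ n ↔ gB.p n b = b) :
    ∃ gC : GAlg 𝕜 C, (∀ n c, c ∈ Submodule.map ψ (kunneth 𝕜 𝒜 ℬ n) ↔ gC.p n c = c) ∧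
      ∀ n x, gC.p n (ψ x) = ψ (tensorProj gA gB n x) := by
  let e := LinearEquiv.ofBijective ψ h.1
  have he : ∀ x, e.symm (ψ x) = x := fun x => e.symm_apply_apply x
  let p : ℕ → C →ₗ[𝕜] C := fun n => ψ ∘ₗ tensorProj gA gB n ∘ₗ e.symm.toLinearMap
  have hp : ∀ n x, p n (ψ x) = ψ (tensorProj gA gB n x) := fun n x => by simp [p, he]
  have hmem : ∀ n c, c ∈ Submodule.map ψ (kunneth 𝕜 𝒜 ℬ n) ↔ p n c = c := by
    intro n c
    obtain ⟨x, rfl⟩ := h.1.2 c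
    rw [hp, h.1.1.eq_iff, ← mem_kunneth_iff hA hB]
    exact Function.Injective.mem_set_image h.1.1
  refine ⟨GAlg.ofMul p ?_ ?_ ?_
    (LinearMap.mul' 𝕜 𝕜 ∘ₗ TensorProduct.map gA.ε gB.ε ∘ₗ e.symm.toLinearMap) ?_ ?_, hmem, hp⟩
  · intro i j c
    obtain ⟨x, rfl⟩ := h.1.2 c
    rw [hp, hp, tensorProj_tensorProj]
    split_ifs <;> simp
  · intro c
    obtain ⟨x, rfl⟩ := h.1.2 c
    obtain ⟨N, hN⟩ := tensorProj_summable gA gB x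
    refine ⟨N, fun n hn => ?_⟩
    simp only [hp]
    rw [← map_sum, hN n hn]
  · intro i j c d hc hd
    rw [← hmem] at hc hd ⊢
    obtain ⟨x, hx, rfl⟩ := hc
    obtain ⟨y, hy, rfl⟩ := hd
    rw [← h.2.2]
    exact Submodule.mem_map_of_mem (mulTau_mem_kunneth hg hx hy)
  · intro c
    obtain ⟨x, rfl⟩ := h.1.2 c
    rw [hp]
    simp only [LinearMap.comp_apply, LinearEquiv.coe_coe, he]
    rw [← h.2.1, ← map_smul]
    congr 1
    induction x with
    | zero => simp
    | add x y hx hy => simp only [map_add, hx, hy, add_smul]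
    | tmul a b =>
      rw [tensorProj_tmul, Finset.Nat.antidiagonal_zero, Finset.sum_singleton, gA.p_zero,
        gB.p_zero]
      simp [TensorProduct.smul_tmul', TensorProduct.tmul_smul, smul_smul, mul_comm]
  · simp [← h.2.1, he, gA.ε_one, gB.ε_one]

lemma Realizes.isProd (h : Realizes 𝕜 A B τ C ψ) (hτ : IsTwisting 𝕜 A B τ) {gC : GAlg 𝕜 C}
    (hC : ∀ n x, gC.p n (ψ x) = ψ (tensorProj gA gB n x)) :
    IsProd gA gB gC (h.left hτ) (h.right hτ) where
  ιA_p i a := by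
    rw [left_apply, left_apply, hC, tensorProj_tmul]
    congr 1
    rw [Finset.sum_eq_single (i, 0)]
    · simp [gB.p_zero, gB.ε_one]
    · rintro ⟨k, l⟩ hkl hne
      have hl : l ≠ 0 := by
        rintro rfl
        exact hne (by simpa using Finset.HasAntidiagonal.mem_antidiagonal.1 hkl)
      simp [gB.p_one, hl]
    · simp
  ιB_p i b := by
    rw [right_apply, right_apply, hC, tensorProj_tmul]
    congr 1
    rw [Finset.sum_eq_single (0, i)]
    · simp [gA.p_zero, gA.ε_one]
    · rintro ⟨k, l⟩ hkl hne
      have hk : k ≠ 0 := by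
        rintro rfl
        exact hne (by simpa using Finset.HasAntidiagonal.mem_antidiagonal.1 hkl)
      simp [gA.p_one, hk]
    · simp
  bij := by
    rw [h.act_eq]
    exact h.1

lemma mem_plusPart (hA : ∀ n a, a ∈ 𝒜 n ↔ gA.p n a = a) (a : A) : a ∈ plusPart 𝕜 𝒜 ↔ gA.ε a = 0 := by
  constructor
  · have : plusPart 𝕜 𝒜 ≤ LinearMap.ker gA.ε := iSup₂_le fun i hi x hx => by
      rw [LinearMap.mem_ker, ← (hA i x).1 hx, gA.ε_p, if_neg (by omega)]
    exact fun h => this h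
  · intro h0
    obtain ⟨N, hN⟩ := gA.exists_sum a
    rw [← hN]
    refine sum_mem fun i _ => ?_
    rcases Nat.eq_zero_or_pos i with rfl | hi
    · simp [gA.p_zero, h0]
    · exact Submodule.mem_iSup_of_mem i (Submodule.mem_iSup_of_mem hi ((hA _ _).2 (gA.p_mem _ _)))

variable (gA gB) in
/-- Applying the augmentation to the left factor. -/
def augLeft : A ⊗[𝕜] B →ₗ[𝕜] B := (TensorProduct.lid 𝕜 B).toLinearMap ∘ₗ gA.ε.rTensor B

variable (gA gB) in
/-- Applying the augmentation to the right factor. -/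
def augRight : A ⊗[𝕜] B →ₗ[𝕜] A := (TensorProduct.rid 𝕜 A).toLinearMap ∘ₗ gB.ε.lTensor A

lemma augLeft_tmul (a : A) (b : B) : augLeft gA (a ⊗ₜ[𝕜] b) = gA.ε a • b := by simp [augLeft]

lemma augRight_tmul (a : A) (b : B) : augRight gB (a ⊗ₜ[𝕜] b) = gB.ε b • a := by simp [augRight]

/-- A twist is determined by its unital conditions and its values on positive parts. -/
lemma twist_decomp (hτ : IsTwisting 𝕜 A B τ) (a : A) (b : B) : τ (b ⊗ₜ a) =
    τ ((b - gB.ε b • 1) ⊗ₜ (a - gA.ε a • 1)) + gB.ε b • a ⊗ₜ 1 + gA.ε a • 1 ⊗ₜ b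
      - (gA.ε a * gB.ε b) • 1 ⊗ₜ 1 := by
  simp only [TensorProduct.sub_tmul, TensorProduct.tmul_sub, map_sub, TensorProduct.tmul_smul,
    ← TensorProduct.smul_tmul', map_smul, hτ.1, hτ.2.1, smul_sub, mul_smul]
  abel

lemma augLeft_twist (hA : ∀ n a, a ∈ 𝒜 n ↔ gA.p n a = a) (hB : ∀ n b, b ∈ ℬ n ↔ gB.p n b = b)
    (hτ : IsTwisting 𝕜 A B τ) (h1 : Submodule.map τ (subTmul 𝕜 (plusPart 𝕜 ℬ) (plusPart 𝕜 𝒜)) ≤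
      subTmul 𝕜 (plusPart 𝕜 𝒜) (ℬ 0) ⊔ subTmul 𝕜 (plusPart 𝕜 𝒜) (plusPart 𝕜 ℬ)) (a : A) (b : B) :
    augLeft gA (τ (b ⊗ₜ a)) = gA.ε a • b := by
  have hle : subTmul 𝕜 (plusPart 𝕜 𝒜) (ℬ 0) ⊔ subTmul 𝕜 (plusPart 𝕜 𝒜) (plusPart 𝕜 ℬ) ≤
      LinearMap.ker (augLeft (B := B) gA) :=
    sup_le (subTmul_le fun x hx y _ => by
        rw [LinearMap.mem_ker, augLeft_tmul, (mem_plusPart hA x).1 hx, zero_smul])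
      (subTmul_le fun x hx y _ => by
        rw [LinearMap.mem_ker, augLeft_tmul, (mem_plusPart hA x).1 hx, zero_smul])
  have h0 : augLeft gA (τ ((b - gB.ε b • 1) ⊗ₜ (a - gA.ε a • 1))) = 0 :=
    hle (h1 (Submodule.mem_map_of_mem (tmul_mem_subTmul
      ((mem_plusPart hB _).2 (by simp [gB.ε_one])) ((mem_plusPart hA _).2 (by simp [gA.ε_one])))))
  rw [twist_decomp (gA := gA) (gB := gB) hτ]
  simp only [map_add, map_sub, h0, map_smul, augLeft_tmul, gA.ε_one, one_smul, mul_smul]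
  rw [smul_comm (gB.ε b)]
  abel

lemma augRight_twist (hA : ∀ n a, a ∈ 𝒜 n ↔ gA.p n a = a) (hB : ∀ n b, b ∈ ℬ n ↔ gB.p n b = b)
    (hτ : IsTwisting 𝕜 A B τ) (h1 : Submodule.map τ (subTmul 𝕜 (plusPart 𝕜 ℬ) (plusPart 𝕜 𝒜)) ≤
      subTmul 𝕜 (plusPart 𝕜 𝒜) (plusPart 𝕜 ℬ) ⊔ subTmul 𝕜 (𝒜 0) (plusPart 𝕜 ℬ)) (a : A) (b : B) :
    augRight gB (τ (b ⊗ₜ a)) = gB.ε b • a := by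
  have hle : subTmul 𝕜 (plusPart 𝕜 𝒜) (plusPart 𝕜 ℬ) ⊔ subTmul 𝕜 (𝒜 0) (plusPart 𝕜 ℬ) ≤
      LinearMap.ker (augRight (A := A) gB) :=
    sup_le (subTmul_le fun x _ y hy => by
        rw [LinearMap.mem_ker, augRight_tmul, (mem_plusPart hB y).1 hy, zero_smul])
      (subTmul_le fun x _ y hy => by
        rw [LinearMap.mem_ker, augRight_tmul, (mem_plusPart hB y).1 hy, zero_smul])
  have h0 : augRight gB (τ ((b - gB.ε b • 1) ⊗ₜ (a - gA.ε a • 1))) = 0 :=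
    hle (h1 (Submodule.mem_map_of_mem (tmul_mem_subTmul
      ((mem_plusPart hB _).2 (by simp [gB.ε_one])) ((mem_plusPart hA _).2 (by simp [gA.ε_one])))))
  rw [twist_decomp (gA := gA) (gB := gB) hτ]
  simp only [map_add, map_sub, h0, map_smul, augRight_tmul, gB.ε_one, one_smul, mul_smul]
  abel

lemma augLeft_tensorProj (l : ℕ) (x : A ⊗[𝕜] B) :
    augLeft gA (tensorProj gA gB l x) = gB.p l (augLeft gA x) := by
  induction x with
  | zero => simp
  | add x y hx hy => simp only [map_add, hx, hy]
  | tmul a b =>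
    rw [tensorProj_tmul, map_sum, augLeft_tmul, map_smul, Finset.sum_eq_single (0, l)]
    · simp [augLeft_tmul, gA.ε_p]
    · rintro ⟨i, j⟩ hij hne
      have hi : i ≠ 0 := by
        rintro rfl
        exact hne (by simpa using Finset.HasAntidiagonal.mem_antidiagonal.1 hij)
      simp [augLeft_tmul, gA.ε_p, hi]
    · simp

lemma augRight_tensorProj (l : ℕ) (x : A ⊗[𝕜] B) :
    augRight gB (tensorProj gA gB l x) = gA.p l (augRight gB x) := by
  induction x with
  | zero => simp
  | add x y hx hy => simp only [map_add, hx, hy]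
  | tmul a b =>
    rw [tensorProj_tmul, map_sum, augRight_tmul, map_smul, Finset.sum_eq_single (l, 0)]
    · simp [augRight_tmul, gB.ε_p]
    · rintro ⟨i, j⟩ hij hne
      have hj : j ≠ 0 := by
        rintro rfl
        exact hne (by simpa using Finset.HasAntidiagonal.mem_antidiagonal.1 hij)
      simp [augRight_tmul, gB.ε_p, hj]
    · simp

lemma augLeft_mulTau (H : ∀ a b, augLeft gA (τ (b ⊗ₜ a)) = gA.ε a • b) (x y : A ⊗[𝕜] B) :
    augLeft gA (mulTau 𝕜 A B τ (x ⊗ₜ y)) = augLeft gA x * augLeft gA y := by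
  have key : ∀ (a : A) (b : B) (t : A ⊗[𝕜] B), augLeft gA (TensorProduct.map (LinearMap.mulLeft 𝕜 a)
      (LinearMap.mulRight 𝕜 b) t) = gA.ε a • (augLeft gA t * b) := by
    intro a b t
    induction t with
    | zero => simp
    | add x y hx hy => simp only [map_add, hx, hy, add_mul, smul_add]
    | tmul c d => simp [augLeft_tmul, gA.ε_mul, mul_smul]
  induction x with
  | zero => simp
  | add x x' hx hx' => simp only [TensorProduct.add_tmul, map_add, hx, hx', add_mul]
  | tmul a b =>
    induction y with
    | zero => simp
    | add y y' hy hy' => simp only [TensorProduct.tmul_add, map_add, hy, hy', mul_add]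
    | tmul a' b' =>
      rw [mulTau_tmul, key, H, augLeft_tmul, augLeft_tmul, smul_mul_assoc, smul_mul_smul_comm,
        mul_smul]

lemma augRight_mulTau (H : ∀ a b, augRight gB (τ (b ⊗ₜ a)) = gB.ε b • a) (x y : A ⊗[𝕜] B) :
    augRight gB (mulTau 𝕜 A B τ (x ⊗ₜ y)) = augRight gB x * augRight gB y := by
  have key : ∀ (a : A) (b : B) (t : A ⊗[𝕜] B), augRight gB (TensorProduct.map (LinearMap.mulLeft 𝕜 a)
      (LinearMap.mulRight 𝕜 b) t) = gB.ε b • (a * augRight gB t) := by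
    intro a b t
    induction t with
    | zero => simp
    | add x y hx hy => simp only [map_add, hx, hy, mul_add, smul_add]
    | tmul c d => simp [augRight_tmul, gB.ε_mul, mul_smul, smul_comm (gB.ε d)]
  induction x with
  | zero => simp
  | add x x' hx hx' => simp only [TensorProduct.add_tmul, map_add, hx, hx', add_mul]
  | tmul a b =>
    induction y with
    | zero => simp
    | add y y' hy hy' => simp only [TensorProduct.tmul_add, map_add, hy, hy', mul_add]
    | tmul a' b' => rw [mulTau_tmul, key, H, augRight_tmul, augRight_tmul]; simp

/-- A multiplicative linear map on a realization, as an algebra homomorphism. -/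
lemma Realizes.exists_algHom {D : Type} [Ring D] [Algebra 𝕜 D] (h : Realizes 𝕜 A B τ C ψ)
    (f : A ⊗[𝕜] B →ₗ[𝕜] D) (f_one : f (1 ⊗ₜ 1) = 1)
    (f_mul : ∀ x y, f (mulTau 𝕜 A B τ (x ⊗ₜ y)) = f x * f y) :
    ∃ ρ : C →ₐ[𝕜] D, ∀ x, ρ (ψ x) = f x := by
  let e := LinearEquiv.ofBijective ψ h.1
  have he : ∀ x, e.symm (ψ x) = x := fun x => e.symm_apply_apply x
  refine ⟨AlgHom.ofLinearMap (f ∘ₗ e.symm.toLinearMap) ?_ ?_, fun x => ?_⟩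
  · simp [← h.2.1, he, f_one]
  · intro c d
    obtain ⟨x, rfl⟩ := h.1.2 c
    obtain ⟨y, rfl⟩ := h.1.2 d
    rw [← h.2.2]
    simp [he, f_mul]
  · simp [he]

theorem Realizes.isKoszul [GradedAlgebra 𝒜] [GradedAlgebra ℬ] [Nontrivial A] [Nontrivial B]
    (hconnA : 𝒜 0 = (1 : Submodule 𝕜 A)) (hconnB : ℬ 0 = (1 : Submodule 𝕜 B))
    (hτ : IsGradedTwisting 𝕜 A B 𝒜 ℬ τ)
    (honesided :
      Submodule.map τ (subTmul 𝕜 (plusPart 𝕜 ℬ) (plusPart 𝕜 𝒜)) ≤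
        subTmul 𝕜 (plusPart 𝕜 𝒜) (ℬ 0) ⊔ subTmul 𝕜 (plusPart 𝕜 𝒜) (plusPart 𝕜 ℬ) ∨
      Submodule.map τ (subTmul 𝕜 (plusPart 𝕜 ℬ) (plusPart 𝕜 𝒜)) ≤
        subTmul 𝕜 (plusPart 𝕜 𝒜) (plusPart 𝕜 ℬ) ⊔ subTmul 𝕜 (𝒜 0) (plusPart 𝕜 ℬ))
    (h : Realizes 𝕜 A B τ C ψ) (hKA : IsKoszul 𝕜 A 𝒜) (hKB : IsKoszul 𝕜 B ℬ) :
    IsKoszul 𝕜 C (fun n => Submodule.map ψ (kunneth 𝕜 𝒜 ℬ n)) := by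
  obtain ⟨gA, hA⟩ := TTP.exists_gAlg 𝒜 hconnA
  obtain ⟨gB, hB⟩ := TTP.exists_gAlg ℬ hconnB
  obtain ⟨gC, hC, hCp⟩ := h.exists_gAlg hτ.2 hA hB
  have H := h.isProd hτ.1 hCp
  rcases honesided with h1 | h1
  · obtain ⟨ρ, hρ⟩ := h.exists_algHom (augLeft gA) (by simp [augLeft_tmul, gA.ε_one])
      (augLeft_mulTau (augLeft_twist hA hB hτ.1 h1))
    refine H.isKoszul_of_right hA hB hC ρ (fun i c => ?_) (fun a => ?_) (fun b => ?_) hKA hKB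
    · obtain ⟨x, rfl⟩ := h.1.2 c
      rw [hCp, hρ, hρ, augLeft_tensorProj]
    · rw [left_apply, hρ, augLeft_tmul]
    · rw [right_apply, hρ, augLeft_tmul, gA.ε_one, one_smul]
  · obtain ⟨ρ, hρ⟩ := h.exists_algHom (augRight gB) (by simp [augRight_tmul, gB.ε_one])
      (augRight_mulTau (augRight_twist hA hB hτ.1 h1))
    refine H.isKoszul_of_left hA hB hC ρ (fun i c => ?_) (fun a => ?_) (fun b => ?_) hKA hKB
    · obtain ⟨x, rfl⟩ := h.1.2 c
      rw [hCp, hρ, hρ, augRight_tensorProj]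
    · rw [left_apply, hρ, augRight_tmul, gB.ε_one, one_smul]
    · rw [right_apply, hρ, augRight_tmul]

lemma isKoszul_of_subsingleton [Subsingleton C] (𝒞 : ℕ → Submodule 𝕜 C) : IsKoszul 𝕜 C 𝒞 := by
  have hs : Subsingleton (C ⧸ augIdeal 𝕜 C 𝒞) := (Submodule.mkQ_surjective _).subsingleton
  refine ⟨fun _ => Empty, fun _ => 0, 0, fun x => ⟨0, Subsingleton.elim _ _⟩,
    Subsingleton.elim _ _, fun _ => Subsingleton.elim _ _, fun i n x _ => ?_, fun n _ x _ => rfl⟩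
  rw [LinearMap.zero_apply]
  exact zero_mem _

end Realization

end TTP

namespace TTP

section TensorAlgebraRelations

variable {𝕜 : Type} [Field 𝕜] {U V W : Type} [AddCommGroup U] [Module 𝕜 U] [AddCommGroup V]
  [Module 𝕜 V] [AddCommGroup W] [Module 𝕜 W]

lemma eq_top_of_ι_mul_mem {J : Submodule 𝕜 (TensorAlgebra 𝕜 V)} (h1 : 1 ∈ J)
    (h : ∀ v, ∀ x ∈ J, TensorAlgebra.ι 𝕜 v * x ∈ J) : J = ⊤ := by
  have key : ∀ t : TensorAlgebra 𝕜 V, ∀ x ∈ J, t * x ∈ J := by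
    intro t
    induction t using TensorAlgebra.induction with
    | algebraMap r => intro x hx; rw [← Algebra.smul_def]; exact J.smul_mem r hx
    | ι v => exact h v
    | mul a b ha hb => intro x hx; rw [mul_assoc]; exact ha _ (hb _ hx)
    | add a b ha hb => intro x hx; rw [add_mul]; exact add_mem (ha _ hx) (hb _ hx)
  exact eq_top_iff.2 fun t _ => by simpa using key t 1 h1

lemma eq_top_of_mul_ι_mem {J : Submodule 𝕜 (TensorAlgebra 𝕜 V)} (h1 : 1 ∈ J)
    (h : ∀ v, ∀ x ∈ J, x * TensorAlgebra.ι 𝕜 v ∈ J) : J = ⊤ := by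
  have key : ∀ t : TensorAlgebra 𝕜 V, ∀ x ∈ J, x * t ∈ J := by
    intro t
    induction t using TensorAlgebra.induction with
    | algebraMap r =>
      intro x hx
      rw [← Algebra.commutes, ← Algebra.smul_def]
      exact J.smul_mem r hx
    | ι v => exact h v
    | mul a b ha hb => intro x hx; rw [← mul_assoc]; exact hb _ (ha _ hx)
    | add a b ha hb => intro x hx; rw [mul_add]; exact add_mem (ha _ hx) (hb _ hx)
  exact eq_top_iff.2 fun t _ => by simpa using key t 1 h1

/-- The map of tensor algebras induced by a linear map. -/
def tensorMap (j : U →ₗ[𝕜] W) : TensorAlgebra 𝕜 U →ₐ[𝕜] TensorAlgebra 𝕜 W :=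
  TensorAlgebra.lift 𝕜 (TensorAlgebra.ι 𝕜 ∘ₗ j)

lemma tensorMap_ι (j : U →ₗ[𝕜] W) (u : U) :
    tensorMap j (TensorAlgebra.ι 𝕜 u) = TensorAlgebra.ι 𝕜 (j u) := by
  simp [tensorMap]

lemma ι_mem_weight (v : V) : TensorAlgebra.ι 𝕜 v ∈ tensorWeight 𝕜 V 1 := by
  rw [tensorWeight, pow_one]
  exact ⟨v, rfl⟩

lemma mul_mem_weight {i j : ℕ} {x y : TensorAlgebra 𝕜 V} (hx : x ∈ tensorWeight 𝕜 V i)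
    (hy : y ∈ tensorWeight 𝕜 V j) : x * y ∈ tensorWeight 𝕜 V (i + j) := by
  rw [tensorWeight, pow_add]
  exact Submodule.mul_mem_mul hx hy

lemma tensorMap_weight (j : U →ₗ[𝕜] W) {n : ℕ} {x : TensorAlgebra 𝕜 U}
    (hx : x ∈ tensorWeight 𝕜 U n) : tensorMap j x ∈ tensorWeight 𝕜 W n := by
  have h1 : (LinearMap.range (TensorAlgebra.ι 𝕜 (M := U))).map (tensorMap j).toLinearMap ≤
      LinearMap.range (TensorAlgebra.ι 𝕜 (M := W)) := by
    rintro _ ⟨_, ⟨u, rfl⟩, rfl⟩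
    exact ⟨j u, (tensorMap_ι j u).symm⟩
  have h2 : (tensorWeight 𝕜 U n).map (tensorMap j).toLinearMap ≤ tensorWeight 𝕜 W n := by
    rw [tensorWeight, Submodule.map_pow]
    exact pow_le_pow_left' h1 n
  exact h2 (Submodule.mem_map_of_mem hx)

lemma mul_mem_idealSpan {R : Type} [Ring R] [Algebra 𝕜 R] {s : Set R} {x : R}
    (hx : x ∈ idealSpan 𝕜 R s) (c d : R) : c * x * d ∈ idealSpan 𝕜 R s := by
  induction hx using Submodule.span_induction with
  | zero => simp
  | add x y _ _ hx hy => rw [mul_add, add_mul]; exact add_mem hx hy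
  | smul r x _ hx => rw [mul_smul_comm, smul_mul_assoc]; exact Submodule.smul_mem _ r hx
  | mem x hx =>
    obtain ⟨c', d', r, hr, rfl⟩ := hx
    exact Submodule.subset_span ⟨c * c', d' * d, r, hr, by simp only [mul_assoc]⟩

lemma subset_idealSpan {R : Type} [Ring R] [Algebra 𝕜 R] {s : Set R} {x : R} (hx : x ∈ s) :
    x ∈ idealSpan 𝕜 R s :=
  Submodule.subset_span ⟨1, 1, x, hx, by simp⟩

lemma idealSpan_le {R S : Type} [Ring R] [Algebra 𝕜 R] [Ring S] [Algebra 𝕜 S] {s : Set R} {t : Set S}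
    (f : R →ₐ[𝕜] S) (h : ∀ x ∈ s, f x ∈ idealSpan 𝕜 S t) {x : R} (hx : x ∈ idealSpan 𝕜 R s) :
    f x ∈ idealSpan 𝕜 S t := by
  have : idealSpan 𝕜 R s ≤ (idealSpan 𝕜 S t).comap f.toLinearMap := by
    refine Submodule.span_le.2 ?_
    rintro _ ⟨c, d, r, hr, rfl⟩
    change f (c * r * d) ∈ idealSpan 𝕜 S t
    rw [map_mul, map_mul]
    exact mul_mem_idealSpan (s := t) (h r hr) _ _
  exact this hx

lemma idealSpan_le_ker {R S : Type} [Ring R] [Algebra 𝕜 R] [Ring S] [Algebra 𝕜 S] {s : Set R}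
    (f : R →ₐ[𝕜] S) (h : ∀ x ∈ s, f x = 0) : idealSpan 𝕜 R s ≤ LinearMap.ker f.toLinearMap := by
  refine Submodule.span_le.2 ?_
  rintro _ ⟨c, d, r, hr, rfl⟩
  simp [h r hr]

variable (jA : U →ₗ[𝕜] W) (jB : V →ₗ[𝕜] W) (s : Set (TensorAlgebra 𝕜 W))

/-- If every product `v u` of generators can be rewritten modulo an ideal with all generators
from `U` to the left and at most one from `V` remaining, then ordered products span the quotient. -/
lemma range_sup_eq_top_left (hW : ∀ w, ∃ u v, w = jA u + jB v)
    (hrel : ∀ u v, ∃ y ∈ LinearMap.range (tensorMap jA).toLinearMap ⊔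
        LinearMap.range (tensorMap jA).toLinearMap * LinearMap.range (TensorAlgebra.ι 𝕜 ∘ₗ jB),
      TensorAlgebra.ι 𝕜 (jB v) * TensorAlgebra.ι 𝕜 (jA u) - y ∈ idealSpan 𝕜 _ s) :
    LinearMap.range (mulMapP 𝕜 _ _ _ (tensorMap jA) (tensorMap jB)) ⊔ idealSpan 𝕜 _ s = ⊤ := by
  set J := LinearMap.range (mulMapP 𝕜 _ _ _ (tensorMap jA) (tensorMap jB)) ⊔ idealSpan 𝕜 _ s
  have hP : ∀ x y, tensorMap jA x * tensorMap jB y ∈ J := fun x y =>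
    Submodule.mem_sup_left ⟨x ⊗ₜ y, by simp [mulMapP]⟩
  have hJ : ∀ f : TensorAlgebra 𝕜 W →ₗ[𝕜] TensorAlgebra 𝕜 W,
      (∀ x y, f (tensorMap jA x * tensorMap jB y) ∈ J) → (∀ i ∈ idealSpan 𝕜 _ s, f i ∈ J) →
      ∀ z ∈ J, f z ∈ J := by
    intro f h1 h2 z hz
    refine (sup_le ?_ h2 : J ≤ J.comap f) hz
    rintro _ ⟨w, rfl⟩
    induction w with
    | zero => simp
    | add x y hx hy => rw [map_add]; exact add_mem hx hy
    | tmul x y => simpa [mulMapP] using h1 x y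
  have hα : ∀ t, ∀ z ∈ J, tensorMap jA t * z ∈ J := fun t =>
    hJ (LinearMap.mulLeft 𝕜 _) (fun x y => by
      simpa [mul_assoc] using hP (t * x) y) (fun i hi => Submodule.mem_sup_right (by
      simpa using mul_mem_idealSpan hi (tensorMap jA t) 1))
  have hK : ∀ x : TensorAlgebra 𝕜 U, ∀ v y,
      TensorAlgebra.ι 𝕜 (jB v) * (tensorMap jA x * tensorMap jB y) ∈ J := by
    let K : Submodule 𝕜 (TensorAlgebra 𝕜 U) :=
      { carrier := {x | ∀ v y, TensorAlgebra.ι 𝕜 (jB v) * (tensorMap jA x * tensorMap jB y) ∈ J}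
        zero_mem' := fun v y => by simp
        add_mem' := fun {a b} ha hb v y => by
          rw [map_add, add_mul, mul_add]
          exact add_mem (ha v y) (hb v y)
        smul_mem' := fun c a ha v y => by
          rw [map_smul, smul_mul_assoc, mul_smul_comm]
          exact J.smul_mem c (ha v y) }
    have hKtop : K = ⊤ := by
      refine eq_top_of_ι_mul_mem (fun v y => ?_) fun u x hx v y => ?_
      · rw [← tensorMap_ι]
        simpa using hP 1 (TensorAlgebra.ι 𝕜 v * y)
      · obtain ⟨q, hq, hi⟩ := hrel u v
        set z := tensorMap jA x * tensorMap jB y with hz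
        have hq' : q * z ∈ J := by
          refine (sup_le ?_ (Submodule.mul_le.2 ?_) : _ ≤ J.comap (LinearMap.mulRight 𝕜 z)) hq
          · rintro _ ⟨t, rfl⟩
            exact hα t _ (hP x y)
          · rintro _ ⟨t, rfl⟩ _ ⟨v', rfl⟩
            have := hα t _ (hx v' y)
            rwa [← mul_assoc] at this
        have : TensorAlgebra.ι 𝕜 (jB v) * (tensorMap jA (TensorAlgebra.ι 𝕜 u * x) * tensorMap jB y)
            = (TensorAlgebra.ι 𝕜 (jB v) * TensorAlgebra.ι 𝕜 (jA u) - q) * z + q * z := by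
          rw [map_mul, tensorMap_ι, hz]
          simp only [sub_mul, mul_assoc, sub_add_cancel]
        rw [this]
        exact add_mem (Submodule.mem_sup_right (by simpa using mul_mem_idealSpan hi 1 z)) hq'
    intro x
    have : x ∈ K := hKtop ▸ Submodule.mem_top
    exact this
  refine eq_top_of_ι_mul_mem (by simpa using hP 1 1) fun w z hz => ?_
  obtain ⟨u, v, rfl⟩ := hW w
  rw [map_add, add_mul]
  refine add_mem (tensorMap_ι jA u ▸ hα _ _ hz) (hJ (LinearMap.mulLeft 𝕜 _) (fun x y => hK x v y)
    (fun i hi => Submodule.mem_sup_right ?_) z hz)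
  simpa using mul_mem_idealSpan hi (TensorAlgebra.ι 𝕜 (jB v)) 1

/-- If every product `v u` of generators can be rewritten modulo an ideal with all generators
from `V` to the right and at most one from `U` remaining, then ordered products span the quotient. -/
lemma range_sup_eq_top_right (hW : ∀ w, ∃ u v, w = jA u + jB v)
    (hrel : ∀ u v, ∃ y ∈ LinearMap.range (tensorMap jB).toLinearMap ⊔
        LinearMap.range (TensorAlgebra.ι 𝕜 ∘ₗ jA) * LinearMap.range (tensorMap jB).toLinearMap,
      TensorAlgebra.ι 𝕜 (jB v) * TensorAlgebra.ι 𝕜 (jA u) - y ∈ idealSpan 𝕜 _ s) :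
    LinearMap.range (mulMapP 𝕜 _ _ _ (tensorMap jA) (tensorMap jB)) ⊔ idealSpan 𝕜 _ s = ⊤ := by
  set J := LinearMap.range (mulMapP 𝕜 _ _ _ (tensorMap jA) (tensorMap jB)) ⊔ idealSpan 𝕜 _ s
  have hP : ∀ x y, tensorMap jA x * tensorMap jB y ∈ J := fun x y =>
    Submodule.mem_sup_left ⟨x ⊗ₜ y, by simp [mulMapP]⟩
  have hJ : ∀ f : TensorAlgebra 𝕜 W →ₗ[𝕜] TensorAlgebra 𝕜 W,
      (∀ x y, f (tensorMap jA x * tensorMap jB y) ∈ J) → (∀ i ∈ idealSpan 𝕜 _ s, f i ∈ J) →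
      ∀ z ∈ J, f z ∈ J := by
    intro f h1 h2 z hz
    refine (sup_le ?_ h2 : J ≤ J.comap f) hz
    rintro _ ⟨w, rfl⟩
    induction w with
    | zero => simp
    | add x y hx hy => rw [map_add]; exact add_mem hx hy
    | tmul x y => simpa [mulMapP] using h1 x y
  have hβ : ∀ t, ∀ z ∈ J, z * tensorMap jB t ∈ J := fun t =>
    hJ (LinearMap.mulRight 𝕜 _) (fun x y => by
      simpa [mul_assoc] using hP x (y * t)) (fun i hi => Submodule.mem_sup_right (by
      simpa using mul_mem_idealSpan hi 1 (tensorMap jB t)))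
  have hK : ∀ y : TensorAlgebra 𝕜 V, ∀ u x,
      tensorMap jA x * tensorMap jB y * TensorAlgebra.ι 𝕜 (jA u) ∈ J := by
    let K : Submodule 𝕜 (TensorAlgebra 𝕜 V) :=
      { carrier := {y | ∀ u x, tensorMap jA x * tensorMap jB y * TensorAlgebra.ι 𝕜 (jA u) ∈ J}
        zero_mem' := fun v y => by simp
        add_mem' := fun {a b} ha hb v y => by
          rw [map_add, mul_add, add_mul]
          exact add_mem (ha v y) (hb v y)
        smul_mem' := fun c a ha v y => by
          rw [map_smul, mul_smul_comm, smul_mul_assoc]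
          exact J.smul_mem c (ha v y) }
    have hKtop : K = ⊤ := by
      refine eq_top_of_mul_ι_mem (fun u x => ?_) fun v y hy u x => ?_
      · rw [← tensorMap_ι]
        simpa using hP (x * TensorAlgebra.ι 𝕜 u) 1
      · obtain ⟨q, hq, hi⟩ := hrel u v
        set z := tensorMap jA x * tensorMap jB y with hz
        have hq' : z * q ∈ J := by
          refine (sup_le ?_ (Submodule.mul_le.2 ?_) : _ ≤ J.comap (LinearMap.mulLeft 𝕜 z)) hq
          · rintro _ ⟨t, rfl⟩
            exact hβ t _ (hP x y)
          · rintro _ ⟨u', rfl⟩ _ ⟨t, rfl⟩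
            have := hβ t _ (hy u' x)
            rwa [mul_assoc] at this
        have : tensorMap jA x * tensorMap jB (y * TensorAlgebra.ι 𝕜 v) * TensorAlgebra.ι 𝕜 (jA u)
            = z * (TensorAlgebra.ι 𝕜 (jB v) * TensorAlgebra.ι 𝕜 (jA u) - q) + z * q := by
          rw [map_mul, tensorMap_ι, hz]
          simp only [mul_sub, mul_assoc, sub_add_cancel]
        rw [this]
        exact add_mem (Submodule.mem_sup_right (by simpa using mul_mem_idealSpan hi z 1)) hq'
    intro y
    have : y ∈ K := hKtop ▸ Submodule.mem_top
    exact this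
  refine eq_top_of_mul_ι_mem (by simpa using hP 1 1) fun w z hz => ?_
  obtain ⟨u, v, rfl⟩ := hW w
  rw [map_add, mul_add]
  refine add_mem (hJ (LinearMap.mulRight 𝕜 _) (fun x y => hK y u x)
    (fun i hi => Submodule.mem_sup_right ?_) z hz) (tensorMap_ι jB v ▸ hβ _ _ hz)
  simpa using mul_mem_idealSpan hi 1 (TensorAlgebra.ι 𝕜 (jA u))

end TensorAlgebraRelations

end TTP

namespace TTP

section Quadratic

variable {𝕜 : Type} [Field 𝕜]
variable {A B C : Type} [Ring A] [Algebra 𝕜 A] [Ring B] [Algebra 𝕜 B] [Ring C] [Algebra 𝕜 C]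

lemma IsQuadraticAlg.nontrivial {𝒜 : ℕ → Submodule 𝕜 A} (h : IsQuadraticAlg 𝕜 A 𝒜) :
    Nontrivial A := by
  by_contra hn
  rw [not_nontrivial_iff_subsingleton] at hn
  have h1 : (1 : TensorAlgebra 𝕜 (𝒜 1)) ∈ LinearMap.ker (canMap 𝕜 A 𝒜).toLinearMap :=
    Subsingleton.elim (α := A) _ _
  rw [h.2] at h1
  have h2 := idealSpan_le_ker (TensorAlgebra.algebraMapInv (R := 𝕜) (M := 𝒜 1)) (fun x hx => ?_) h1
  · simp at h2
  · have hle : tensorWeight 𝕜 (𝒜 1) 2 ≤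
        LinearMap.ker (TensorAlgebra.algebraMapInv (R := 𝕜) (M := 𝒜 1)).toLinearMap := by
      rw [tensorWeight, pow_two, Submodule.mul_le]
      rintro _ ⟨v, rfl⟩ _ ⟨w, rfl⟩
      simp [TensorAlgebra.algebraMapInv]
    exact hle hx.2

lemma canMap_ι (𝒜 : ℕ → Submodule 𝕜 A) (a : 𝒜 1) :
    canMap 𝕜 A 𝒜 (TensorAlgebra.ι 𝕜 a) = a := by
  simp [canMap]

lemma p_canMap (gA : GAlg 𝕜 A) {𝒜 : ℕ → Submodule 𝕜 A} (hA : ∀ n a, a ∈ 𝒜 n ↔ gA.p n a = a)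
    (x : TensorAlgebra 𝕜 (𝒜 1)) : ∀ k, gA.p k (canMap 𝕜 A 𝒜 x) ∈
      (tensorWeight 𝕜 (𝒜 1) k).map (canMap 𝕜 A 𝒜).toLinearMap := by
  induction x using TensorAlgebra.induction with
  | algebraMap r =>
    intro k
    rw [AlgHom.commutes, Algebra.algebraMap_eq_smul_one, map_smul, gA.p_one]
    split_ifs with hk
    · subst hk
      refine Submodule.smul_mem _ r ⟨1, ?_, map_one (canMap 𝕜 A 𝒜)⟩
      rw [tensorWeight, pow_zero]
      exact Submodule.one_le.1 le_rfl
    · rw [smul_zero]; exact zero_mem _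
  | ι v =>
    intro k
    rw [canMap_ι, ← (hA 1 v).1 v.2, gA.p_p]
    split_ifs with hk
    · subst hk
      exact ⟨_, ι_mem_weight v, by rw [(hA 1 v).1 v.2]; exact canMap_ι 𝒜 v⟩
    · exact zero_mem _
  | mul x y hx hy =>
    intro k
    rw [map_mul, gA.p_mul]
    refine sum_mem fun ij hij => ?_
    obtain ⟨u, hu, hu'⟩ := hx ij.1
    obtain ⟨v, hv, hv'⟩ := hy ij.2
    rw [← Finset.HasAntidiagonal.mem_antidiagonal.1 hij]
    exact ⟨u * v, mul_mem_weight hu hv, by rw [← hu', ← hv']; exact map_mul (canMap 𝕜 A 𝒜) _ _⟩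
  | add x y hx hy =>
    intro k
    rw [map_add, map_add]
    exact add_mem (hx k) (hy k)

lemma IsQuadraticAlg.exists_weight {gA : GAlg 𝕜 A} {𝒜 : ℕ → Submodule 𝕜 A}
    (h : IsQuadraticAlg 𝕜 A 𝒜) (hA : ∀ n a, a ∈ 𝒜 n ↔ gA.p n a = a) {n : ℕ} {a : A} (ha : a ∈ 𝒜 n) :
    ∃ x ∈ tensorWeight 𝕜 (𝒜 1) n, canMap 𝕜 A 𝒜 x = a := by
  obtain ⟨y, rfl⟩ := h.1 a
  obtain ⟨x, hx, hx'⟩ := p_canMap gA hA y n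
  exact ⟨x, hx, hx'.trans ((hA _ _).1 ha)⟩

variable {gA : GAlg 𝕜 A} {gB : GAlg 𝕜 B} {𝒜 : ℕ → Submodule 𝕜 A} {ℬ : ℕ → Submodule 𝕜 B}
  {𝒞 : ℕ → Submodule 𝕜 C} {ιA : A →ₐ[𝕜] C} {ιB : B →ₐ[𝕜] C} {jA : 𝒜 1 →ₗ[𝕜] 𝒞 1}
  {jB : ℬ 1 →ₗ[𝕜] 𝒞 1}

lemma canMap_tensorMap (hjA : ∀ a, (jA a : C) = ιA a) (x : TensorAlgebra 𝕜 (𝒜 1)) :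
    canMap 𝕜 C 𝒞 (tensorMap jA x) = ιA (canMap 𝕜 A 𝒜 x) := by
  have : (canMap 𝕜 C 𝒞).comp (tensorMap jA) = ιA.comp (canMap 𝕜 A 𝒜) := by
    refine TensorAlgebra.hom_ext (LinearMap.ext fun a => ?_)
    simp [tensorMap_ι, canMap_ι, hjA]
  exact DFunLike.congr_fun this x

/-- A quadratic presentation of an algebra with ordered products `A B`, given that ordered products
span modulo the quadratic relations. -/
lemma isQuadraticAlg_of_range_sup (hA : IsQuadraticAlg 𝕜 A 𝒜) (hB : IsQuadraticAlg 𝕜 B ℬ)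
    (hjA : ∀ a, (jA a : C) = ιA a) (hjB : ∀ b, (jB b : C) = ιB b)
    (hbij : Function.Bijective (mulMapP 𝕜 A B C ιA ιB))
    (htop : LinearMap.range (mulMapP 𝕜 _ _ _ (tensorMap jA) (tensorMap jB)) ⊔
      idealSpan 𝕜 (TensorAlgebra 𝕜 (𝒞 1)) ((LinearMap.ker (canMap 𝕜 C 𝒞).toLinearMap ⊓
        tensorWeight 𝕜 (𝒞 1) 2 : Submodule 𝕜 _) : Set _) = ⊤) : IsQuadraticAlg 𝕜 C 𝒞 := by
  have hcomp : ∀ w, canMap 𝕜 C 𝒞 (mulMapP 𝕜 _ _ _ (tensorMap jA) (tensorMap jB) w) =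
      mulMapP 𝕜 A B C ιA ιB (TensorProduct.map (canMap 𝕜 A 𝒜).toLinearMap
        (canMap 𝕜 B ℬ).toLinearMap w) := by
    intro w
    induction w with
    | zero => simp
    | add x y hx hy => simp only [map_add, hx, hy]
    | tmul x y => simp [mulMapP, canMap_tensorMap hjA, canMap_tensorMap hjB]
  set s : Set (TensorAlgebra 𝕜 (𝒞 1)) := ((LinearMap.ker (canMap 𝕜 C 𝒞).toLinearMap ⊓
        tensorWeight 𝕜 (𝒞 1) 2 : Submodule 𝕜 (TensorAlgebra 𝕜 (𝒞 1))) :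
          Set (TensorAlgebra 𝕜 (𝒞 1)))
  have hle : idealSpan 𝕜 _ s ≤ LinearMap.ker (canMap 𝕜 C 𝒞).toLinearMap :=
    idealSpan_le_ker _ fun x hx => hx.1
  have hIA : ∀ x ∈ LinearMap.ker (canMap 𝕜 A 𝒜).toLinearMap, tensorMap jA x ∈ idealSpan 𝕜 _ s := by
    intro x hx
    rw [hA.2] at hx
    refine idealSpan_le (t := s) _ (fun y hy => subset_idealSpan ⟨?_, tensorMap_weight jA hy.2⟩) hx
    have hy' : canMap 𝕜 A 𝒜 y = 0 := hy.1
    change canMap 𝕜 C 𝒞 _ = 0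
    rw [canMap_tensorMap hjA, hy', map_zero]
  have hIB : ∀ x ∈ LinearMap.ker (canMap 𝕜 B ℬ).toLinearMap, tensorMap jB x ∈ idealSpan 𝕜 _ s := by
    intro x hx
    rw [hB.2] at hx
    refine idealSpan_le (t := s) _ (fun y hy => subset_idealSpan ⟨?_, tensorMap_weight jB hy.2⟩) hx
    have hy' : canMap 𝕜 B ℬ y = 0 := hy.1
    change canMap 𝕜 C 𝒞 _ = 0
    rw [canMap_tensorMap hjB, hy', map_zero]
  refine ⟨fun c => ?_, le_antisymm (fun z hz => ?_) hle⟩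
  · obtain ⟨x, rfl⟩ := hbij.2 c
    obtain ⟨w, rfl⟩ := TensorProduct.map_surjective (g := (canMap 𝕜 A 𝒜).toLinearMap)
      (g' := (canMap 𝕜 B ℬ).toLinearMap) hA.1 hB.1 x
    exact ⟨_, hcomp w⟩
  · have hz' : z ∈ LinearMap.range (mulMapP 𝕜 _ _ _ (tensorMap jA) (tensorMap jB)) ⊔
        idealSpan 𝕜 _ s := htop ▸ Submodule.mem_top
    obtain ⟨_, ⟨w, rfl⟩, i, hi, rfl⟩ := Submodule.mem_sup.1 hz'
    refine add_mem ?_ hi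
    have hi' : canMap 𝕜 C 𝒞 i = 0 := hle hi
    have hw : canMap 𝕜 C 𝒞 (mulMapP 𝕜 _ _ _ (tensorMap jA) (tensorMap jB) w) = 0 := by
      have : canMap 𝕜 C 𝒞 (mulMapP 𝕜 _ _ _ (tensorMap jA) (tensorMap jB) w + i) = 0 := hz
      rwa [map_add, hi', add_zero] at this
    rw [hcomp, map_eq_zero_iff _ hbij.1] at hw
    have hw' : w ∈ LinearMap.ker (TensorProduct.map (canMap 𝕜 A 𝒜).toLinearMap
      (canMap 𝕜 B ℬ).toLinearMap) := hw
    rw [TensorProduct.map_ker (LinearMap.exact_subtype_ker_map _) hA.1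
      (LinearMap.exact_subtype_ker_map _) hB.1] at hw'
    refine (sup_le ?_ ?_ : _ ≤ (idealSpan 𝕜 _ s).comap
      (mulMapP 𝕜 _ _ _ (tensorMap jA) (tensorMap jB))) hw'
    · rintro _ ⟨t, rfl⟩
      induction t with
      | zero => simp
      | add x y hx hy => rw [map_add]; exact add_mem hx hy
      | tmul x y => simpa [mulMapP] using mul_mem_idealSpan (hIB _ y.2) (tensorMap jA x) 1
    · rintro _ ⟨t, rfl⟩
      induction t with
      | zero => simp
      | add x y hx hy => rw [map_add]; exact add_mem hx hy
      | tmul x y => simpa [mulMapP] using mul_mem_idealSpan (hIA _ x.2) 1 (tensorMap jB y)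

variable {τ : B ⊗[𝕜] A →ₗ[𝕜] A ⊗[𝕜] B} {ψ : A ⊗[𝕜] B →ₗ[𝕜] C}

lemma twist_degree_two_left [GradedAlgebra 𝒜] [GradedAlgebra ℬ]
    (hA : ∀ n a, a ∈ 𝒜 n ↔ gA.p n a = a) (hB : ∀ n b, b ∈ ℬ n ↔ gB.p n b = b)
    (hg : IsGradedMapBA 𝕜 A B 𝒜 ℬ τ)
    (h1 : Submodule.map τ (subTmul 𝕜 (plusPart 𝕜 ℬ) (plusPart 𝕜 𝒜)) ≤
      subTmul 𝕜 (plusPart 𝕜 𝒜) (ℬ 0) ⊔ subTmul 𝕜 (plusPart 𝕜 𝒜) (plusPart 𝕜 ℬ))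
    {a : A} {b : B} (ha : a ∈ 𝒜 1) (hb : b ∈ ℬ 1) :
    τ (b ⊗ₜ a) ∈ subTmul 𝕜 (𝒜 2) (ℬ 0) ⊔ subTmul 𝕜 (𝒜 1) (ℬ 1) := by
  have hplus : ∀ x ∈ plusPart 𝕜 𝒜, ∀ y, tensorProj gA gB 2 (x ⊗ₜ y) ∈
      subTmul 𝕜 (𝒜 2) (ℬ 0) ⊔ subTmul 𝕜 (𝒜 1) (ℬ 1) := by
    intro x hx y
    rw [tensorProj_tmul]
    refine sum_mem fun ij hij => ?_
    obtain ⟨i, j⟩ := ij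
    have hij' : i + j = 2 := Finset.HasAntidiagonal.mem_antidiagonal.1 hij
    obtain ⟨rfl, rfl⟩ | ⟨rfl, rfl⟩ | ⟨rfl, rfl⟩ : i = 0 ∧ j = 2 ∨ i = 1 ∧ j = 1 ∨ i = 2 ∧ j = 0 := by
      omega
    · simp [gA.p_zero, (mem_plusPart hA x).1 hx]
    · exact Submodule.mem_sup_right (tmul_mem_subTmul ((hA _ _).2 (gA.p_mem _ _))
        ((hB _ _).2 (gB.p_mem _ _)))
    · exact Submodule.mem_sup_left (tmul_mem_subTmul ((hA _ _).2 (gA.p_mem _ _))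
        ((hB _ _).2 (gB.p_mem _ _)))
  have h2 : τ (b ⊗ₜ a) ∈ kunneth 𝕜 𝒜 ℬ 2 :=
    hg _ (Submodule.mem_map_of_mem (tmul_mem_kunneth hb ha rfl))
  rw [← (mem_kunneth_iff hA hB _ _).1 h2]
  have h3 := h1 (Submodule.mem_map_of_mem (tmul_mem_subTmul
    (Submodule.mem_iSup_of_mem 1 (Submodule.mem_iSup_of_mem one_pos hb))
    (Submodule.mem_iSup_of_mem 1 (Submodule.mem_iSup_of_mem one_pos ha))))
  exact (sup_le (subTmul_le fun x hx y _ => hplus x hx y) (subTmul_le fun x hx y _ => hplus x hx y) :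
    _ ≤ (subTmul 𝕜 (𝒜 2) (ℬ 0) ⊔ subTmul 𝕜 (𝒜 1) (ℬ 1)).comap (tensorProj gA gB 2)) h3

lemma twist_degree_two_right [GradedAlgebra 𝒜] [GradedAlgebra ℬ]
    (hA : ∀ n a, a ∈ 𝒜 n ↔ gA.p n a = a) (hB : ∀ n b, b ∈ ℬ n ↔ gB.p n b = b)
    (hg : IsGradedMapBA 𝕜 A B 𝒜 ℬ τ)
    (h1 : Submodule.map τ (subTmul 𝕜 (plusPart 𝕜 ℬ) (plusPart 𝕜 𝒜)) ≤
      subTmul 𝕜 (plusPart 𝕜 𝒜) (plusPart 𝕜 ℬ) ⊔ subTmul 𝕜 (𝒜 0) (plusPart 𝕜 ℬ))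
    {a : A} {b : B} (ha : a ∈ 𝒜 1) (hb : b ∈ ℬ 1) :
    τ (b ⊗ₜ a) ∈ subTmul 𝕜 (𝒜 0) (ℬ 2) ⊔ subTmul 𝕜 (𝒜 1) (ℬ 1) := by
  have hplus : ∀ x, ∀ y ∈ plusPart 𝕜 ℬ, tensorProj gA gB 2 (x ⊗ₜ y) ∈
      subTmul 𝕜 (𝒜 0) (ℬ 2) ⊔ subTmul 𝕜 (𝒜 1) (ℬ 1) := by
    intro x y hy
    rw [tensorProj_tmul]
    refine sum_mem fun ij hij => ?_
    obtain ⟨i, j⟩ := ij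
    have hij' : i + j = 2 := Finset.HasAntidiagonal.mem_antidiagonal.1 hij
    obtain ⟨rfl, rfl⟩ | ⟨rfl, rfl⟩ | ⟨rfl, rfl⟩ : i = 0 ∧ j = 2 ∨ i = 1 ∧ j = 1 ∨ i = 2 ∧ j = 0 := by
      omega
    · exact Submodule.mem_sup_left (tmul_mem_subTmul ((hA _ _).2 (gA.p_mem _ _))
        ((hB _ _).2 (gB.p_mem _ _)))
    · exact Submodule.mem_sup_right (tmul_mem_subTmul ((hA _ _).2 (gA.p_mem _ _))
        ((hB _ _).2 (gB.p_mem _ _)))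
    · simp [gB.p_zero, (mem_plusPart hB y).1 hy]
  have h2 : τ (b ⊗ₜ a) ∈ kunneth 𝕜 𝒜 ℬ 2 :=
    hg _ (Submodule.mem_map_of_mem (tmul_mem_kunneth hb ha rfl))
  rw [← (mem_kunneth_iff hA hB _ _).1 h2]
  have h3 := h1 (Submodule.mem_map_of_mem (tmul_mem_subTmul
    (Submodule.mem_iSup_of_mem 1 (Submodule.mem_iSup_of_mem one_pos hb))
    (Submodule.mem_iSup_of_mem 1 (Submodule.mem_iSup_of_mem one_pos ha))))
  exact (sup_le (subTmul_le fun x _ y hy => hplus x y hy) (subTmul_le fun x _ y hy => hplus x y hy) :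
    _ ≤ (subTmul 𝕜 (𝒜 0) (ℬ 2) ⊔ subTmul 𝕜 (𝒜 1) (ℬ 1)).comap (tensorProj gA gB 2)) h3

theorem Realizes.isQuadraticAlg [GradedAlgebra 𝒜] [GradedAlgebra ℬ]
    (hconnA : 𝒜 0 = (1 : Submodule 𝕜 A)) (hconnB : ℬ 0 = (1 : Submodule 𝕜 B))
    (hτ : IsGradedTwisting 𝕜 A B 𝒜 ℬ τ)
    (honesided :
      Submodule.map τ (subTmul 𝕜 (plusPart 𝕜 ℬ) (plusPart 𝕜 𝒜)) ≤
        subTmul 𝕜 (plusPart 𝕜 𝒜) (ℬ 0) ⊔ subTmul 𝕜 (plusPart 𝕜 𝒜) (plusPart 𝕜 ℬ) ∨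
      Submodule.map τ (subTmul 𝕜 (plusPart 𝕜 ℬ) (plusPart 𝕜 𝒜)) ≤
        subTmul 𝕜 (plusPart 𝕜 𝒜) (plusPart 𝕜 ℬ) ⊔ subTmul 𝕜 (𝒜 0) (plusPart 𝕜 ℬ))
    (h : Realizes 𝕜 A B τ C ψ) (hQA : IsQuadraticAlg 𝕜 A 𝒜) (hQB : IsQuadraticAlg 𝕜 B ℬ) :
    IsQuadraticAlg 𝕜 C (fun n => Submodule.map ψ (kunneth 𝕜 𝒜 ℬ n)) := by
  have := hQA.nontrivial
  have := hQB.nontrivial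
  obtain ⟨gA, hA⟩ := TTP.exists_gAlg 𝒜 hconnA
  obtain ⟨gB, hB⟩ := TTP.exists_gAlg ℬ hconnB
  set 𝒞 : ℕ → Submodule 𝕜 C := fun n => Submodule.map ψ (kunneth 𝕜 𝒜 ℬ n)
  let jA : 𝒜 1 →ₗ[𝕜] 𝒞 1 := ((h.left hτ.1).toLinearMap ∘ₗ (𝒜 1).subtype).codRestrict (𝒞 1)
    fun a => Submodule.mem_map_of_mem (tmul_mem_kunneth a.2 (SetLike.one_mem_graded ℬ) rfl)
  let jB : ℬ 1 →ₗ[𝕜] 𝒞 1 := ((h.right hτ.1).toLinearMap ∘ₗ (ℬ 1).subtype).codRestrict (𝒞 1)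
    fun b => Submodule.mem_map_of_mem (tmul_mem_kunneth (SetLike.one_mem_graded 𝒜) b.2 rfl)
  have hjA : ∀ a, (jA a : C) = h.left hτ.1 a := fun _ => rfl
  have hjB : ∀ b, (jB b : C) = h.right hτ.1 b := fun _ => rfl
  have hmul : mulMapP 𝕜 A B C (h.left hτ.1) (h.right hτ.1) = ψ := by
    ext a b
    simpa [mulMapP] using h.left_mul_right hτ.1 a b
  have hscalar : ∀ {D : Type} [Ring D] [Algebra 𝕜 D] {d : D}, d ∈ (1 : Submodule 𝕜 D) →
      ∃ c : 𝕜, d = c • 1 := by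
    intro D _ _ d hd
    rw [Submodule.one_eq_range] at hd
    obtain ⟨c, rfl⟩ := hd
    exact ⟨c, Algebra.algebraMap_eq_smul_one c⟩
  have hW : ∀ w, ∃ u v, w = jA u + jB v := by
    rintro ⟨_, x, hx, rfl⟩
    have hle : kunneth 𝕜 𝒜 ℬ 1 ≤ (LinearMap.range ((𝒞 1).subtype ∘ₗ jA) ⊔
        LinearMap.range ((𝒞 1).subtype ∘ₗ jB)).comap ψ := by
      refine kunneth_le fun i j a b hij ha hb => ?_
      obtain ⟨rfl, rfl⟩ | ⟨rfl, rfl⟩ : i = 0 ∧ j = 1 ∨ i = 1 ∧ j = 0 := by omega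
      · obtain ⟨c, rfl⟩ := hscalar (hconnA ▸ ha)
        refine Submodule.mem_sup_right ⟨c • ⟨b, hb⟩, ?_⟩
        rw [map_smul, ← TensorProduct.smul_tmul', map_smul]
        rfl
      · obtain ⟨c, rfl⟩ := hscalar (hconnB ▸ hb)
        refine Submodule.mem_sup_left ⟨c • ⟨a, ha⟩, ?_⟩
        rw [map_smul, TensorProduct.tmul_smul, map_smul]
        rfl
    obtain ⟨_, ⟨u, rfl⟩, _, ⟨v, rfl⟩, huv⟩ := Submodule.mem_sup.1 (hle hx)
    exact ⟨u, v, Subtype.ext huv.symm⟩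
  have hprod : ∀ (Q : Submodule 𝕜 (TensorAlgebra 𝕜 (𝒞 1))) (u : 𝒜 1) (v : ℬ 1),
      τ ((v : B) ⊗ₜ (u : A)) ∈ ((Q ⊓ tensorWeight 𝕜 (𝒞 1) 2).map
        (canMap 𝕜 C 𝒞).toLinearMap).comap ψ →
      ∃ y ∈ Q, TensorAlgebra.ι 𝕜 (jB v) * TensorAlgebra.ι 𝕜 (jA u) - y ∈
        idealSpan 𝕜 (TensorAlgebra 𝕜 (𝒞 1)) ((LinearMap.ker (canMap 𝕜 C 𝒞).toLinearMap ⊓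
          tensorWeight 𝕜 (𝒞 1) 2 : Submodule 𝕜 _) : Set _) := by
    rintro Q u v ⟨y, ⟨hyQ, hyW⟩, hy⟩
    refine ⟨y, hyQ, subset_idealSpan ⟨?_, sub_mem
      (mul_mem_weight (ι_mem_weight _) (ι_mem_weight _)) hyW⟩⟩
    have hy' : canMap 𝕜 C 𝒞 y = ψ (τ ((v : B) ⊗ₜ (u : A))) := hy
    change canMap 𝕜 C 𝒞 _ = 0
    rw [map_sub, map_mul, canMap_ι, canMap_ι, hy', hjA, hjB, h.right_mul_left, sub_self]
  refine isQuadraticAlg_of_range_sup (jA := jA) (jB := jB) hQA hQB hjA hjB (hmul.symm ▸ h.1) ?_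
  rcases honesided with h1 | h1
  · refine range_sup_eq_top_left jA jB _ hW fun u v => hprod _ u v ?_
    refine (show subTmul 𝕜 (𝒜 2) (ℬ 0) ⊔ subTmul 𝕜 (𝒜 1) (ℬ 1) ≤ _ from
      sup_le (subTmul_le fun a ha b hb => ?_) (subTmul_le fun a ha b hb => ?_))
      (twist_degree_two_left hA hB hτ.2 h1 u.2 v.2)
    · obtain ⟨c, rfl⟩ := hscalar (hconnB ▸ hb)
      obtain ⟨x, hx, rfl⟩ := hQA.exists_weight hA ha
      rw [TensorProduct.tmul_smul]
      refine Submodule.smul_mem _ c ⟨tensorMap jA x, ⟨Submodule.mem_sup_left ⟨x, rfl⟩,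
        tensorMap_weight jA hx⟩, canMap_tensorMap hjA x⟩
    · refine ⟨TensorAlgebra.ι 𝕜 (jA ⟨a, ha⟩) * TensorAlgebra.ι 𝕜 (jB ⟨b, hb⟩),
        ⟨Submodule.mem_sup_right (Submodule.mul_mem_mul ⟨_, tensorMap_ι _ _⟩ ⟨_, rfl⟩),
        mul_mem_weight (ι_mem_weight _) (ι_mem_weight _)⟩, ?_⟩
      change canMap 𝕜 C 𝒞 _ = _
      rw [map_mul, canMap_ι, canMap_ι, hjA, hjB, h.left_mul_right]
  · refine range_sup_eq_top_right jA jB _ hW fun u v => hprod _ u v ?_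
    refine (show subTmul 𝕜 (𝒜 0) (ℬ 2) ⊔ subTmul 𝕜 (𝒜 1) (ℬ 1) ≤ _ from
      sup_le (subTmul_le fun a ha b hb => ?_) (subTmul_le fun a ha b hb => ?_))
      (twist_degree_two_right hA hB hτ.2 h1 u.2 v.2)
    · obtain ⟨c, rfl⟩ := hscalar (hconnA ▸ ha)
      obtain ⟨x, hx, rfl⟩ := hQB.exists_weight hB hb
      rw [← TensorProduct.smul_tmul']
      refine Submodule.smul_mem _ c ⟨tensorMap jB x, ⟨Submodule.mem_sup_left ⟨x, rfl⟩,
        tensorMap_weight jB hx⟩, canMap_tensorMap hjB x⟩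
    · refine ⟨TensorAlgebra.ι 𝕜 (jA ⟨a, ha⟩) * TensorAlgebra.ι 𝕜 (jB ⟨b, hb⟩),
        ⟨Submodule.mem_sup_right (Submodule.mul_mem_mul ⟨_, rfl⟩ ⟨_, tensorMap_ι _ _⟩),
        mul_mem_weight (ι_mem_weight _) (ι_mem_weight _)⟩, ?_⟩
      change canMap 𝕜 C 𝒞 _ = _
      rw [map_mul, canMap_ι, canMap_ι, hjA, hjB, h.left_mul_right]

end Quadratic

end TTP

namespace TTP

/-- Theorem 5.3 (`oneSidedKoszul`).  Let `τ : B ⊗ A → A ⊗ B` be a one-sided graded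
twisting map, i.e. `τ(B₊ ⊗ A₊) ⊆ A₊ ⊗ B₀ ⊕ A₊ ⊗ B₊` or
`τ(B₊ ⊗ A₊) ⊆ A₊ ⊗ B₊ ⊕ A₀ ⊗ B₊`.  (1) If `A` and `B` are quadratic then the twisted
tensor product `A ⊗_τ B` is quadratic; (2) if `A` and `B` are Koszul then `A ⊗_τ B` is
Koszul.  (The twisted tensor product is encoded through realizations `(C, ψ)` of
`(A ⊗ B, μ_τ)`, with the transported Künneth grading.) -/
theorem stmt10 (𝕜 : Type) [Field 𝕜] (A B : Type) [Ring A] [Algebra 𝕜 A] [Ring B] [Algebra 𝕜 B]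
    (𝒜 : ℕ → Submodule 𝕜 A) (ℬ : ℕ → Submodule 𝕜 B)
    [GradedAlgebra 𝒜] [GradedAlgebra ℬ]
    (hconnA : 𝒜 0 = (1 : Submodule 𝕜 A)) (hconnB : ℬ 0 = (1 : Submodule 𝕜 B))
    (hlfA : ∀ n, Module.Finite 𝕜 ↥(𝒜 n)) (hlfB : ∀ n, Module.Finite 𝕜 ↥(ℬ n))
    (τ : B ⊗[𝕜] A →ₗ[𝕜] A ⊗[𝕜] B)
    (hτ : IsGradedTwisting 𝕜 A B 𝒜 ℬ τ)
    (honesided :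
      Submodule.map τ (subTmul 𝕜 (plusPart 𝕜 ℬ) (plusPart 𝕜 𝒜)) ≤
        subTmul 𝕜 (plusPart 𝕜 𝒜) (ℬ 0) ⊔ subTmul 𝕜 (plusPart 𝕜 𝒜) (plusPart 𝕜 ℬ) ∨
      Submodule.map τ (subTmul 𝕜 (plusPart 𝕜 ℬ) (plusPart 𝕜 𝒜)) ≤
        subTmul 𝕜 (plusPart 𝕜 𝒜) (plusPart 𝕜 ℬ) ⊔ subTmul 𝕜 (𝒜 0) (plusPart 𝕜 ℬ)) :
    (IsQuadraticAlg 𝕜 A 𝒜 → IsQuadraticAlg 𝕜 B ℬ →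
      ∀ (C : Type) [Ring C] [Algebra 𝕜 C], ∀ ψ : A ⊗[𝕜] B →ₗ[𝕜] C,
        Realizes 𝕜 A B τ C ψ →
        IsQuadraticAlg 𝕜 C (fun n => Submodule.map ψ (kunneth 𝕜 𝒜 ℬ n))) ∧
    (IsKoszul 𝕜 A 𝒜 → IsKoszul 𝕜 B ℬ →
      ∀ (C : Type) [Ring C] [Algebra 𝕜 C], ∀ ψ : A ⊗[𝕜] B →ₗ[𝕜] C,
        Realizes 𝕜 A B τ C ψ →
        IsKoszul 𝕜 C (fun n => Submodule.map ψ (kunneth 𝕜 𝒜 ℬ n))) := by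
  refine ⟨fun hQA hQB C _ _ ψ h => h.isQuadraticAlg hconnA hconnB hτ honesided hQA hQB,
    fun hKA hKB C _ _ ψ h => ?_⟩
  rcases subsingleton_or_nontrivial A with hA | hA
  · have : Subsingleton (A ⊗[𝕜] B) := inferInstance
    have : Subsingleton C := h.1.2.subsingleton
    exact isKoszul_of_subsingleton _
  · rcases subsingleton_or_nontrivial B with hB | hB
    · have : Subsingleton (A ⊗[𝕜] B) := inferInstance
      have : Subsingleton C := h.1.2.subsingleton
      exact isKoszul_of_subsingleton _
    · exact h.isKoszul hconnA hconnB hτ honesided hKA hKB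

end TTP
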